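/- arXiv:1106.0769 — 5 statements merged into one kernel-verified Lean document; each statement's English description precedes it below -/
import Mathlib

section
/- Let G be a finite simple graph on n vertices and let 1 ≤ m ≤ n−1. If the complement Ḡ of G is not the disjoint union K_m + (n−m)K_1 of a complete graph on m vertices with n−m isolated vertices, then λ_{m+1}(G) ≤ d_m(G) + m − 1, where λ_{m+1}(G) is the (m+1)-th smallest Laplacian eigenvalue of G and d_m(G) is the m-th smallest vertex degree of G. -/
/-- `G` is (up to relabeling of vertices) the disjoint union of a complete graph on the
`r` vertices of a set `S` with the remaining vertices isolated. -/
def IsCliquePlusIsolated {V : Type*} [Fintype V] (G : SimpleGraph V) (r : ℕ) : Prop :=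
  ∃ S : Finset V, S.card = r ∧ ∀ u v : V, G.Adj u v ↔ u ≠ v ∧ u ∈ S ∧ v ∈ S

open Finset Matrix in
theorem cf_aux {n : ℕ} (A : Matrix (Fin n) (Fin n) ℝ) (hA : A.IsHermitian) :
    ∃ M : Matrix (Fin n) (Fin n) ℝ, 
      (∀ x : Fin n → ℝ, x ⬝ᵥ (A *ᵥ x) = ∑ i, hA.eigenvalues i * (M *ᵥ x) i ^ 2) ∧
      (∀ x : Fin n → ℝ, x ⬝ᵥ x = ∑ i, (M *ᵥ x) i ^ 2) := by
  set U : Matrix (Fin n) (Fin n) ℝ := hA.eigenvectorUnitary.1 with hU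
  have h1 : A = U * diagonal hA.eigenvalues * Uᵀ := by
    conv_lhs => rw [hA.spectral_theorem]
    rw [Unitary.conjStarAlgAut_apply]
    rfl
  have h2 : U * Uᵀ = 1 := by
    have := Unitary.coe_mul_star_self hA.eigenvectorUnitary
    exact this
  refine ⟨Uᵀ, fun x => ?_, fun x => ?_⟩
  · conv_lhs => rw [h1]
    rw [← mulVec_mulVec, ← mulVec_mulVec, dotProduct_mulVec, ← mulVec_transpose]
    simp only [dotProduct, mulVec_diagonal]
    exact sum_congr rfl fun i _ => by ring
  · have : x ⬝ᵥ x = x ⬝ᵥ ((U * Uᵀ) *ᵥ x) := by rw [h2, one_mulVec]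
    rw [this, ← mulVec_mulVec, dotProduct_mulVec, ← mulVec_transpose]
    simp only [dotProduct]
    exact sum_congr rfl fun i _ => by ring

theorem perm_of_multiset {n : ℕ} {α : Type*} [LinearOrder α] (f g : Fin n → α)
    (h : Finset.univ.val.map f = Finset.univ.val.map g) (hf : Monotone f) :
    ∃ σ : Equiv.Perm (Fin n), ∀ i, f i = g (σ i) := by
  refine ⟨Tuple.sort g, ?_⟩
  have hg : Monotone (g ∘ Tuple.sort g) := Tuple.monotone_sort g
  have hm : Finset.univ.val.map f = Finset.univ.val.map (g ∘ Tuple.sort g) := by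
    rw [h, ← Multiset.map_map]
    congr 1
    have := Finset.map_univ_equiv (Tuple.sort g)
    conv_lhs => rw [← this]
    rfl
  have hl : List.ofFn f = List.ofFn (g ∘ Tuple.sort g) := by
    rw [Fin.univ_val_map, Fin.univ_val_map, Multiset.coe_eq_coe] at hm
    exact hm.eq_of_pairwise' hf.sortedLE_ofFn.pairwise hg.sortedLE_ofFn.pairwise
  intro i
  exact congrFun (List.ofFn_injective hl) i

open Finset Matrix in
theorem cf {n m : ℕ} (hmn : m < n) (A : Matrix (Fin n) (Fin n) ℝ) (hA : A.IsHermitian)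
    (eigs : Fin n → ℝ) (heigs : Monotone eigs)
    (hroots : A.charpoly.roots = Finset.univ.val.map eigs)
    {P : Type*} [AddCommGroup P] [Module ℝ P] [FiniteDimensional ℝ P]
    (hP : m < Module.finrank ℝ P) (Φ : P →ₗ[ℝ] (Fin n → ℝ)) (hΦ : ∀ p, Φ p = 0 → p = 0)
    (B : ℝ) (hB : ∀ p, Φ p ⬝ᵥ (A *ᵥ Φ p) ≤ B * (Φ p ⬝ᵥ Φ p)) :
    eigs ⟨m, hmn⟩ ≤ B := by
  obtain ⟨M, h1, h2⟩ := cf_aux A hA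
  rw [hA.roots_charpoly_eq_eigenvalues] at hroots
  obtain ⟨σ, hσ⟩ := perm_of_multiset eigs _ hroots.symm heigs
  have hσ' : ∀ i, hA.eigenvalues (σ i) = eigs i := fun i => (hσ i).symm
  let Ψ : P →ₗ[ℝ] (Fin m → ℝ) :=
    (LinearMap.funLeft ℝ ℝ (fun i : Fin m => σ (Fin.castLE hmn.le i))) ∘ₗ (M.mulVecLin ∘ₗ Φ)
  have hker : LinearMap.ker Ψ ≠ ⊥ := Ψ.ker_ne_bot_of_finrank_lt (by simpa using hP)
  obtain ⟨p, hp, hp0⟩ := (Submodule.ne_bot_iff _).1 hker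
  have hz : ∀ i : Fin n, i.1 < m → (M *ᵥ Φ p) (σ i) = 0 := by
    intro i hi
    have := congrFun (LinearMap.mem_ker.1 hp) ⟨i, hi⟩
    simpa [Ψ, LinearMap.funLeft] using this
  have hx : Φ p ≠ 0 := fun h => hp0 (hΦ p h)
  have hpos : 0 < Φ p ⬝ᵥ Φ p := by
    have : 0 ≤ Φ p ⬝ᵥ Φ p := by 
      rw [h2]; positivity
    exact lt_of_le_of_ne this (fun h => hx (dotProduct_self_eq_zero.1 h.symm))
  have hge : eigs ⟨m, hmn⟩ * (Φ p ⬝ᵥ Φ p) ≤ Φ p ⬝ᵥ (A *ᵥ Φ p) := by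
    rw [h1, h2, mul_sum, ← Equiv.sum_comp σ, ← Equiv.sum_comp σ (fun i => hA.eigenvalues i * _)]
    refine sum_le_sum fun i _ => ?_
    rw [hσ']
    by_cases hi : i.1 < m
    · rw [hz i hi]; simp
    · exact mul_le_mul_of_nonneg_right (heigs (by simpa [Fin.le_def] using hi)) (sq_nonneg _)
  exact le_of_mul_le_mul_right (hge.trans (hB p)) hpos

/-- The Laplacian quadratic form. -/
noncomputable def lapForm {n : ℕ} (H : SimpleGraph (Fin n)) [DecidableRel H.Adj]
    (x : Fin n → ℝ) : ℝ :=
  (∑ i, ∑ j, if H.Adj i j then (x i - x j) ^ 2 else 0) / 2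

open Finset in
theorem sum_sq_diff {ι : Type*} (A : Finset ι) (x : ι → ℝ) :
    (∑ i ∈ A, ∑ j ∈ A, (x i - x j) ^ 2) / 2 = #A * ∑ i ∈ A, x i ^ 2 - (∑ i ∈ A, x i) ^ 2 := by
  have : ∀ i ∈ A, ∑ j ∈ A, (x i - x j) ^ 2
      = #A * x i ^ 2 - 2 * x i * (∑ j ∈ A, x j) + ∑ j ∈ A, x j ^ 2 := by
    intro i _
    simp only [sub_sq, sum_add_distrib, sum_sub_distrib, sum_const, nsmul_eq_mul, mul_sum]
  rw [sum_congr rfl this]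
  simp only [sum_add_distrib, sum_sub_distrib, sum_const, nsmul_eq_mul, ← mul_sum, ← sum_mul]
  ring

theorem lapForm_nonneg {n : ℕ} (H : SimpleGraph (Fin n)) [DecidableRel H.Adj]
    (x : Fin n → ℝ) : 0 ≤ lapForm H x := by
  unfold lapForm; positivity

theorem lapForm_add_const {n : ℕ} (H : SimpleGraph (Fin n)) [DecidableRel H.Adj]
    (x : Fin n → ℝ) (a : ℝ) : lapForm H (fun i => x i + a) = lapForm H x := by
  unfold lapForm; simp

open Finset in
theorem lapForm_compl {n : ℕ} (H : SimpleGraph (Fin n)) [DecidableRel H.Adj]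
    (x : Fin n → ℝ) :
    lapForm H x + lapForm Hᶜ x = n * ∑ i, x i ^ 2 - (∑ i, x i) ^ 2 := by
  have := sum_sq_diff univ x
  rw [card_univ, Fintype.card_fin] at this
  rw [← this]
  unfold lapForm
  rw [← add_div, ← sum_add_distrib]
  congr 1
  refine sum_congr rfl fun i _ => ?_
  rw [← sum_add_distrib]
  refine sum_congr rfl fun j _ => ?_
  by_cases h : i = j
  · subst h; simp
  · by_cases h' : H.Adj i j <;> simp [h, h']

open Finset Matrix in
theorem core {n m : ℕ} (hm : 1 ≤ m) (hmn : m < n)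
    (G : SimpleGraph (Fin n)) [DecidableRel G.Adj]
    (eigs : Fin n → ℝ) (heigs : Monotone eigs)
    (hroots : (G.lapMatrix ℝ).charpoly.roots = Finset.univ.val.map eigs)
    (R K : Finset (Fin n)) (hR : #R = m) (hRK : Disjoint R K) (γ β : ℝ) (hβ : 0 < β)
    (hQ : ∀ x : Fin n → ℝ, (∀ i ∈ K, x i = γ * ∑ j ∈ R, x j) → (∀ i, i ∉ R → i ∉ K → x i = 0) →
      β * ∑ i, x i ^ 2 ≤ lapForm Gᶜ x) :
    eigs ⟨m, hmn⟩ ≤ n - β := by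
  classical
  let Ψ : (R → ℝ) →ₗ[ℝ] (Fin n → ℝ) :=
    { toFun := fun p i => if h : i ∈ R then p ⟨i, h⟩ else if i ∈ K then γ * ∑ j, p j else 0
      map_add' := by
        intro p q; ext i
        simp only [Pi.add_apply, sum_add_distrib]
        split_ifs <;> ring
      map_smul' := by
        intro c p; ext i
        simp only [Pi.smul_apply, smul_eq_mul, ← mul_sum, RingHom.id_apply]
        split_ifs <;> ring }
  have hΨR : ∀ p (i : R), Ψ p i = p i := by
    intro p i; simp [Ψ]
  have hΨ0 : ∀ p, Ψ p = 0 → p = 0 := by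
    intro p h; ext i; rw [← hΨR p i, h]; rfl
  have hsum : ∀ p, ∑ j ∈ R, Ψ p j = ∑ j, p j := by
    intro p
    rw [← sum_coe_sort R (fun j => Ψ p j)]
    exact sum_congr rfl fun i _ => hΨR p i
  have hQ' : ∀ p, β * ∑ i, Ψ p i ^ 2 ≤ lapForm Gᶜ (Ψ p) := by
    intro p
    refine hQ _ ?_ ?_
    · intro i hi
      rw [hsum]
      have : i ∉ R := fun h => (disjoint_left.1 hRK h hi)
      simp [Ψ, this, hi]
    · intro i h1 h2; simp [Ψ, h1, h2]
  have hpos : ∀ p, p ≠ 0 → 0 < ∑ i, Ψ p i ^ 2 := by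
    intro p hp
    have hne : Ψ p ≠ 0 := fun h => hp (hΨ0 p h)
    obtain ⟨i, hi⟩ := Function.ne_iff.1 hne
    exact sum_pos' (fun _ _ => sq_nonneg _) ⟨i, mem_univ _, by simpa using sq_pos_of_ne_zero hi⟩
  have hβn : β ≤ n := by
    obtain ⟨r, hr⟩ : R.Nonempty := card_pos.1 (by omega)
    have hp : (fun _ => 1 : R → ℝ) ≠ 0 := fun h => by simpa using congrFun h ⟨r, hr⟩
    have h1 := hpos _ hp
    have h2 := hQ' (fun _ => 1)
    have h3 := lapForm_compl G (Ψ (fun _ => 1))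
    have h4 := lapForm_nonneg G (Ψ (fun _ => 1))
    refine le_of_mul_le_mul_right ?_ h1
    nlinarith [sq_nonneg (∑ i, Ψ (fun _ => 1) i)]
  let Φ : ((R → ℝ) × ℝ) →ₗ[ℝ] (Fin n → ℝ) :=
    { toFun := fun p i => Ψ p.1 i + p.2
      map_add' := by
        intro p q; ext i; simp; ring
      map_smul' := by
        intro c p; ext i; simp; ring }
  have hform : ∀ p, lapForm G (Φ p) = lapForm G (Ψ p.1) := fun p => lapForm_add_const G _ _
  have hform' : ∀ p, lapForm Gᶜ (Φ p) = lapForm Gᶜ (Ψ p.1) := fun p => lapForm_add_const Gᶜ _ _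
  refine cf hmn _ (G.isHermitian_lapMatrix ℝ) eigs heigs hroots (P := (R → ℝ) × ℝ) ?_ Φ ?_ _ ?_
  · simp [hR]
  · intro p hp
    have h0 : lapForm Gᶜ (Ψ p.1) = 0 := by
      rw [← hform', hp]; simp [lapForm]
    have h1 : p.1 = 0 := by
      by_contra hne
      have := mul_pos hβ (hpos _ hne)
      linarith [hQ' p.1]
    have h2 : p.2 = 0 := by
      have := congrFun hp ⟨m, hmn⟩
      simpa [Φ, h1] using this
    exact Prod.ext h1 h2
  · intro p
    have e1 : Φ p ⬝ᵥ (G.lapMatrix ℝ *ᵥ Φ p) = lapForm G (Φ p) := by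
      rw [← toLinearMap₂'_apply', SimpleGraph.lapMatrix_toLinearMap₂']; rfl
    rw [e1, hform]
    have h3 := lapForm_compl G (Ψ p.1)
    have h4 := hQ' p.1
    have e2 : Φ p ⬝ᵥ Φ p = ∑ i, Ψ p.1 i ^ 2 + 2 * p.2 * ∑ i, Ψ p.1 i + n * p.2 ^ 2 := by
      simp only [dotProduct, Φ, LinearMap.coe_mk, AddHom.coe_mk, mul_sum]
      rw [← sum_add_distrib]
      have : (n : ℝ) * p.2 ^ 2 = ∑ i : Fin n, p.2 ^ 2 := by simp
      rw [this, ← sum_add_distrib]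
      exact sum_congr rfl fun i _ => by ring
    rw [e2]
    set s := ∑ i, Ψ p.1 i
    set a := p.2
    have : 0 ≤ s ^ 2 + 2 * (n - β) * a * s + (n - β) * n * a ^ 2 := by
      have h5 : 0 ≤ (n - β) * β * a ^ 2 :=
        mul_nonneg (mul_nonneg (by linarith) hβ.le) (sq_nonneg _)
      nlinarith [sq_nonneg (s + (n - β) * a)]
    nlinarith

open Finset in
theorem lapForm_lower {n : ℕ} (H : SimpleGraph (Fin n)) [DecidableRel H.Adj]
    (S : Finset (Fin n)) (F : Fin n → Finset (Fin n))
    (hF : ∀ s ∈ S, ∀ j ∈ F s, H.Adj s j ∧ j ∉ S) (x : Fin n → ℝ) :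
    (∑ i ∈ S, ∑ j ∈ S, if H.Adj i j then (x i - x j) ^ 2 else 0) / 2
      + ∑ s ∈ S, ∑ j ∈ F s, (x s - x j) ^ 2 ≤ lapForm H x := by
  unfold lapForm
  set g : Fin n → Fin n → ℝ := fun i j => if H.Adj i j then (x i - x j) ^ 2 else 0 with hg
  have hg0 : ∀ i j, 0 ≤ g i j := by intro i j; simp only [hg]; positivity
  have hsymm : ∀ i j, g i j = g j i := by
    intro i j; simp only [hg, H.adj_comm i j]; congr 1; ring
  have h1 : ∑ i, ∑ j, g i j = ∑ i ∈ S, ∑ j ∈ S, g i j + ∑ i ∈ S, ∑ j ∈ Sᶜ, g i j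
      + (∑ i ∈ Sᶜ, ∑ j ∈ S, g i j + ∑ i ∈ Sᶜ, ∑ j ∈ Sᶜ, g i j) := by
    rw [← sum_add_sum_compl S, ← sum_add_distrib, ← sum_add_distrib]
    congr 1 <;> exact sum_congr rfl fun i _ => (sum_add_sum_compl S _).symm
  have h2 : ∑ i ∈ Sᶜ, ∑ j ∈ S, g i j = ∑ i ∈ S, ∑ j ∈ Sᶜ, g i j := by
    rw [sum_comm]
    exact sum_congr rfl fun i _ => sum_congr rfl fun j _ => hsymm _ _
  have h3 : 0 ≤ ∑ i ∈ Sᶜ, ∑ j ∈ Sᶜ, g i j := sum_nonneg fun i _ => sum_nonneg fun j _ => hg0 i j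
  have h4 : ∑ s ∈ S, ∑ j ∈ F s, (x s - x j) ^ 2 ≤ ∑ i ∈ S, ∑ j ∈ Sᶜ, g i j := by
    refine sum_le_sum fun s hs => ?_
    calc ∑ j ∈ F s, (x s - x j) ^ 2 = ∑ j ∈ F s, g s j := by
          refine sum_congr rfl fun j hj => ?_
          simp [hg, (hF s hs j hj).1]
      _ ≤ ∑ j ∈ Sᶜ, g s j := by
          refine sum_le_sum_of_subset_of_nonneg ?_ fun j _ _ => hg0 s j
          intro j hj
          simpa using (hF s hs j hj).2
  change (∑ i ∈ S, ∑ j ∈ S, g i j) / 2 + _ ≤ (∑ i, ∑ j, g i j) / 2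
  linarith

open Finset in
theorem lapForm_lower' {n : ℕ} (H : SimpleGraph (Fin n)) [DecidableRel H.Adj]
    (S T : Finset (Fin n)) (hT : T ⊆ S) (F : Fin n → Finset (Fin n))
    (hF : ∀ s ∈ S, ∀ j ∈ F s, H.Adj s j ∧ j ∉ S)
    (hU : ∀ u ∈ S, u ∉ T → ∀ s ∈ S, s ≠ u → H.Adj u s) (x : Fin n → ℝ) :
    (#S * ∑ i ∈ S, x i ^ 2 - (∑ i ∈ S, x i) ^ 2) - (#T * ∑ i ∈ T, x i ^ 2 - (∑ i ∈ T, x i) ^ 2)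
      + ∑ s ∈ S, ∑ j ∈ F s, (x s - x j) ^ 2 ≤ lapForm H x := by
  refine le_trans ?_ (lapForm_lower H S F hF x)
  rw [← sum_sq_diff, ← sum_sq_diff, ← sub_div]
  have hTT : ∑ i ∈ T, ∑ j ∈ T, (x i - x j) ^ 2
      = ∑ i ∈ S, ∑ j ∈ S, if i ∈ T ∧ j ∈ T then (x i - x j) ^ 2 else 0 := by
    rw [← sum_subset hT]
    · refine sum_congr rfl fun i hi => ?_
      rw [← sum_subset hT]
      · exact sum_congr rfl fun j hj => by simp [hi, hj]
      · intro j _ hj; simp [hj]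
    · intro i _ hi; simp [hi]
  rw [hTT]
  simp only [← sum_sub_distrib]
  gcongr with i hi j hj
  by_cases hij : i = j
  · subst hij; simp
  by_cases h1 : i ∈ T
  · by_cases h2 : j ∈ T
    · simp only [h1, h2, and_self, if_true, sub_self]; positivity
    · have := (hU j hj h2 i hi hij).symm
      simp [h2, this]
  · have := hU i hi h1 j hj (Ne.symm hij)
    simp [h1, this]

theorem alg2 (m e k y X Z c q : ℝ) (hm : 0 < m) (hk : 0 < k) (hkm : k ≤ e * m)
    (hZ : X + y = Z) (hc : k * c = -Z) :
    (e + 1) * (y ^ 2 + q + k * c ^ 2) ≤ m * (y ^ 2 + q) - Z ^ 2 - ((m - 1) * q - X ^ 2)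
      + e * (y ^ 2 + q - 2 * c * Z + m * c ^ 2) := by
  obtain rfl : Z = -(k * c) := by linarith
  obtain rfl : X = -(k * c) - y := by linarith
  rw [← sub_nonneg]
  refine nonneg_of_mul_nonneg_right (a := m) ?_ hm
  have h : 0 ≤ c ^ 2 * ((k + m) * (e * m - k)) :=
    mul_nonneg (sq_nonneg _) (mul_nonneg (by linarith) (by linarith))
  nlinarith [sq_nonneg (m * y + k * c)]

theorem alg3 (u t k Y X c p q : ℝ) (hu : 1 ≤ u) (ht : 1 ≤ t) (hk : 1 ≤ k) (hkt : k ≤ t)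
    (hp : Y ^ 2 ≤ u * p) (hq : X ^ 2 ≤ t * q) (hc : k * c = -(X + Y)) :
    p + q + k * c ^ 2 ≤ (u + t) * (p + q) - (X + Y) ^ 2 - (t * q - X ^ 2)
      + (q - 2 * c * X + t * c ^ 2) := by
  have hk0 : k ≠ 0 := by linarith
  obtain ⟨i, hi⟩ : ∃ i, i * k = 1 := ⟨k⁻¹, inv_mul_cancel₀ hk0⟩
  have hi0 : 0 < i := by by_contra h; nlinarith
  have hi1 : i ≤ 1 := by nlinarith
  have hit : 1 ≤ i * t := by nlinarith
  have hcc : c = -i * (X + Y) := by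
    have : i * (k * c) = c := by rw [← mul_assoc, hi, one_mul]
    rw [← this, hc]; ring
  have hkc : 0 ≤ (t - k) * c ^ 2 := mul_nonneg (by linarith) (sq_nonneg _)
  -- main part
  have key : 0 ≤ (u + t - 1) * p + u * q + X ^ 2 - 2 * c * X - (X + Y) ^ 2 := by
    have hut : 0 < u * t := by positivity
    refine nonneg_of_mul_nonneg_right (a := u * t) ?_ hut
    have h1 : (u + t - 1) * t * Y ^ 2 ≤ (u + t - 1) * t * (u * p) :=
      mul_le_mul_of_nonneg_left hp (mul_nonneg (by linarith) (by linarith))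
    have h2 : u * u * X ^ 2 ≤ u * u * (t * q) :=
      mul_le_mul_of_nonneg_left hq (by positivity)
    have h3 : 0 ≤ (t * (t - 1) - t ^ 2 * (1 - i) ^ 2) * Y ^ 2 := by
      refine mul_nonneg ?_ (sq_nonneg _)
      have : (1 - i) ^ 2 ≤ 1 - i := by nlinarith
      have := mul_le_mul_of_nonneg_left this (sq_nonneg t)
      nlinarith
    have h4 : 0 ≤ 2 * i * (u * t) * X ^ 2 := by positivity
    rw [hcc]
    nlinarith [sq_nonneg (u * X - t * (1 - i) * Y)]
  have hk2 : 0 ≤ (t - k) * c ^ 2 := hkc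
  nlinarith

open Finset in
theorem sum_sq_split {n : ℕ} (S K : Finset (Fin n)) (hSK : Disjoint S K) (x : Fin n → ℝ) (c : ℝ)
    (hK : ∀ i ∈ K, x i = c) (h0 : ∀ i, i ∉ S → i ∉ K → x i = 0) :
    ∑ i, x i ^ 2 = ∑ i ∈ S, x i ^ 2 + #K * c ^ 2 := by
  have h1 : ∑ i, x i ^ 2 = ∑ i ∈ S ∪ K, x i ^ 2 := by
    symm
    refine sum_subset (subset_univ _) fun i _ hi => ?_
    rw [mem_union, not_or] at hi
    rw [h0 i hi.1 hi.2]; simp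
  have h2 : ∑ i ∈ K, x i ^ 2 = ∑ _i ∈ K, c ^ 2 := sum_congr rfl fun i hi => by rw [hK i hi]
  rw [h1, sum_union hSK, h2]
  simp

open Finset in
theorem case_principal {n : ℕ} (H : SimpleGraph (Fin n)) [DecidableRel H.Adj]
    (R : Finset (Fin n)) (b : ℕ) (hR : ∀ s ∈ R, b ≤ #(H.neighborFinset s \ R))
    (x : Fin n → ℝ) (h0 : ∀ i, i ∉ R → x i = 0) :
    (b : ℝ) * ∑ i, x i ^ 2 ≤ lapForm H x := by
  have h := lapForm_lower H R (fun s => H.neighborFinset s \ R)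
    (fun s _ j hj => by simpa using hj) x
  refine le_trans ?_ h
  rw [sum_sq_split R ∅ (disjoint_empty_right _) x 0 (by simp) (fun i hi _ => h0 i hi), mul_add,
    mul_sum]
  have h1 : 0 ≤ (∑ i ∈ R, ∑ j ∈ R, if H.Adj i j then (x i - x j) ^ 2 else 0) / 2 := by positivity
  have h2 : ∑ i ∈ R, (b : ℝ) * x i ^ 2
      ≤ ∑ s ∈ R, ∑ j ∈ H.neighborFinset s \ R, (x s - x j) ^ 2 := by
    refine sum_le_sum fun s hs => ?_
    have : ∀ j ∈ H.neighborFinset s \ R, (x s - x j) ^ 2 = x s ^ 2 := by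
      intro j hj
      rw [h0 j (mem_sdiff.1 hj).2, sub_zero]
    rw [sum_congr rfl this, sum_const, nsmul_eq_mul]
    exact mul_le_mul_of_nonneg_right (by exact_mod_cast hR s hs) (sq_nonneg _)
  simp only [card_empty, Nat.cast_zero, zero_mul, mul_zero, add_zero]
  linarith

open Finset in
theorem case_full {n : ℕ} (H : SimpleGraph (Fin n)) [DecidableRel H.Adj]
    (S : Finset (Fin n)) (e : ℕ) (he : 1 ≤ e) (u : Fin n) (hu : u ∈ S)
    (hfull : ∀ s ∈ S, s ≠ u → H.Adj u s) (F : Fin n → Finset (Fin n))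
    (hF : ∀ s ∈ S, ∀ j ∈ F s, H.Adj s j ∧ j ∉ S) (hFc : ∀ s ∈ S, #(F s) = e)
    (x : Fin n → ℝ) 
    (hK : ∀ i ∈ S.biUnion F, x i = (-(#(S.biUnion F) : ℝ)⁻¹) * ∑ j ∈ S, x j)
    (h0 : ∀ i, i ∉ S → i ∉ S.biUnion F → x i = 0) :
    ((e : ℝ) + 1) * ∑ i, x i ^ 2 ≤ lapForm H x := by
  have hdisj : Disjoint S (S.biUnion F) := by
    rw [disjoint_left]
    intro i hi hi'
    obtain ⟨s, hs, hj⟩ := mem_biUnion.1 hi'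
    exact (hF s hs i hj).2 hi
  set K := S.biUnion F with hKdef
  set c := (-(#K : ℝ)⁻¹) * ∑ j ∈ S, x j with hc
  have hkpos : 0 < #K := by
    obtain ⟨j, hj⟩ : (F u).Nonempty := card_pos.1 (by rw [hFc u hu]; omega)
    exact card_pos.2 ⟨j, mem_biUnion.2 ⟨u, hu, hj⟩⟩
  have hkle : #K ≤ e * #S := by
    have := card_biUnion_le_card_mul S F e (fun s hs => (hFc s hs).le)
    rwa [mul_comm] at this
  have h := lapForm_lower' H S (S.erase u) (erase_subset _ _) F hF (by
    intro v hv hvT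
    have : v = u := by by_contra hne; exact hvT (mem_erase.2 ⟨hne, hv⟩)
    subst this
    exact hfull) x
  refine le_trans ?_ h
  rw [sum_sq_split S K hdisj x c hK h0]
  have hm1 : 1 ≤ #S := card_pos.2 ⟨u, hu⟩
  have hcard : (#(S.erase u) : ℝ) = #S - 1 := by
    rw [card_erase_of_mem hu, Nat.cast_sub hm1]; simp
  have hFsum : ∑ s ∈ S, ∑ j ∈ F s, (x s - x j) ^ 2
      = e * (∑ i ∈ S, x i ^ 2 - 2 * c * ∑ i ∈ S, x i + #S * c ^ 2) := by
    have : ∀ s ∈ S, ∑ j ∈ F s, (x s - x j) ^ 2 = e * (x s ^ 2 - 2 * c * x s + c ^ 2) := by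
      intro s hs
      have h1 : ∀ j ∈ F s, (x s - x j) ^ 2 = x s ^ 2 - 2 * c * x s + c ^ 2 := by
        intro j hj
        rw [hK j (mem_biUnion.2 ⟨s, hs, hj⟩)]; ring
      rw [sum_congr rfl h1, sum_const, hFc s hs, nsmul_eq_mul]
    rw [sum_congr rfl this, ← mul_sum, sum_add_distrib, sum_sub_distrib, ← mul_sum]
    simp
  rw [hFsum, hcard]
  have e1 : ∑ i ∈ S, x i ^ 2 = x u ^ 2 + ∑ i ∈ S.erase u, x i ^ 2 := (add_sum_erase S _ hu).symm
  have e2 : ∑ i ∈ S.erase u, x i + x u = ∑ i ∈ S, x i := sum_erase_add S _ hu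
  rw [e1]
  refine alg2 #S e #K (x u) (∑ i ∈ S.erase u, x i) (∑ i ∈ S, x i) c _ ?_ ?_ ?_ e2 ?_
  · exact_mod_cast hm1
  · exact_mod_cast hkpos
  · exact_mod_cast hkle
  · rw [hc, ← mul_assoc, mul_neg, mul_inv_cancel₀ (by exact_mod_cast hkpos.ne')]; ring

open Finset in
theorem case_mixed {n : ℕ} (H : SimpleGraph (Fin n)) [DecidableRel H.Adj]
    (S T : Finset (Fin n)) (hTS : T ⊆ S) (hT : T.Nonempty) (hU : (S \ T).Nonempty)
    (hfull : ∀ u ∈ S, u ∉ T → ∀ s ∈ S, s ≠ u → H.Adj u s) (f : Fin n → Fin n)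
    (hf : ∀ s ∈ T, H.Adj s (f s) ∧ f s ∉ S)
    (x : Fin n → ℝ) 
    (hK : ∀ i ∈ T.image f, x i = (-(#(T.image f) : ℝ)⁻¹) * ∑ j ∈ S, x j)
    (h0 : ∀ i, i ∉ S → i ∉ T.image f → x i = 0) :
    (1 : ℝ) * ∑ i, x i ^ 2 ≤ lapForm H x := by
  have hdisj : Disjoint S (T.image f) := by
    rw [disjoint_left]
    intro i hi hi'
    obtain ⟨s, hs, rfl⟩ := mem_image.1 hi'
    exact (hf s hs).2 hi
  set K := T.image f with hKdef
  set c := (-(#K : ℝ)⁻¹) * ∑ j ∈ S, x j with hc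
  have hkpos : 0 < #K := card_pos.2 (hT.image f)
  have hkle : #K ≤ #T := card_image_le
  have h := lapForm_lower' H S T hTS (fun s => if s ∈ T then {f s} else ∅) (by
    intro s hs j hj
    by_cases hsT : s ∈ T
    · simp only [hsT, if_true, mem_singleton] at hj
      subst hj
      exact hf s hsT
    · simp [hsT] at hj) hfull x
  refine le_trans ?_ h
  rw [sum_sq_split S K hdisj x c hK h0]
  have hFsum : ∑ s ∈ S, ∑ j ∈ (if s ∈ T then {f s} else ∅), (x s - x j) ^ 2
      = ∑ i ∈ T, x i ^ 2 - 2 * c * ∑ i ∈ T, x i + #T * c ^ 2 := by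
    rw [← sum_subset hTS (by intro s _ hs; simp [hs])]
    have : ∀ s ∈ T, ∑ j ∈ (if s ∈ T then {f s} else ∅), (x s - x j) ^ 2
        = x s ^ 2 - 2 * c * x s + c ^ 2 := by
      intro s hs
      simp only [hs, if_true, sum_singleton]
      rw [hK _ (mem_image_of_mem f hs)]; ring
    rw [sum_congr rfl this, sum_add_distrib, sum_sub_distrib, ← mul_sum]
    simp
  rw [hFsum]
  have e1 : ∑ i ∈ S, x i ^ 2 = ∑ i ∈ S \ T, x i ^ 2 + ∑ i ∈ T, x i ^ 2 := (sum_sdiff hTS).symm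
  have e2 : ∑ i ∈ S, x i = ∑ i ∈ T, x i + ∑ i ∈ S \ T, x i := by
    rw [add_comm]; exact (sum_sdiff hTS).symm
  have e3 : (#S : ℝ) = #(S \ T) + #T := by exact_mod_cast (card_sdiff_add_card_eq_card hTS).symm
  have hkc : #K * c = -(∑ i ∈ T, x i + ∑ i ∈ S \ T, x i) := by
    rw [← e2, hc, ← mul_assoc, mul_neg, mul_inv_cancel₀ (by exact_mod_cast hkpos.ne')]; ring
  rw [e1, e2, e3, one_mul]
  refine alg3 #(S \ T) #T #K (∑ i ∈ S \ T, x i) (∑ i ∈ T, x i) c _ _ ?_ ?_ ?_ ?_ ?_ ?_ hkc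
  · exact_mod_cast card_pos.2 hU
  · exact_mod_cast card_pos.2 hT
  · exact_mod_cast hkpos
  · exact_mod_cast hkle
  · exact sq_sum_le_card_mul_sum_sq
  · exact sq_sum_le_card_mul_sum_sq

open Finset Matrix in
theorem eig_le_n {n m : ℕ} (hmn : m < n)
    (G : SimpleGraph (Fin n)) [DecidableRel G.Adj]
    (eigs : Fin n → ℝ) (heigs : Monotone eigs)
    (hroots : (G.lapMatrix ℝ).charpoly.roots = Finset.univ.val.map eigs) :
    eigs ⟨m, hmn⟩ ≤ n := by
  refine cf hmn _ (G.isHermitian_lapMatrix ℝ) eigs heigs hroots (P := Fin n → ℝ)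
    (by simpa using hmn) LinearMap.id (fun p hp => hp) _ ?_
  intro x
  have e1 : x ⬝ᵥ (G.lapMatrix ℝ *ᵥ x) = lapForm G x := by
    rw [← toLinearMap₂'_apply', SimpleGraph.lapMatrix_toLinearMap₂']; rfl
  have e2 : x ⬝ᵥ x = ∑ i, x i ^ 2 := sum_congr rfl fun i _ => by ring
  simp only [LinearMap.id_apply]
  rw [e1, e2]
  nlinarith [lapForm_compl G x, lapForm_nonneg Gᶜ x, sq_nonneg (∑ i, x i)]

open Finset in
theorem outside_card {n : ℕ} (H : SimpleGraph (Fin n)) [DecidableRel H.Adj]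
    (S : Finset (Fin n)) (s : Fin n) (hs : s ∈ S) :
    H.degree s + 1 ≤ #(H.neighborFinset s \ S) + #S := by
  have h1 := card_inter_add_card_sdiff (H.neighborFinset s) S
  rw [H.card_neighborFinset_eq_degree] at h1
  have h2 : H.neighborFinset s ∩ S ⊆ S.erase s := by
    intro j hj
    simp only [mem_inter, SimpleGraph.mem_neighborFinset] at hj
    exact mem_erase.2 ⟨hj.1.ne', hj.2⟩
  have h3 := card_le_card h2
  have h4 := card_erase_add_one hs
  omega

open Finset in
theorem outside_card' {n : ℕ} (H : SimpleGraph (Fin n)) [DecidableRel H.Adj]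
    (S : Finset (Fin n)) (s : Fin n) (hs : s ∈ S)
    (hnf : ¬ ∀ t ∈ S, t ≠ s → H.Adj s t) :
    H.degree s + 2 ≤ #(H.neighborFinset s \ S) + #S := by
  push Not at hnf
  obtain ⟨t, ht, hts, hadj⟩ := hnf
  have h1 := card_inter_add_card_sdiff (H.neighborFinset s) S
  rw [H.card_neighborFinset_eq_degree] at h1
  have h2 : H.neighborFinset s ∩ S ⊆ (S.erase s).erase t := by
    intro j hj
    simp only [mem_inter, SimpleGraph.mem_neighborFinset] at hj
    refine mem_erase.2 ⟨?_, mem_erase.2 ⟨hj.1.ne', hj.2⟩⟩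
    rintro rfl
    exact hadj hj.1
  have h3 := card_le_card h2
  have h4 := card_erase_add_one hs
  have h5 := card_erase_add_one (mem_erase.2 ⟨hts, ht⟩)
  omega

open Finset in
theorem bound_of_set {n m : ℕ} (hm : 1 ≤ m) (hmn : m < n)
    (G : SimpleGraph (Fin n)) [DecidableRel G.Adj]
    (eigs : Fin n → ℝ) (heigs : Monotone eigs)
    (hroots : (G.lapMatrix ℝ).charpoly.roots = Finset.univ.val.map eigs)
    (hnot : ¬ IsCliquePlusIsolated Gᶜ m)
    (S : Finset (Fin n)) (hS : #S = m) (e : ℕ)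
    (hdeg : ∀ s ∈ S, e + m ≤ Gᶜ.degree s + 1) :
    eigs ⟨m, hmn⟩ ≤ n - ((e : ℝ) + 1) := by
  classical
  have he0 : (0 : ℝ) < (e : ℝ) + 1 := by positivity
  have hprin : ∀ R : Finset (Fin n), #R = m →
      (∀ s ∈ R, e + 1 ≤ #(Gᶜ.neighborFinset s \ R)) → eigs ⟨m, hmn⟩ ≤ n - ((e : ℝ) + 1) := by
    intro R hR hRo
    refine core hm hmn G eigs heigs hroots R ∅ hR (disjoint_empty_right _) 0 _ he0 ?_
    intro x _ h0
    have := case_principal Gᶜ R (e + 1) hRo x (fun i hi => h0 i hi (notMem_empty _))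
    push_cast at this
    exact this
  set T := S.filter (fun s => ¬ ∀ t ∈ S, t ≠ s → Gᶜ.Adj s t) with hTdef
  have hTout : ∀ s ∈ T, e + 1 ≤ #(Gᶜ.neighborFinset s \ S) := by
    intro s hs
    obtain ⟨h1, h2⟩ := mem_filter.1 hs
    have h3 := outside_card' Gᶜ S s h1 h2
    have h4 := hdeg s h1
    omega
  have hfullU : ∀ u ∈ S, u ∉ T → ∀ s ∈ S, s ≠ u → Gᶜ.Adj u s := by
    intro u hu huT
    by_contra h
    exact huT (mem_filter.2 ⟨hu, h⟩)
  by_cases hTS : T = S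
  · exact hprin S hS (by rwa [hTS] at hTout)
  have hTsub : T ⊆ S := filter_subset _ _
  have hUne : (S \ T).Nonempty := sdiff_nonempty.2 fun h => hTS (hTsub.antisymm h)
  obtain ⟨u, hu'⟩ := hUne
  obtain ⟨hu, huT⟩ := mem_sdiff.1 hu'
  rcases Nat.eq_zero_or_pos e with rfl | he
  · rcases T.eq_empty_or_nonempty with hT0 | hTne
    · -- S is a clique
      have hclique : ∀ a ∈ S, ∀ b ∈ S, b ≠ a → Gᶜ.Adj a b := fun a ha =>
        hfullU a ha (by rw [hT0]; exact notMem_empty _)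
      obtain ⟨w, z, hwz, hw⟩ : ∃ w z, Gᶜ.Adj w z ∧ w ∉ S := by
        by_contra hcon
        push Not at hcon
        refine hnot ⟨S, hS, fun a b => ⟨fun h => ⟨h.ne, hcon a b h, hcon b a h.symm⟩, ?_⟩⟩
        rintro ⟨h1, h2, h3⟩
        exact hclique a h2 b h3 h1.symm
      have hexists : ∃ v ∈ S, z ∉ S ∨ z = v := by
        by_cases hz : z ∈ S
        · exact ⟨z, hz, Or.inr rfl⟩
        · exact ⟨u, hu, Or.inl hz⟩
      obtain ⟨v, hv, hzv⟩ := hexists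
      have hwv : w ≠ v := fun h => hw (h ▸ hv)
      refine hprin (insert w (S.erase v)) ?_ ?_
      · rw [card_insert_of_notMem (fun h => hw (mem_of_mem_erase h)), card_erase_add_one hv, hS]
      · intro s hs
        rw [zero_add, Nat.succ_le_iff, card_pos]
        rcases mem_insert.1 hs with rfl | hs
        · refine ⟨z, mem_sdiff.2 ⟨by simpa using hwz, ?_⟩⟩
          rw [mem_insert, mem_erase]
          rintro (h | h)
          · exact hwz.ne h.symm
          · rcases hzv with h' | h'
            · exact h' h.2
            · exact h.1 h'
        · obtain ⟨h1, h2⟩ := mem_erase.1 hs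
          refine ⟨v, mem_sdiff.2 ⟨?_, ?_⟩⟩
          · rw [SimpleGraph.mem_neighborFinset]; exact hclique s h2 v hv h1.symm
          · rw [mem_insert, mem_erase]
            rintro (h | h)
            · exact hwv h.symm
            · exact h.1 rfl
    · have hex : ∀ s, ∃ j, s ∈ T → Gᶜ.Adj s j ∧ j ∉ S := by
        intro s
        by_cases hs : s ∈ T
        · obtain ⟨j, hj⟩ := card_pos.1 (show 0 < #(Gᶜ.neighborFinset s \ S) by
            have := hTout s hs; omega)
          rw [mem_sdiff, SimpleGraph.mem_neighborFinset] at hj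
          exact ⟨j, fun _ => hj⟩
        · exact ⟨s, fun h => absurd h hs⟩
      choose f hf using hex
      refine core hm hmn G eigs heigs hroots S (T.image f) hS ?_
        (-(#(T.image f) : ℝ)⁻¹) _ he0 ?_
      · rw [disjoint_left]
        intro i hi hi'
        obtain ⟨s, hs, rfl⟩ := mem_image.1 hi'
        exact (hf s hs).2 hi
      · intro x hK h0
        have := case_mixed Gᶜ S T hTsub hTne ⟨u, hu'⟩ hfullU f (fun s hs => hf s hs) x hK h0
        simpa using this
  · have hex : ∀ s, ∃ A : Finset (Fin n), s ∈ S →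
        (∀ j ∈ A, Gᶜ.Adj s j ∧ j ∉ S) ∧ #A = e := by
      intro s
      by_cases hs : s ∈ S
      · have h1 := outside_card Gᶜ S s hs
        have h2 := hdeg s hs
        obtain ⟨A, hA, hAc⟩ := exists_subset_card_eq
          (show e ≤ #(Gᶜ.neighborFinset s \ S) by omega)
        refine ⟨A, fun _ => ⟨fun j hj => ?_, hAc⟩⟩
        have := hA hj
        rwa [mem_sdiff, SimpleGraph.mem_neighborFinset] at this
      · exact ⟨∅, fun h => absurd h hs⟩
    choose F hF using hex
    refine core hm hmn G eigs heigs hroots S (S.biUnion F) hS ?_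
      (-(#(S.biUnion F) : ℝ)⁻¹) _ he0 ?_
    · rw [disjoint_left]
      intro i hi hi'
      obtain ⟨s, hs, hj⟩ := mem_biUnion.1 hi'
      exact ((hF s hs).1 i hj).2 hi
    · intro x hK h0
      exact case_full Gᶜ S e he u hu (hfullU u hu huT) F (fun s hs => (hF s hs).1)
        (fun s hs => (hF s hs).2) x hK h0

/-- If `Ḡ ≠ K_m + (n-m)K_1`, then `λ_{m+1}(G) ≤ d_m(G) + m - 1`. -/
theorem lap_eigenvalue_upper_bound (n m : ℕ) (hm : 1 ≤ m) (hmn : m ≤ n - 1)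
    (G : SimpleGraph (Fin n)) [DecidableRel G.Adj]
    (eigs : Fin n → ℝ) (heigs : Monotone eigs)
    (hroots : (G.lapMatrix ℝ).charpoly.roots = Finset.univ.val.map eigs)
    (d : Fin n → ℕ) (hd : Monotone d)
    (hdeg : Finset.univ.val.map d = Finset.univ.val.map (fun v => G.degree v))
    (hnot : ¬ IsCliquePlusIsolated Gᶜ m) :
    eigs ⟨m, by omega⟩ ≤ (d ⟨m - 1, by omega⟩ : ℝ) + m - 1 := by
  have hmn' : m < n := by omega
  obtain ⟨σ, hσ⟩ := perm_of_multiset d _ hdeg hd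
  set D := d ⟨m - 1, by omega⟩ with hD
  by_cases hbig : n + 1 ≤ D + m
  · have h1 := eig_le_n hmn' G eigs heigs hroots
    have h2 : (n : ℝ) + 1 ≤ D + m := by exact_mod_cast hbig
    linarith
  · obtain ⟨e, he⟩ : ∃ e, D + m + e = n := ⟨n - (D + m), by omega⟩
    let ι : Fin m ↪ Fin n := (Fin.castLEEmb hmn'.le).trans σ.toEmbedding
    have h := bound_of_set hm hmn' G eigs heigs hroots hnot (Finset.univ.map ι) (by simp) e (by
      intro s hs
      obtain ⟨i, -, rfl⟩ := Finset.mem_map.1 hs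
      have h1 : G.degree (ι i) ≤ D := by
        have : G.degree (ι i) = d (Fin.castLE hmn'.le i) := (hσ _).symm
        rw [this]
        apply hd
        rw [Fin.le_def]
        have := i.2
        simp only [Fin.val_castLE]
        omega
      have h2 := G.degree_compl (ι i)
      rw [Fintype.card_fin] at h2
      omega)
    have h3 : (D : ℝ) + m + e = n := by exact_mod_cast he
    linarith
end

section
/- Let G be a finite simple graph on n vertices and let 1 ≤ i ≤ n. If G is not the disjoint union K_{n−i+1} + (i−1)K_1 of a complete graph on n−i+1 vertices with i−1 isolated vertices, then λ_i(G) ≥ d_i(G) − n + i + 1, where λ_i(G) is the i-th smallest Laplacian eigenvalue of G and d_i(G) is the i-th smallest vertex degree of G. -/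
open Finset Matrix

lemma card_filter_of_map_eq {n : ℕ} {α : Type*} (f g : Fin n → α) (p : α → Prop) [DecidablePred p]
    (h : (univ : Finset (Fin n)).val.map f = (univ : Finset (Fin n)).val.map g) :
    #{j | p (f j)} = #{j | p (g j)} := by
  have := congrArg (Multiset.countP p) h
  rw [Multiset.countP_map, Multiset.countP_map] at this
  exact this

lemma diag_forms {n : ℕ} (A : Matrix (Fin n) (Fin n) ℝ) (hA : A.IsHermitian) :
    ∃ U : Matrix (Fin n) (Fin n) ℝ, ∀ z : Fin n → ℝ,
      z ⬝ᵥ (A *ᵥ z) = ∑ j, hA.eigenvalues j * (U *ᵥ z) j ^ 2 ∧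
      ∑ j, z j ^ 2 = ∑ j, (U *ᵥ z) j ^ 2 := by
  set U0 : Matrix (Fin n) (Fin n) ℝ := hA.eigenvectorUnitary.1 with hU0
  have hUU : U0 * U0ᵀ = 1 := by
    have := Unitary.coe_mul_star_self hA.eigenvectorUnitary
    rw [Unitary.coe_star, star_eq_conjTranspose, conjTranspose_eq_transpose_of_trivial] at this
    exact this
  have hs : A = U0 * diagonal hA.eigenvalues * U0ᵀ := by
    have := hA.spectral_theorem
    rw [Unitary.conjStarAlgAut_apply, star_eq_conjTranspose,
      conjTranspose_eq_transpose_of_trivial] at this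
    exact this
  refine ⟨U0ᵀ, fun z => ⟨?_, ?_⟩⟩
  · conv_lhs => rw [hs]
    rw [← mulVec_mulVec, ← mulVec_mulVec, dotProduct_mulVec, ← mulVec_transpose]
    simp only [dotProduct, mulVec_diagonal]
    exact Finset.sum_congr rfl fun j _ => by ring
  · have : z ⬝ᵥ ((U0 * U0ᵀ) *ᵥ z) = z ⬝ᵥ z := by rw [hUU, one_mulVec]
    rw [← mulVec_mulVec, dotProduct_mulVec, ← mulVec_transpose] at this
    simp only [dotProduct] at this
    simp only [pow_two]
    exact this.symm

lemma eig_principle {n i : ℕ} (hi : 1 ≤ i) (hin : i ≤ n)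
    (A : Matrix (Fin n) (Fin n) ℝ) (hA : A.IsHermitian)
    (eigs : Fin n → ℝ) (heigs : Monotone eigs)
    (hroots : A.charpoly.roots = Finset.univ.val.map eigs)
    (S : Finset (Fin n)) (hS : n - i + 1 ≤ S.card)
    (w : Fin n → ℝ) (t : Fin n) (htS : t ∉ S) (hwt : w t ≠ 0)
    (f : (Fin n → ℝ) →ₗ[ℝ] ℝ) (θ : ℝ)
    (h : ∀ z : Fin n → ℝ, ∀ c : ℝ, (∀ v, v ∉ S → z v = c * w v) → f z = 0 →
      θ * ∑ v, z v ^ 2 ≤ z ⬝ᵥ (A *ᵥ z)) :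
    θ ≤ eigs ⟨i - 1, by omega⟩ := by
  by_contra hlt
  push Not at hlt
  obtain ⟨U, hU⟩ := diag_forms A hA
  have hcard : i ≤ #{j | hA.eigenvalues j < θ} := by
    have h1 := hA.roots_charpoly_eq_eigenvalues
    rw [hroots] at h1
    have h2 := card_filter_of_map_eq eigs _ (fun x => x < θ) h1
    simp only [Function.comp_apply, RCLike.ofReal_real_eq_id, id] at h2
    rw [← h2]
    have : Finset.Iic (⟨i - 1, by omega⟩ : Fin n) ⊆ ({j | eigs j < θ} : Finset (Fin n)) := by
      intro j hj
      simp only [Finset.mem_Iic] at hj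
      simp only [mem_filter, mem_univ, true_and]
      exact lt_of_le_of_lt (heigs hj) hlt
    have := Finset.card_le_card this
    rw [Fin.card_Iic] at this
    simp only at this
    omega
  let ψ : ((S → ℝ) × ℝ) →ₗ[ℝ] (Fin n → ℝ) :=
    { toFun := fun y v => if hv : v ∈ S then y.1 ⟨v, hv⟩ else y.2 * w v
      map_add' := by
        intro x y; ext v; by_cases hv : v ∈ S <;> simp [hv]; ring
      map_smul' := by
        intro x y; ext v; by_cases hv : v ∈ S <;> simp [hv]; ring }
  have hψ1 : ∀ y (v : S), ψ y v = y.1 v := by intro y v; simp [ψ]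
  have hψ2 : ∀ y v, v ∉ S → ψ y v = y.2 * w v := by intro y v hv; simp [ψ, hv]
  let g : ((S → ℝ) × ℝ) →ₗ[ℝ] (ℝ × ({j // ¬ hA.eigenvalues j < θ} → ℝ)) :=
    (f.prod (LinearMap.pi fun j => (LinearMap.proj j.1).comp (Matrix.toLin' U))).comp ψ
  have hg : LinearMap.ker g ≠ ⊥ := by
    apply LinearMap.ker_ne_bot_of_finrank_lt
    simp only [Module.finrank_prod, Module.finrank_self, Module.finrank_fintype_fun_eq_card,
      Fintype.card_coe]
    have : Fintype.card {j // ¬ hA.eigenvalues j < θ} + #{j | hA.eigenvalues j < θ} = n := by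
      rw [Fintype.card_subtype]
      have := Finset.card_filter_add_card_filter_not (s := (univ : Finset (Fin n))) (fun j => hA.eigenvalues j < θ)
      simp only [Finset.card_univ, Fintype.card_fin] at this
      omega
    omega
  obtain ⟨y, hy, hy0⟩ := Submodule.exists_mem_ne_zero_of_ne_bot hg
  rw [LinearMap.mem_ker] at hy
  have hf : f (ψ y) = 0 := congrArg Prod.fst hy
  have hz : ∀ j, ¬ hA.eigenvalues j < θ → (U *ᵥ ψ y) j = 0 := by
    intro j hj
    exact congrFun (congrArg Prod.snd hy) ⟨j, hj⟩
  have hmain := h (ψ y) y.2 (hψ2 y) hf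
  obtain ⟨e1, e2⟩ := hU (ψ y)
  rw [e1, e2, Finset.mul_sum] at hmain
  have hle : ∀ j ∈ (univ : Finset (Fin n)),
      hA.eigenvalues j * (U *ᵥ ψ y) j ^ 2 ≤ θ * (U *ᵥ ψ y) j ^ 2 := by
    intro j _
    by_cases hj : hA.eigenvalues j < θ
    · exact mul_le_mul_of_nonneg_right hj.le (sq_nonneg _)
    · rw [hz j hj]; simp
  have heq := (Finset.sum_eq_sum_iff_of_le hle).1 (le_antisymm (Finset.sum_le_sum hle) hmain)
  have hall : ∀ j, (U *ᵥ ψ y) j = 0 := by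
    intro j
    by_cases hj : hA.eigenvalues j < θ
    · have h3 := heq j (mem_univ j)
      by_contra hne
      have : 0 < (U *ᵥ ψ y) j ^ 2 := by positivity
      nlinarith
    · exact hz j hj
  have hsum : ∑ j, (ψ y) j ^ 2 = 0 := by
    rw [e2]; exact Finset.sum_eq_zero fun j _ => by rw [hall j]; simp
  have hzero : ∀ j, ψ y j = 0 := by
    intro j
    have := (Finset.sum_eq_zero_iff_of_nonneg (fun j _ => sq_nonneg (ψ y j))).1 hsum j (mem_univ j)
    exact pow_eq_zero_iff (two_ne_zero) |>.1 this
  apply hy0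
  ext v
  · rw [← hψ1]; exact hzero v
  · have := hψ2 y t htS
    rw [hzero t] at this
    simpa [hwt] using this.symm

lemma lap_form {n : ℕ} (G : SimpleGraph (Fin n)) [DecidableRel G.Adj] (S : Finset (Fin n))
    (z : Fin n → ℝ) :
    z ⬝ᵥ (G.lapMatrix ℝ *ᵥ z) =
      (∑ i ∈ S, ∑ j ∈ S, if G.Adj i j then (z i - z j) ^ 2 else 0) / 2
      + (∑ i ∈ S, ∑ j ∈ Sᶜ, if G.Adj i j then (z i - z j) ^ 2 else 0)
      + (∑ i ∈ Sᶜ, ∑ j ∈ Sᶜ, if G.Adj i j then (z i - z j) ^ 2 else 0) / 2 := by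
  rw [← Matrix.toLinearMap₂'_apply', SimpleGraph.lapMatrix_toLinearMap₂']
  rw [← Finset.sum_add_sum_compl S]
  simp_rw [← Finset.sum_add_sum_compl S (fun j => if G.Adj _ j then _ else _)]
  rw [Finset.sum_add_distrib, Finset.sum_add_distrib]
  have : (∑ i ∈ Sᶜ, ∑ j ∈ S, if G.Adj i j then (z i - z j) ^ 2 else 0)
      = ∑ i ∈ S, ∑ j ∈ Sᶜ, if G.Adj i j then (z i - z j) ^ 2 else 0 := by
    rw [Finset.sum_comm]
    refine Finset.sum_congr rfl fun i _ => Finset.sum_congr rfl fun j _ => ?_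
    simp only [G.adj_comm j i]
    congr 1; ring
  rw [this]; ring

lemma term_nonneg {n : ℕ} (G : SimpleGraph (Fin n)) [DecidableRel G.Adj] (z : Fin n → ℝ)
    (i j : Fin n) : 0 ≤ (if G.Adj i j then (z i - z j) ^ 2 else 0) := by
  split_ifs <;> positivity

lemma cross_bound {n : ℕ} (G : SimpleGraph (Fin n)) [DecidableRel G.Adj] (S : Finset (Fin n))
    (N : Fin n → Finset (Fin n)) (hN : ∀ s ∈ S, ∀ v ∈ N s, v ∉ S ∧ G.Adj s v)
    (z : Fin n → ℝ) (c : ℝ) (hc : ∀ s ∈ S, ∀ v ∈ N s, z v = c) :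
    ∑ s ∈ S, (#(N s) : ℝ) * (z s - c) ^ 2 ≤
      ∑ i ∈ S, ∑ j ∈ Sᶜ, if G.Adj i j then (z i - z j) ^ 2 else 0 := by
  refine Finset.sum_le_sum fun s hs => ?_
  calc (#(N s) : ℝ) * (z s - c) ^ 2 = ∑ j ∈ N s, if G.Adj s j then (z s - z j) ^ 2 else 0 := by
        rw [← nsmul_eq_mul, ← Finset.sum_const]
        refine Finset.sum_congr rfl fun j hj => ?_
        rw [if_pos (hN s hs j hj).2, hc s hs j hj]
    _ ≤ _ := Finset.sum_le_sum_of_subset_of_nonneg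
        (fun j hj => by simpa using (hN s hs j hj).1) (fun j _ _ => term_nonneg G z s j)

/-- the part of the form inside `S`, when the vertices of `A ⊆ S` dominate `S` -/
lemma inner_bound {n : ℕ} (G : SimpleGraph (Fin n)) [DecidableRel G.Adj] (A B : Finset (Fin n))
    (hAB : Disjoint A B) (hA : ∀ s ∈ A, ∀ v ∈ A ∪ B, v ≠ s → G.Adj s v) (z : Fin n → ℝ) :
    (#A : ℝ) * ∑ s ∈ A, z s ^ 2 - (∑ s ∈ A, z s) ^ 2 + (#B : ℝ) * ∑ s ∈ A, z s ^ 2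
      + (#A : ℝ) * ∑ s ∈ B, z s ^ 2 - 2 * (∑ s ∈ A, z s) * (∑ s ∈ B, z s) ≤
      (∑ i ∈ A ∪ B, ∑ j ∈ A ∪ B, if G.Adj i j then (z i - z j) ^ 2 else 0) / 2 := by
  have key : ∀ X Y : Finset (Fin n), ∑ i ∈ X, ∑ j ∈ Y, (z i - z j) ^ 2 =
      (#Y : ℝ) * ∑ s ∈ X, z s ^ 2 + (#X : ℝ) * ∑ s ∈ Y, z s ^ 2
        - 2 * (∑ s ∈ X, z s) * (∑ s ∈ Y, z s) := by
    intro X Y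
    simp only [sub_sq, Finset.sum_add_distrib, Finset.sum_sub_distrib, Finset.sum_const,
      nsmul_eq_mul, ← Finset.mul_sum, ← Finset.sum_mul]
    ring
  have t1 : ∀ i j, i ∈ A → j ∈ A ∪ B →
      (if G.Adj i j then (z i - z j) ^ 2 else 0) = (z i - z j) ^ 2 := by
    intro i j hi hj
    by_cases hij : j = i
    · subst hij; simp
    · rw [if_pos (hA i hi j hj hij)]
  have t2 : ∀ i j, i ∈ A ∪ B → j ∈ A →
      (if G.Adj i j then (z i - z j) ^ 2 else 0) = (z i - z j) ^ 2 := by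
    intro i j hi hj
    by_cases hij : i = j
    · subst hij; simp
    · rw [if_pos (hA j hj i hi hij).symm]
  simp only [Finset.sum_union hAB, Finset.sum_add_distrib]
  have e1 : ∑ i ∈ A, ∑ j ∈ A, (if G.Adj i j then (z i - z j) ^ 2 else 0) =
      ∑ i ∈ A, ∑ j ∈ A, (z i - z j) ^ 2 :=
    Finset.sum_congr rfl fun i hi => Finset.sum_congr rfl fun j hj =>
      t1 i j hi (mem_union_left _ hj)
  have e2 : ∑ i ∈ A, ∑ j ∈ B, (if G.Adj i j then (z i - z j) ^ 2 else 0) =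
      ∑ i ∈ A, ∑ j ∈ B, (z i - z j) ^ 2 :=
    Finset.sum_congr rfl fun i hi => Finset.sum_congr rfl fun j hj =>
      t1 i j hi (mem_union_right _ hj)
  have e3 : ∑ i ∈ B, ∑ j ∈ A, (if G.Adj i j then (z i - z j) ^ 2 else 0) =
      ∑ i ∈ B, ∑ j ∈ A, (z i - z j) ^ 2 :=
    Finset.sum_congr rfl fun i hi => Finset.sum_congr rfl fun j hj =>
      t2 i j (mem_union_right _ hi) hj
  have e4 : 0 ≤ ∑ i ∈ B, ∑ j ∈ B, (if G.Adj i j then (z i - z j) ^ 2 else 0) :=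
    Finset.sum_nonneg fun i _ => Finset.sum_nonneg fun j _ => term_nonneg G z i j
  rw [e1, e2, e3, key, key, key]
  linarith

/-- the part of the form inside `S`, with one dominating vertex -/
lemma inner_bound_one {n : ℕ} (G : SimpleGraph (Fin n)) [DecidableRel G.Adj] (S : Finset (Fin n))
    (s₀ : Fin n) (hs : s₀ ∈ S) (hA : ∀ v ∈ S, v ≠ s₀ → G.Adj s₀ v) (z : Fin n → ℝ) :
    (#S : ℝ) * ∑ s ∈ S, z s ^ 2 - (∑ s ∈ S, z s) ^ 2 ≤
      #S * ((∑ i ∈ S, ∑ j ∈ S, if G.Adj i j then (z i - z j) ^ 2 else 0) / 2) := by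
  have hu : {s₀} ∪ S.erase s₀ = S := by
    ext v; simp only [mem_union, mem_singleton, mem_erase]
    constructor
    · rintro (rfl | h); exacts [hs, h.2]
    · intro h; by_cases hv : v = s₀ <;> simp [hv, h]
  have hb := inner_bound G {s₀} (S.erase s₀) (by simp)
    (by rw [hu]; simpa using hA) z
  rw [hu] at hb
  have c1 : (#(S.erase s₀) : ℝ) = #S - 1 := by
    rw [eq_sub_iff_add_eq]; exact_mod_cast Finset.card_erase_add_one hs
  have c2 := Finset.add_sum_erase S z hs
  have c3 := Finset.add_sum_erase S (fun v => z v ^ 2) hs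
  simp only [card_singleton, sum_singleton, c1, Nat.cast_one] at hb
  have hpos : (0 : ℝ) ≤ #S := by positivity
  have := mul_le_mul_of_nonneg_left hb hpos
  refine le_trans ?_ this
  rw [← c2, ← c3]
  nlinarith [sq_nonneg ((#S : ℝ) * z s₀ - (z s₀ + ∑ x ∈ S.erase s₀, z x))]

lemma sums_T {n : ℕ} (S T : Finset (Fin n)) (hT : Disjoint S T) (z : Fin n → ℝ) (c : ℝ)
    (hz : ∀ v, v ∉ S → z v = c * (if v ∈ T then 1 else 0)) :
    ∑ v, z v = ∑ v ∈ S, z v + #T * c ∧ ∑ v, z v ^ 2 = ∑ v ∈ S, z v ^ 2 + #T * c ^ 2 := by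
  have hTS : T ⊆ Sᶜ := fun v hv => by
    simpa using (Finset.disjoint_right.1 hT hv)
  have h1 : ∑ v ∈ Sᶜ, z v = #T * c := by
    rw [← Finset.sum_subset hTS]
    · rw [← nsmul_eq_mul, ← Finset.sum_const]
      exact Finset.sum_congr rfl fun v hv => by
        rw [hz v (by simpa using hTS hv), if_pos hv, mul_one]
    · intro v hv hvT
      rw [hz v (by simpa using hv), if_neg hvT, mul_zero]
  have h2 : ∑ v ∈ Sᶜ, z v ^ 2 = #T * c ^ 2 := by
    rw [← Finset.sum_subset hTS]
    · rw [← nsmul_eq_mul, ← Finset.sum_const]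
      exact Finset.sum_congr rfl fun v hv => by
        rw [hz v (by simpa using hTS hv), if_pos hv, mul_one]
    · intro v hv hvT
      rw [hz v (by simpa using hv), if_neg hvT, mul_zero]; simp
  rw [← h1, ← h2, Finset.sum_add_sum_compl, Finset.sum_add_sum_compl]
  exact ⟨rfl, rfl⟩

lemma outer_nonneg {n : ℕ} (G : SimpleGraph (Fin n)) [DecidableRel G.Adj] (X Y : Finset (Fin n))
    (z : Fin n → ℝ) : 0 ≤ ∑ i ∈ X, ∑ j ∈ Y, (if G.Adj i j then (z i - z j) ^ 2 else 0) :=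
  Finset.sum_nonneg fun i _ => Finset.sum_nonneg fun j _ => term_nonneg G z i j

lemma case_one {n : ℕ} (G : SimpleGraph (Fin n)) [DecidableRel G.Adj] (S : Finset (Fin n))
    (e : ℕ) (he : ∀ s ∈ S, e ≤ #{v | v ∉ S ∧ G.Adj s v}) (z : Fin n → ℝ)
    (hz : ∀ v, v ∉ S → z v = 0) :
    (e : ℝ) * ∑ v, z v ^ 2 ≤ z ⬝ᵥ (G.lapMatrix ℝ *ᵥ z) := by
  rw [lap_form G S z]
  have h1 := outer_nonneg G S S z
  have h2 := outer_nonneg G Sᶜ Sᶜ z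
  have h3 := cross_bound G S (fun s => {v | v ∉ S ∧ G.Adj s v})
    (fun s _ v hv => by simpa using hv) z 0 (fun s _ v hv => hz v (by simp at hv; exact hv.1))
  have h4 := (sums_T S ∅ (by simp) z 0 (fun v hv => by simp [hz v hv])).2
  rw [h4]
  have h5 : (e : ℝ) * (∑ v ∈ S, z v ^ 2 + #(∅ : Finset (Fin n)) * 0 ^ 2) ≤
      ∑ s ∈ S, (#{v | v ∉ S ∧ G.Adj s v} : ℝ) * (z s - 0) ^ 2 := by
    simp only [card_empty, Nat.cast_zero, zero_mul, add_zero, sub_zero]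
    rw [Finset.mul_sum]
    refine Finset.sum_le_sum fun s hs => ?_
    exact mul_le_mul_of_nonneg_right (by exact_mod_cast he s hs) (sq_nonneg _)
  linarith

lemma case_two {n : ℕ} (G : SimpleGraph (Fin n)) [DecidableRel G.Adj] (S : Finset (Fin n))
    (s₀ : Fin n) (hs : s₀ ∈ S) (hA : ∀ v ∈ S, v ≠ s₀ → G.Adj s₀ v)
    (e : ℕ) (N : Fin n → Finset (Fin n)) (hN : ∀ s ∈ S, ∀ v ∈ N s, v ∉ S ∧ G.Adj s v)
    (hNe : ∀ s ∈ S, #(N s) = e) (z : Fin n → ℝ) (c : ℝ)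
    (hz : ∀ v, v ∉ S → z v = c * (if v ∈ S.biUnion N then 1 else 0)) (hsum : ∑ v, z v = 0) :
    ((e : ℝ) + 1) * ∑ v, z v ^ 2 ≤ z ⬝ᵥ (G.lapMatrix ℝ *ᵥ z) := by
  rw [lap_form G S z]
  have hdis : Disjoint S (S.biUnion N) := by
    rw [Finset.disjoint_right]
    intro v hv
    obtain ⟨s, hs, hv⟩ := Finset.mem_biUnion.1 hv
    exact (hN s hs v hv).1
  have hin := inner_bound_one G S s₀ hs hA z
  have h2 := outer_nonneg G Sᶜ Sᶜ z
  have h3 := cross_bound G S N hN z c (fun s hs v hv => by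
    rw [hz v (hN s hs v hv).1, if_pos (Finset.mem_biUnion.2 ⟨s, hs, hv⟩), mul_one])
  obtain ⟨g1, g2⟩ := sums_T S _ hdis z c hz
  have ht : (#(S.biUnion N) : ℝ) ≤ #S * e := by
    exact_mod_cast Finset.card_biUnion_le_card_mul S N e (fun s hs => (hNe s hs).le)
  have h4 : ∑ s ∈ S, (#(N s) : ℝ) * (z s - c) ^ 2 =
      e * (∑ s ∈ S, z s ^ 2 - 2 * c * ∑ s ∈ S, z s + #S * c ^ 2) := by
    have : ∑ s ∈ S, (#(N s) : ℝ) * (z s - c) ^ 2 = ∑ s ∈ S, (e : ℝ) * (z s - c) ^ 2 :=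
      Finset.sum_congr rfl fun s hs => by rw [hNe s hs]
    rw [this, ← Finset.mul_sum]
    simp only [sub_sq, Finset.sum_add_distrib, Finset.sum_sub_distrib, Finset.sum_const,
      nsmul_eq_mul, ← Finset.mul_sum, ← Finset.sum_mul]
    ring
  rw [h4] at h3
  rw [g2]
  rw [g1] at hsum
  have hm : (0 : ℝ) < #S := by exact_mod_cast Finset.card_pos.2 ⟨s₀, hs⟩
  have ht0 : (0 : ℝ) ≤ #(S.biUnion N) := by positivity
  generalize (#(S.biUnion N) : ℝ) = t at *
  generalize (#S : ℝ) = m at *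
  generalize (∑ s ∈ S, z s) = p at *
  generalize (∑ s ∈ S, z s ^ 2) = P at *
  generalize (∑ i ∈ S, ∑ j ∈ S, if G.Adj i j then (z i - z j) ^ 2 else 0) = Q1 at *
  generalize (∑ i ∈ S, ∑ j ∈ Sᶜ, if G.Adj i j then (z i - z j) ^ 2 else 0) = Q2 at *
  generalize (∑ i ∈ Sᶜ, ∑ j ∈ Sᶜ, if G.Adj i j then (z i - z j) ^ 2 else 0) = Q3 at *
  generalize (e : ℝ) = e' at *
  obtain rfl : p = -(t * c) := by linarith
  have key : 0 ≤ c ^ 2 * ((m + t) * (m * e' - t)) :=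
    mul_nonneg (sq_nonneg _) (mul_nonneg (by linarith) (by linarith))
  have h3' := mul_le_mul_of_nonneg_left h3 hm.le
  have h2' := mul_nonneg hm.le h2
  refine le_of_mul_le_mul_left ?_ hm
  nlinarith

lemma case_three {n : ℕ} (G : SimpleGraph (Fin n)) [DecidableRel G.Adj] (S : Finset (Fin n))
    (s₀ : Fin n) (hs : s₀ ∈ S) (hA : ∀ v ∈ S, v ≠ s₀ → G.Adj s₀ v)
    (a b : Fin n) (ha : a ∉ S) (hb : b ∉ S) (hab : G.Adj a b) (z : Fin n → ℝ) (c : ℝ)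
    (hz : ∀ v, v ∉ S → z v = c * ((if v = a then 1 else 0) - (if v = b then 1 else 0)))
    (hsum : ∑ v ∈ S, z v = 0) :
    (1 : ℝ) * ∑ v, z v ^ 2 ≤ z ⬝ᵥ (G.lapMatrix ℝ *ᵥ z) := by
  rw [lap_form G S z]
  have hin := inner_bound_one G S s₀ hs hA z
  have h2 := outer_nonneg G S Sᶜ z
  have hne : a ≠ b := hab.ne
  have za : z a = c := by rw [hz a ha]; simp [hne]
  have zb : z b = -c := by rw [hz b hb]; simp [hne.symm]
  have hsub : ({a, b} : Finset (Fin n)) ⊆ Sᶜ := by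
    intro v hv
    simp only [mem_insert, mem_singleton] at hv
    rcases hv with rfl | rfl <;> simpa
  have h3 : (∑ i ∈ {a, b}, ∑ j ∈ {a, b}, if G.Adj i j then (z i - z j) ^ 2 else 0) ≤
      ∑ i ∈ Sᶜ, ∑ j ∈ Sᶜ, if G.Adj i j then (z i - z j) ^ 2 else 0 := by
    refine le_trans (Finset.sum_le_sum fun i _ =>
      Finset.sum_le_sum_of_subset_of_nonneg hsub (fun j _ _ => term_nonneg G z i j)) ?_
    exact Finset.sum_le_sum_of_subset_of_nonneg hsub (fun i _ _ =>
      Finset.sum_nonneg fun j _ => term_nonneg G z i j)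
  have h4 : ∑ v, z v ^ 2 = ∑ v ∈ S, z v ^ 2 + 2 * c ^ 2 := by
    rw [← Finset.sum_add_sum_compl S, ← Finset.sum_subset hsub, Finset.sum_pair hne, za, zb]
    · ring
    · intro v hv hv'
      simp only [mem_insert, mem_singleton, not_or] at hv'
      rw [hz v (by simpa using hv)]
      simp [hv'.1, hv'.2]
  simp only [Finset.sum_pair hne, hab, hab.symm, if_true, SimpleGraph.irrefl, if_false,
    za, zb] at h3
  rw [h4]
  rw [hsum] at hin
  have hm : (0 : ℝ) < #S := by exact_mod_cast Finset.card_pos.2 ⟨s₀, hs⟩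
  have hin' := le_of_mul_le_mul_left (a := (#S : ℝ)) (by linarith) hm
  nlinarith [sq_nonneg c]

lemma case_four {n : ℕ} (G : SimpleGraph (Fin n)) [DecidableRel G.Adj] (A B : Finset (Fin n))
    (hAB : Disjoint A B) (hA : ∀ s ∈ A, ∀ v ∈ A ∪ B, v ≠ s → G.Adj s v)
    (hAn : A.Nonempty) (hBn : B.Nonempty)
    (g : Fin n → Fin n) (hg : ∀ s ∈ B, g s ∉ A ∪ B ∧ G.Adj s (g s))
    (z : Fin n → ℝ) (c : ℝ)
    (hz : ∀ v, v ∉ A ∪ B → z v = c * (if v ∈ B.image g then 1 else 0)) (hsum : ∑ v, z v = 0) :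
    (1 : ℝ) * ∑ v, z v ^ 2 ≤ z ⬝ᵥ (G.lapMatrix ℝ *ᵥ z) := by
  rw [lap_form G (A ∪ B) z]
  have hdis : Disjoint (A ∪ B) (B.image g) := by
    rw [Finset.disjoint_right]
    intro v hv
    obtain ⟨s, hs, rfl⟩ := Finset.mem_image.1 hv
    exact (hg s hs).1
  have hin := inner_bound G A B hAB hA z
  have h2 := outer_nonneg G (A ∪ B)ᶜ (A ∪ B)ᶜ z
  have h3 := cross_bound G (A ∪ B) (fun s => if s ∈ B then {g s} else ∅)
    (fun s hs v hv => by
      split_ifs at hv with h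
      · obtain rfl := Finset.mem_singleton.1 hv
        exact hg s h
      · simp at hv) z c (fun s hs v hv => by
      split_ifs at hv with h
      · obtain rfl := Finset.mem_singleton.1 hv
        rw [hz _ (hg s h).1, if_pos (Finset.mem_image_of_mem g h), mul_one]
      · simp at hv)
  obtain ⟨g1, g2⟩ := sums_T (A ∪ B) _ hdis z c hz
  have ht : (#(B.image g) : ℝ) ≤ #B := by exact_mod_cast Finset.card_image_le
  have h4 : ∑ s ∈ A ∪ B, (#(if s ∈ B then {g s} else (∅ : Finset (Fin n))) : ℝ) * (z s - c) ^ 2 =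
      (∑ s ∈ B, z s ^ 2 - 2 * c * ∑ s ∈ B, z s + #B * c ^ 2) := by
    rw [Finset.sum_union hAB]
    have e1 : ∑ s ∈ A, (#(if s ∈ B then {g s} else (∅ : Finset (Fin n))) : ℝ) * (z s - c) ^ 2 = 0 :=
      Finset.sum_eq_zero fun s hs => by
        rw [if_neg (Finset.disjoint_left.1 hAB hs)]; simp
    have e2 : ∑ s ∈ B, (#(if s ∈ B then {g s} else (∅ : Finset (Fin n))) : ℝ) * (z s - c) ^ 2
        = ∑ s ∈ B, (z s - c) ^ 2 :=
      Finset.sum_congr rfl fun s hs => by rw [if_pos hs]; simp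
    rw [e1, e2]
    simp only [sub_sq, Finset.sum_add_distrib, Finset.sum_sub_distrib, Finset.sum_const,
      nsmul_eq_mul, ← Finset.mul_sum, ← Finset.sum_mul]
    ring
  rw [h4] at h3
  rw [g2]
  rw [g1] at hsum
  rw [Finset.sum_union hAB] at hsum
  rw [Finset.sum_union hAB (f := fun v => z v ^ 2)]
  have cA := sq_sum_le_card_mul_sum_sq (s := A) (f := z)
  have cB := sq_sum_le_card_mul_sum_sq (s := B) (f := z)
  have ha : (1 : ℝ) ≤ #A := by exact_mod_cast Finset.card_pos.2 hAn
  have hb : (1 : ℝ) ≤ #B := by exact_mod_cast Finset.card_pos.2 hBn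
  have ht0 : (0 : ℝ) ≤ #(B.image g) := by positivity
  generalize (#(B.image g) : ℝ) = t at *
  generalize (#A : ℝ) = a at *
  generalize (#B : ℝ) = b at *
  generalize (∑ s ∈ A, z s) = p at *
  generalize (∑ s ∈ A, z s ^ 2) = P at *
  generalize (∑ s ∈ B, z s) = r at *
  generalize (∑ s ∈ B, z s ^ 2) = R at *
  generalize (∑ i ∈ A ∪ B, ∑ j ∈ A ∪ B, if G.Adj i j then (z i - z j) ^ 2 else 0) = Q1 at *
  generalize (∑ i ∈ A ∪ B, ∑ j ∈ (A ∪ B)ᶜ, if G.Adj i j then (z i - z j) ^ 2 else 0) = Q2 at *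
  generalize (∑ i ∈ (A ∪ B)ᶜ, ∑ j ∈ (A ∪ B)ᶜ,
    if G.Adj i j then (z i - z j) ^ 2 else 0) = Q3 at *
  have ha0 : 0 < a := by linarith
  have hb0 : 0 < b := by linarith
  obtain ⟨y, rfl⟩ : ∃ y, p = a * y := ⟨p / a, by field_simp⟩
  obtain ⟨x, rfl⟩ : ∃ x, r = b * x := ⟨r / b, by field_simp⟩
  have cA' : a * y ^ 2 ≤ P := le_of_mul_le_mul_left (by linarith) ha0
  have cB' : b * x ^ 2 ≤ R := le_of_mul_le_mul_left (by linarith) hb0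
  have k1 : (a + b - 1) * (a * y ^ 2) ≤ (a + b - 1) * P :=
    mul_le_mul_of_nonneg_left cA' (by linarith)
  have k2 : a * (b * x ^ 2) ≤ a * R := mul_le_mul_of_nonneg_left cB' ha0.le
  have k3 : 0 ≤ a * (b - 1) * (y - x) ^ 2 :=
    mul_nonneg (mul_nonneg ha0.le (by linarith)) (sq_nonneg _)
  have k4 : 0 ≤ (b - t) * (c - x) ^ 2 := mul_nonneg (by linarith) (sq_nonneg _)
  have k5 : 0 ≤ (a + b + t) * x ^ 2 := mul_nonneg (by linarith) (sq_nonneg _)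
  have k6 : x * (a * y + b * x + t * c) = 0 := by rw [hsum, mul_zero]
  linarith

/-- Brouwer–Haemers: if `G ≠ K_{n-i+1} + (i-1)K_1`, then `λ_i(G) ≥ d_i(G) - n + i + 1`. -/
theorem lap_eigenvalue_lower_bound (n i : ℕ) (hi : 1 ≤ i) (hin : i ≤ n)
    (G : SimpleGraph (Fin n)) [DecidableRel G.Adj]
    (eigs : Fin n → ℝ) (heigs : Monotone eigs)
    (hroots : (G.lapMatrix ℝ).charpoly.roots = Finset.univ.val.map eigs)
    (d : Fin n → ℕ) (hd : Monotone d)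
    (hdeg : Finset.univ.val.map d = Finset.univ.val.map (fun v => G.degree v))
    (hnot : ¬ IsCliquePlusIsolated G (n - i + 1)) :
    eigs ⟨i - 1, by omega⟩ ≥ (d ⟨i - 1, by omega⟩ : ℝ) - n + i + 1 := by
  classical
  have hLH : (G.lapMatrix ℝ).IsHermitian := G.isHermitian_lapMatrix ℝ
  set D := d ⟨i - 1, by omega⟩ with hD
  -- the set of `n - i + 1` vertices of large degree
  obtain ⟨S, hSdeg, hScard⟩ : ∃ S : Finset (Fin n), (∀ s ∈ S, D ≤ G.degree s) ∧
      #S = n - i + 1 := by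
    have h1 := card_filter_of_map_eq d _ (fun x => D ≤ x) hdeg
    have h2 : n - i + 1 ≤ #{v | D ≤ G.degree v} := by
      rw [← h1]
      have : Finset.Ici (⟨i - 1, by omega⟩ : Fin n) ⊆ ({j | D ≤ d j} : Finset (Fin n)) := by
        intro j hj
        simp only [Finset.mem_Ici] at hj
        simp only [mem_filter, mem_univ, true_and]
        exact hd hj
      have := Finset.card_le_card this
      rw [Fin.card_Ici] at this
      simp only at this
      omega
    obtain ⟨S, hS, hc⟩ := Finset.exists_subset_card_eq h2
    exact ⟨S, fun s hs => by simpa using hS hs, hc⟩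
  have hP := eig_principle hi hin (G.lapMatrix ℝ) hLH eigs heigs hroots S hScard.ge
  have hSne : S.Nonempty := Finset.card_pos.1 (by omega)
  -- neighbours inside and outside
  have hsplit : ∀ s, G.degree s = #{v ∈ S | G.Adj s v} + #{v | v ∉ S ∧ G.Adj s v} := by
    intro s
    rw [← Finset.card_union_of_disjoint]
    · rw [← SimpleGraph.card_neighborFinset_eq_degree]
      congr 1
      ext v
      simp only [SimpleGraph.mem_neighborFinset, mem_union, mem_filter, mem_univ, true_and]
      tauto
    · rw [Finset.disjoint_left]
      intro v hv
      simp only [mem_filter, mem_univ, true_and] at hv ⊢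
      tauto
  have hinsub : ∀ s ∈ S, ({v ∈ S | G.Adj s v} : Finset (Fin n)) ⊆ S.erase s := by
    intro s hs v hv
    simp only [mem_filter] at hv
    exact Finset.mem_erase.2 ⟨hv.2.ne', hv.1⟩
  have hincard : ∀ s ∈ S, #{v ∈ S | G.Adj s v} ≤ n - i := by
    intro s hs
    have := Finset.card_le_card (hinsub s hs)
    rw [Finset.card_erase_of_mem hs, hScard] at this
    simpa using this
  have hdom : ∀ s ∈ S, #{v | v ∉ S ∧ G.Adj s v} + (n - i) ≤ D →
      ∀ v ∈ S, v ≠ s → G.Adj s v := by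
    intro s hs hle v hv hvs
    have h1 := hSdeg s hs
    rw [hsplit s] at h1
    have h2 := Finset.eq_of_subset_of_card_le (hinsub s hs) (by
      rw [Finset.card_erase_of_mem hs, hScard]; omega)
    have h3 : v ∈ S.erase s := Finset.mem_erase.2 ⟨hvs, hv⟩
    rw [← h2] at h3
    exact (Finset.mem_filter.1 h3).2
  -- first case: enough neighbours outside
  have hfirst : ∀ e : ℕ, 1 ≤ e → (∀ s ∈ S, e ≤ #{v | v ∉ S ∧ G.Adj s v}) →
      (e : ℝ) ≤ eigs ⟨i - 1, by omega⟩ := by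
    intro e he hall
    obtain ⟨s, hs⟩ := hSne
    obtain ⟨t, ht⟩ := Finset.card_pos.1 (lt_of_lt_of_le he (hall s hs))
    simp only [mem_filter, mem_univ, true_and] at ht
    refine hP (Pi.single t 1) t ht.1 (by simp) (LinearMap.proj t) e ?_
    intro z c hz hf
    refine case_one G S e hall z ?_
    have hc : c = 0 := by
      have := hz t ht.1
      simp only [LinearMap.coe_proj, Function.eval] at hf
      rw [hf] at this
      simpa using this.symm
    intro v hv
    rw [hz v hv, hc, zero_mul]
  have hni : ((n - i : ℕ) : ℝ) = n - i := by push_cast [hin]; ring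
  rcases lt_trichotomy (D + 1) (n - i + 1) with hlt | heq | hgt
  · -- nonpositive bound
    have h0 : 0 ≤ eigs ⟨i - 1, by omega⟩ := by
      have hmem : eigs ⟨i - 1, by omega⟩ ∈ (G.lapMatrix ℝ).charpoly.roots := by
        rw [hroots]; exact Multiset.mem_map_of_mem _ (Finset.mem_univ_val _)
      rw [hLH.roots_charpoly_eq_eigenvalues] at hmem
      obtain ⟨j, _, hj⟩ := Multiset.mem_map.1 hmem
      rw [← hj]
      exact (SimpleGraph.posSemidef_lapMatrix ℝ G).eigenvalues_nonneg j
    have : (D : ℝ) + 1 ≤ (n - i : ℕ) := by exact_mod_cast (by omega : D + 1 ≤ n - i)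
    rw [hni] at this
    linarith
  · -- the bound is one
    have hDe : D = n - i := by omega
    have hDr : (D : ℝ) = n - i := by rw [hDe, hni]
    suffices h : (1 : ℝ) ≤ eigs ⟨i - 1, by omega⟩ by linarith
    by_cases hall : ∀ s ∈ S, 1 ≤ #{v | v ∉ S ∧ G.Adj s v}
    · exact_mod_cast hfirst 1 le_rfl hall
    push Not at hall
    obtain ⟨s₀, hs₀, hs₀'⟩ := hall
    have hdom0 := hdom s₀ hs₀ (by omega)
    by_cases hout : ∃ a b, a ∉ S ∧ b ∉ S ∧ G.Adj a b
    · obtain ⟨a, b, ha, hb, hab⟩ := hout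
      refine hP (fun v => (if v = a then 1 else 0) - (if v = b then 1 else 0)) a ha
        (by simp [hab.ne]) (∑ v ∈ S, LinearMap.proj v) 1 ?_
      intro z c hz hf
      refine case_three G S s₀ hs₀ hdom0 a b ha hb hab z c hz ?_
      simpa using hf
    push Not at hout
    set B : Finset (Fin n) := {s ∈ S | ∃ v, v ∉ S ∧ G.Adj s v} with hB
    have hBS : B ⊆ S := Finset.filter_subset _ _
    have hAd : ∀ s ∈ S \ B, ∀ v ∈ S, v ≠ s → G.Adj s v := by
      intro s hs
      obtain ⟨hsS, hsB⟩ := Finset.mem_sdiff.1 hs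
      refine hdom s hsS ?_
      have : #{v | v ∉ S ∧ G.Adj s v} = 0 := by
        rw [Finset.card_eq_zero, Finset.filter_eq_empty_iff]
        intro v _ hv
        exact hsB (Finset.mem_filter.2 ⟨hsS, v, hv⟩)
      omega
    have hun : S \ B ∪ B = S := Finset.sdiff_union_of_subset hBS
    by_cases hBn : B.Nonempty
    · have hg : ∀ s : Fin n, ∃ v, s ∈ B → v ∉ S ∧ G.Adj s v := by
        intro s
        by_cases hs : s ∈ B
        · obtain ⟨v, hv⟩ := (Finset.mem_filter.1 hs).2
          exact ⟨v, fun _ => hv⟩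
        · exact ⟨s, fun h => absurd h hs⟩
      choose g hg using hg
      obtain ⟨b, hb⟩ := hBn
      refine hP (fun v => if v ∈ B.image g then 1 else 0) (g b) (hg b hb).1
        (by simp only [Finset.mem_image_of_mem g hb, if_true]; exact one_ne_zero)
        (∑ v, LinearMap.proj v) 1 ?_
      intro z c hz hf
      refine case_four G (S \ B) B Finset.sdiff_disjoint (by rw [hun]; exact hAd)
        ⟨s₀, ?_⟩ ⟨b, hb⟩ g (by rw [hun]; exact hg) z c (by rw [hun]; exact hz) ?_
      · refine Finset.mem_sdiff.2 ⟨hs₀, fun h => ?_⟩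
        obtain ⟨v, hv⟩ := (Finset.mem_filter.1 h).2
        have : 0 < #{v | v ∉ S ∧ G.Adj s₀ v} :=
          Finset.card_pos.2 ⟨v, Finset.mem_filter.2 ⟨mem_univ _, hv⟩⟩
        omega
      · simpa using hf
    · exfalso
      rw [Finset.not_nonempty_iff_eq_empty] at hBn
      have hno : ∀ u ∈ S, ∀ v, G.Adj u v → v ∈ S := by
        intro u hu v huv
        by_contra hv
        have : u ∈ B := Finset.mem_filter.2 ⟨hu, v, hv, huv⟩
        rw [hBn] at this
        simp at this
      refine hnot ⟨S, hScard, fun u v => ⟨fun huv => ?_, fun ⟨hne, hu, hv⟩ => ?_⟩⟩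
      · by_cases hu : u ∈ S
        · exact ⟨huv.ne, hu, hno u hu v huv⟩
        · by_cases hv : v ∈ S
          · exact absurd (hno v hv u huv.symm) hu
          · exact absurd huv (hout u v hu hv)
      · exact hAd u (by rw [hBn]; simpa using hu) v hv hne.symm
  · -- the bound is at least two
    obtain ⟨e, he⟩ : ∃ e, D = n - i + e := ⟨D - (n - i), by omega⟩
    have he1 : 1 ≤ e := by omega
    have hDr : (D : ℝ) = n - i + e := by rw [he]; push_cast [hni]; ring
    suffices h : (e : ℝ) + 1 ≤ eigs ⟨i - 1, by omega⟩ by linarith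
    have hge : ∀ s ∈ S, e ≤ #{v | v ∉ S ∧ G.Adj s v} := by
      intro s hs
      have h1 := hSdeg s hs
      have h2 := hincard s hs
      rw [hsplit s] at h1
      omega
    by_cases hall : ∀ s ∈ S, e + 1 ≤ #{v | v ∉ S ∧ G.Adj s v}
    · exact_mod_cast hfirst (e + 1) (by omega) hall
    push Not at hall
    obtain ⟨s₀, hs₀, hs₀'⟩ := hall
    have hdom0 := hdom s₀ hs₀ (by omega)
    have hN : ∀ s : Fin n, ∃ N : Finset (Fin n), s ∈ S →
        (∀ v ∈ N, v ∉ S ∧ G.Adj s v) ∧ #N = e := by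
      intro s
      by_cases hs : s ∈ S
      · obtain ⟨N, hN, hc⟩ := Finset.exists_subset_card_eq (hge s hs)
        exact ⟨N, fun _ => ⟨fun v hv => by simpa using hN hv, hc⟩⟩
      · exact ⟨∅, fun h => absurd h hs⟩
    choose N hN using hN
    obtain ⟨t, ht⟩ := Finset.card_pos.1 (lt_of_lt_of_le he1 (hN s₀ hs₀).2.ge)
    refine hP (fun v => if v ∈ S.biUnion N then 1 else 0) t ((hN s₀ hs₀).1 t ht).1
      (by simp only [Finset.mem_biUnion.2 ⟨s₀, hs₀, ht⟩, if_true]; exact one_ne_zero)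
      (∑ v, LinearMap.proj v) _ ?_
    intro z c hz hf
    exact case_two G S s₀ hs₀ hdom0 e N (fun s hs => (hN s hs).1) (fun s hs => (hN s hs).2)
      z c hz (by simpa using hf)
end

section
/- Let G be a finite simple graph on n vertices and let 2 ≤ m ≤ n. Suppose G is not the disjoint union K_{n−m+1} + (m−1)K_1 and the complement Ḡ is not the disjoint union K_{m−1} + (n−m+1)K_1. Then d_m(G) − n + m + 1 ≤ λ_m(G) ≤ d_{m−1}(G) + m − 2, where λ_m(G) is the m-th smallest Laplacian eigenvalue of G and d_i(G) is the i-th smallest vertex degree of G. -/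
open Finset

noncomputable section BH
open Classical

variable {n : ℕ}

def qf (G : SimpleGraph (Fin n)) (x : Fin n → ℝ) : ℝ :=
  (∑ i, ∑ j, if G.Adj i j then (x i - x j) ^ 2 else 0) / 2

theorem qf_ge (G : SimpleGraph (Fin n)) (x : Fin n → ℝ) (f : Fin n → Finset (Fin n))
    (h1 : ∀ i, ∀ j ∈ f i, G.Adj i j) (h2 : ∀ i, ∀ j ∈ f i, i ∉ f j) :
    ∑ i, ∑ j ∈ f i, (x i - x j) ^ 2 ≤ qf G x := by
  unfold qf
  rw [le_div_iff₀ (by norm_num)]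
  have e1 : ∑ i, ∑ j ∈ f i, (x i - x j) ^ 2 = ∑ i, ∑ j, if j ∈ f i then (x i - x j) ^ 2 else 0 := by
    refine Finset.sum_congr rfl fun i _ => ?_
    rw [← Finset.sum_filter]; congr 1; ext; simp
  have e2 : ∑ i, ∑ j ∈ f i, (x i - x j) ^ 2 = ∑ i, ∑ j, if i ∈ f j then (x i - x j) ^ 2 else 0 := by
    rw [e1, Finset.sum_comm]
    refine Finset.sum_congr rfl fun i _ => Finset.sum_congr rfl fun j _ => ?_
    rw [sub_sq_comm]
  rw [mul_two]
  nth_rewrite 1 [e1]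
  rw [e2, ← Finset.sum_add_distrib]
  refine Finset.sum_le_sum fun i _ => ?_
  rw [← Finset.sum_add_distrib]
  refine Finset.sum_le_sum fun j _ => ?_
  have := sq_nonneg (x i - x j)
  by_cases a : j ∈ f i
  · simp [a, h1 i j a, h2 i j a]
  · by_cases b : i ∈ f j
    · simp [a, b, (h1 j i b).symm]
    · simp only [a, b, if_false, add_zero]; split_ifs <;> simp [this]

theorem qf_nonneg (G : SimpleGraph (Fin n)) (x : Fin n → ℝ) : 0 ≤ qf G x := by
  have := qf_ge G x (fun _ => ∅) (by simp) (by simp)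
  simpa using this

theorem exists_W (S : Finset (Fin n)) (M : Fin n → Fin n → ℝ) :
    ∃ W : Submodule ℝ (Fin n → ℝ), S.card ≤ Module.finrank ℝ W ∧
      ∀ x ∈ W, ∀ t, t ∉ S → ∑ s, M t s * x s = 0 := by
  let f : (Fin n → ℝ) →ₗ[ℝ] ({t // t ∈ Sᶜ} → ℝ) :=
    (Matrix.of fun (t : {t // t ∈ Sᶜ}) s => M t.1 s).mulVecLin
  refine ⟨LinearMap.ker f, ?_, ?_⟩
  · have h := f.finrank_range_add_finrank_ker
    have h2 := Submodule.finrank_le (LinearMap.range f)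
    simp only [Module.finrank_fintype_fun_eq_card, Fintype.card_coe, Fintype.card_fin,
      Finset.card_compl] at h h2
    have : S.card ≤ n := by simpa using S.card_le_univ
    omega
  · intro x hx t ht
    have := congrFun (LinearMap.mem_ker.1 hx) ⟨t, by simpa using ht⟩
    simpa [f, Matrix.mulVec, dotProduct] using this

theorem per_t (K : Finset (Fin n)) (x : Fin n → ℝ) (s0 : Fin n) (e y : ℝ) (he : 0 < e)
    (hy : e * y + ∑ s ∈ K, x s = 0) :
    (e + 1) * (∑ s ∈ K, x s ^ 2 + e * y ^ 2) ≤
      ∑ s ∈ K.erase s0, (x s0 - x s) ^ 2 + e * ∑ s ∈ K, (x s - y) ^ 2 := by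
  rcases K.eq_empty_or_nonempty with rfl | hK
  · have : y = 0 := by simpa [he.ne'] using hy
    simp [this]
  have hk : (1 : ℝ) ≤ K.card := by exact_mod_cast hK.card_pos
  have e1 : ∀ (A : Finset (Fin n)) (c : ℝ), ∑ s ∈ A, (x s - c) ^ 2 =
      ∑ s ∈ A, x s ^ 2 - 2 * c * ∑ s ∈ A, x s + A.card * c ^ 2 := by
    intro A c
    simp only [sub_sq, Finset.sum_add_distrib, Finset.sum_sub_distrib, Finset.mul_sum,
      Finset.sum_const, nsmul_eq_mul]
    congr 2
    refine Finset.sum_congr rfl fun i _ => by ring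
  have e2 : ∑ s ∈ K.erase s0, (x s0 - x s) ^ 2 = ∑ s ∈ K.erase s0, (x s - x s0) ^ 2 :=
    Finset.sum_congr rfl fun i _ => by ring
  rw [e2, e1, e1]
  have hZ : ∑ s ∈ K, x s = - (e * y) := by linarith
  have hb : 0 ≤ e * y ^ 2 * (K.card - 1) := by
    have : (0:ℝ) ≤ K.card - 1 := by linarith
    positivity
  by_cases h0 : s0 ∈ K
  · have a1 := Finset.add_sum_erase K x h0
    have a2 := Finset.add_sum_erase K (fun s => x s ^ 2) h0
    have a3 : ((K.erase s0).card : ℝ) ≥ 0 := by positivity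
    have a4 : ∑ s ∈ K.erase s0, x s = -(e * y) - x s0 := by linarith
    have a5 : ∑ s ∈ K.erase s0, x s ^ 2 = ∑ s ∈ K, x s ^ 2 - x s0 ^ 2 := by linarith
    rw [a4, a5, hZ]
    nlinarith [mul_nonneg a3 (sq_nonneg (x s0)), sq_nonneg (e * y + x s0)]
  · rw [Finset.erase_eq_of_notMem h0, hZ]
    nlinarith [mul_nonneg (sub_nonneg.2 hk) (sq_nonneg (x s0)), sq_nonneg (e * y + x s0)]

/-- the family of test spaces -/
def Good (G : SimpleGraph (Fin n)) (r : ℕ) (c : ℝ) : Prop :=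
  ∃ W : Submodule ℝ (Fin n → ℝ), r ≤ Module.finrank ℝ W ∧
      ∀ x ∈ W, c * ∑ i, x i ^ 2 ≤ qf G x

theorem good_of (G : SimpleGraph (Fin n)) (c : ℝ) (S : Finset (Fin n)) (M : Fin n → Fin n → ℝ)
    (f : Fin n → Finset (Fin n))
    (h1 : ∀ i, ∀ j ∈ f i, G.Adj i j) (h2 : ∀ i, ∀ j ∈ f i, i ∉ f j)
    (h : ∀ x : Fin n → ℝ, (∀ t, t ∉ S → ∑ s, M t s * x s = 0) →
      c * ∑ i, x i ^ 2 ≤ ∑ i, ∑ j ∈ f i, (x i - x j) ^ 2) : Good G S.card c := by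
  obtain ⟨W, hW, hx⟩ := exists_W S M
  exact ⟨W, hW, fun x m => (h x (hx x m)).trans (qf_ge G x f h1 h2)⟩

theorem good1 (G : SimpleGraph (Fin n)) (e : ℕ) (S : Finset (Fin n))
    (h : ∀ s ∈ S, e ≤ (univ.filter fun t => G.Adj s t ∧ t ∉ S).card) : Good G S.card e := by
  refine good_of G e S (fun t s => if s = t then 1 else 0)
    (fun i => if i ∈ S then univ.filter fun t => G.Adj i t ∧ t ∉ S else ∅) ?_ ?_ ?_
  · intro i j; split_ifs <;> simp +contextual
  · intro i j
    split_ifs <;> (simp +contextual; try tauto)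
  · intro x hx
    simp only [ite_mul, one_mul, zero_mul, Finset.sum_ite_eq', Finset.mem_univ, if_true] at hx
    have e1 : ∑ i, x i ^ 2 = ∑ i, if i ∈ S then x i ^ 2 else 0 := by
      refine Finset.sum_congr rfl fun i _ => ?_
      split_ifs with h
      · rfl
      · simp [hx i h]
    rw [e1, Finset.mul_sum]
    refine Finset.sum_le_sum fun i _ => ?_
    split_ifs with hi
    · have : ∑ j ∈ univ.filter fun t => G.Adj i t ∧ t ∉ S, (x i - x j) ^ 2 =
        ∑ j ∈ univ.filter fun t => G.Adj i t ∧ t ∉ S, (x i) ^ 2 := by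
        refine Finset.sum_congr rfl fun j hj => ?_
        simp only [Finset.mem_filter] at hj
        rw [hx j hj.2.2, sub_zero]
      rw [this, Finset.sum_const, nsmul_eq_mul]
      have := h i hi
      gcongr
    · simp

theorem good2 (G : SimpleGraph (Fin n)) (e : ℕ) (he : 0 < e) (S : Finset (Fin n))
    (h : ∀ s ∈ S, e ≤ (univ.filter fun t => G.Adj s t ∧ t ∉ S).card)
    (s0 : Fin n) (hs0 : s0 ∈ S) (hadj : ∀ s ∈ S, s ≠ s0 → G.Adj s0 s) :
    Good G S.card (e + 1) := by
  have : ∀ s, ∃ N : Finset (Fin n), s ∈ S → (N ⊆ (univ.filter fun t => G.Adj s t ∧ t ∉ S) ∧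
      N.card = e) := by
    intro s
    by_cases hs : s ∈ S
    · obtain ⟨N, hN⟩ := Finset.exists_subset_card_eq (h s hs)
      exact ⟨N, fun _ => hN⟩
    · exact ⟨∅, fun h => absurd h hs⟩
  choose N hN using this
  have hN1 : ∀ s ∈ S, ∀ t ∈ N s, G.Adj s t ∧ t ∉ S := by
    intro s hs t ht
    simpa using (hN s hs).1 ht
  have he' : (0:ℝ) < e := by exact_mod_cast he
  refine good_of G (e+1) S (fun t s => (if s = t then (e:ℝ) else 0) +
      if s ∈ S then (if t ∈ N s then 1 else 0) else 0)
    (fun i => (if i = s0 then S.erase s0 else ∅) ∪ (if i ∈ S then N i else ∅)) ?_ ?_ ?_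
  · intro i j hj
    rw [Finset.mem_union] at hj
    rcases hj with hj | hj
    · split_ifs at hj with h1
      · subst h1
        rw [Finset.mem_erase] at hj
        exact hadj j hj.2 hj.1
      · simp at hj
    · split_ifs at hj with h1
      · exact (hN1 i h1 j hj).1
      · simp at hj
  · intro i j hj hi
    rw [Finset.mem_union] at hj hi
    rcases hj with hj | hj
    · split_ifs at hj with h1
      · subst h1
        rw [Finset.mem_erase] at hj
        rcases hi with hi | hi
        · simp [hj.1] at hi
        · rw [if_pos hj.2] at hi
          exact (hN1 _ hj.2 _ hi).2 hs0
      · simp at hj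
    · split_ifs at hj with h1
      · have := (hN1 i h1 j hj).2
        rw [if_neg this, if_neg (fun h : j = s0 => this (h ▸ hs0))] at hi
        simp at hi
      · simp at hj
  · intro x hx
    have hx' : ∀ t, t ∉ S → e * x t + ∑ s ∈ S.filter (fun s => t ∈ N s), x s = 0 := by
      intro t ht
      have := hx t ht
      simp only [add_mul, ite_mul, one_mul, zero_mul, Finset.sum_add_distrib, Finset.sum_ite_eq',
        Finset.mem_univ, if_true] at this
      rw [← this, Finset.sum_filter]
      congr 1
      rw [← Finset.sum_filter (fun s => s ∈ S), Finset.filter_mem_eq_inter, Finset.univ_inter]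
    -- double counting
    have dc : ∀ (A : Finset (Fin n)) (hA : A ⊆ S) (g : Fin n → Fin n → ℝ),
        ∑ s ∈ A, ∑ t ∈ N s, g s t = ∑ t ∈ Sᶜ, ∑ s ∈ A.filter (fun s => t ∈ N s), g s t := by
      intro A hA g
      refine Finset.sum_comm' ?_
      intro s t
      simp only [Finset.mem_filter, Finset.mem_compl]
      constructor
      · rintro ⟨h1, h2⟩; exact ⟨⟨h1, h2⟩, (hN1 s (hA h1) t h2).2⟩
      · rintro ⟨h1, h2⟩; exact h1
    have dc1 : ∀ (A : Finset (Fin n)) (hA : A ⊆ S) (g : Fin n → ℝ),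
        e * ∑ s ∈ A, g s = ∑ t ∈ Sᶜ, ∑ s ∈ A.filter (fun s => t ∈ N s), g s := by
      intro A hA g
      rw [← dc A hA (fun s _ => g s), Finset.mul_sum]
      refine Finset.sum_congr rfl fun s hs => ?_
      rw [Finset.sum_const, (hN s (hA hs)).2, nsmul_eq_mul]
    have R : ∑ i, ∑ j ∈ (if i = s0 then S.erase s0 else ∅) ∪ (if i ∈ S then N i else ∅),
        (x i - x j) ^ 2 = ∑ s ∈ S.erase s0, (x s0 - x s) ^ 2 +
          ∑ s ∈ S, ∑ t ∈ N s, (x s - x t) ^ 2 := by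
      have : ∀ i, ∑ j ∈ (if i = s0 then S.erase s0 else ∅) ∪ (if i ∈ S then N i else ∅),
        (x i - x j) ^ 2 = (if i = s0 then ∑ s ∈ S.erase s0, (x i - x s) ^ 2 else 0) +
          if i ∈ S then ∑ t ∈ N i, (x i - x t) ^ 2 else 0 := by
        intro i
        rw [Finset.sum_union]
        · split_ifs <;> simp
        · rw [Finset.disjoint_left]
          intro a ha hb
          split_ifs at ha hb
          · exact (hN1 i (by assumption) a hb).2 (Finset.mem_of_mem_erase ha)
          all_goals simp_all
      simp only [this, Finset.sum_add_distrib, Finset.sum_ite_eq', Finset.mem_univ, if_true]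
      congr 1
      rw [← Finset.sum_filter]
      congr 1
      ext; simp
    rw [R]
    have key : ∑ t ∈ Sᶜ, (e + 1 : ℝ) * (∑ s ∈ S.filter (fun s => t ∈ N s), x s ^ 2 + e * x t ^ 2) ≤
        ∑ t ∈ Sᶜ, (∑ s ∈ (S.filter (fun s => t ∈ N s)).erase s0, (x s0 - x s) ^ 2 +
          e * ∑ s ∈ S.filter (fun s => t ∈ N s), (x s - x t) ^ 2) :=
      Finset.sum_le_sum fun t ht => per_t _ x s0 e (x t) he' (hx' t (by simpa using ht))
    rw [Finset.sum_add_distrib, ← Finset.mul_sum, ← Finset.mul_sum, Finset.sum_add_distrib,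
      ← dc1 S subset_rfl, ← Finset.mul_sum, ← dc S subset_rfl (fun s t => (x s - x t) ^ 2)] at key
    have e3 : ∑ t ∈ Sᶜ, ∑ s ∈ (S.filter (fun s => t ∈ N s)).erase s0, (x s0 - x s) ^ 2 =
        e * ∑ s ∈ S.erase s0, (x s0 - x s) ^ 2 := by
      rw [dc1 _ (Finset.erase_subset _ _)]
      refine Finset.sum_congr rfl fun t _ => ?_
      rw [Finset.filter_erase]
    rw [e3] at key
    rw [← Finset.sum_add_sum_compl S]
    refine le_of_mul_le_mul_left ?_ he'
    linarith

/-- star with leaves `A` -/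
theorem good3 (G : SimpleGraph (Fin n)) (v : Fin n) (A : Finset (Fin n))
    (hA : ∀ a ∈ A, G.Adj v a) : Good G A.card 1 := by
  have hv : v ∉ A := fun h => G.irrefl (hA v h)
  refine good_of G 1 A (fun t s => if t = v then (if s ∈ insert v A then 1 else 0)
    else if s = t then 1 else 0) (fun i => if i = v then A else ∅) ?_ ?_ ?_
  · intro i j hj
    split_ifs at hj with h
    · subst h; exact hA j hj
    · simp at hj
  · intro i j hj
    split_ifs at hj with h
    · have : j ≠ v := fun h => hv (h ▸ hj)
      simp [this]
    · simp at hj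
  · intro x hx
    have h0 : ∀ t, t ∉ insert v A → x t = 0 := by
      intro t ht
      rw [Finset.mem_insert, not_or] at ht
      simpa [ht.1] using hx t ht.2
    have h1 : x v + ∑ s ∈ A, x s = 0 := by
      have := hx v hv
      simp only [if_true, ite_mul, one_mul, zero_mul] at this
      rw [← Finset.sum_filter, Finset.filter_mem_eq_inter, Finset.univ_inter,
        Finset.sum_insert hv] at this
      exact this
    have e1 : ∑ i, x i ^ 2 = x v ^ 2 + ∑ s ∈ A, x s ^ 2 := by
      rw [← Finset.sum_insert (f := fun s => x s ^ 2) hv]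
      symm
      refine Finset.sum_subset (Finset.subset_univ _) fun t _ ht => by simp [h0 t ht]
    have e2 : ∑ i, ∑ j ∈ (if i = v then A else ∅), (x i - x j) ^ 2 = ∑ j ∈ A, (x v - x j) ^ 2 := by
      rw [Finset.sum_eq_single v]
      · simp
      · intro b _ hb; simp [hb]
      · simp
    rw [e1, e2]
    simp only [sub_sq, Finset.sum_add_distrib, Finset.sum_sub_distrib, ← Finset.mul_sum,
      Finset.sum_const, nsmul_eq_mul]
    have : ∑ s ∈ A, x s = - x v := by linarith
    rw [this]
    nlinarith [mul_nonneg (Nat.cast_nonneg (α := ℝ) A.card) (sq_nonneg (x v)), sq_nonneg (x v)]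


/-- star with leaves `A` and an extra disjoint edge -/
theorem good4 (G : SimpleGraph (Fin n)) (v : Fin n) (A : Finset (Fin n))
    (hA : ∀ a ∈ A, G.Adj v a) (a b : Fin n) (hab : G.Adj a b) (ha : a ∉ insert v A)
    (hb : b ∉ insert v A) : Good G (A.card + 1) 1 := by
  have hv : v ∉ A := fun h => G.irrefl (hA v h)
  rw [Finset.mem_insert, not_or] at ha hb
  have hab' := hab.ne
  rw [← Finset.card_insert_of_notMem ha.2]
  refine good_of G 1 (insert a A) (fun t s => if t = v then (if s ∈ insert v A then 1 else 0)
    else if t = b then (if s ∈ ({a, b} : Finset (Fin n)) then 1 else 0)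
    else if s = t then 1 else 0) (fun i => if i = v then A else if i = a then {b} else ∅) ?_ ?_ ?_
  · intro i j hj
    split_ifs at hj with h h'
    · subst h; exact hA j hj
    · rw [Finset.mem_singleton] at hj; subst hj; subst h'; exact hab
    · simp at hj
  · intro i j hj
    split_ifs at hj with h h'
    · have h1 : j ≠ v := fun h => hv (h ▸ hj)
      have h2 : j ≠ a := fun h => ha.2 (h ▸ hj)
      simp [h1, h2]
    · rw [Finset.mem_singleton] at hj; subst hj; subst h'
      simp [hb.1, hab'.symm]
    · simp at hj
  · intro x hx
    have h0 : ∀ t, t ∉ insert v (insert a (insert b A)) → x t = 0 := by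
      intro t ht
      simp only [Finset.mem_insert, not_or] at ht
      have := hx t (by simp [ht])
      simpa [ht.1, ht.2.2.1] using this
    have h1 : x v + ∑ s ∈ A, x s = 0 := by
      have := hx v (by simp [hv, Ne.symm ha.1])
      simp only [if_true, ite_mul, one_mul, zero_mul] at this
      rw [← Finset.sum_filter, Finset.filter_mem_eq_inter, Finset.univ_inter,
        Finset.sum_insert hv] at this
      exact this
    have h2 : x a + x b = 0 := by
      have := hx b (by simp [hb.2, hab'.symm])
      simp only [if_true, if_neg hb.1, ite_mul, one_mul, zero_mul] at this
      rw [← Finset.sum_filter, Finset.filter_mem_eq_inter, Finset.univ_inter,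
        Finset.sum_pair hab'] at this
      exact this
    have e1 : ∑ i, x i ^ 2 = x v ^ 2 + (x a ^ 2 + (x b ^ 2 + ∑ s ∈ A, x s ^ 2)) := by
      rw [← Finset.sum_insert (f := fun s => x s ^ 2) hb.2,
        ← Finset.sum_insert (f := fun s => x s ^ 2) (by simp [ha.2, hab']),
        ← Finset.sum_insert (f := fun s => x s ^ 2) (by simp [hv, Ne.symm ha.1, Ne.symm hb.1])]
      symm
      refine Finset.sum_subset (Finset.subset_univ _) fun t _ ht => by simp [h0 t ht]
    have e2 : ∑ i, ∑ j ∈ (if i = v then A else if i = a then {b} else ∅), (x i - x j) ^ 2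
        = ∑ j ∈ A, (x v - x j) ^ 2 + (x a - x b) ^ 2 := by
      have : ∀ i, ∑ j ∈ (if i = v then A else if i = a then {b} else ∅), (x i - x j) ^ 2 =
        (if i = v then ∑ j ∈ A, (x i - x j) ^ 2 else 0) +
          if i = a then (x i - x b) ^ 2 else 0 := by
        intro i
        by_cases h : i = v
        · have : i ≠ a := fun h' => ha.1 (h'.symm.trans h)
          simp [h, Ne.symm ha.1]
        · by_cases h' : i = a <;> simp [h, h', ha.1]
      simp only [this, Finset.sum_add_distrib, Finset.sum_ite_eq', Finset.mem_univ, if_true]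
    rw [e1, e2]
    simp only [sub_sq (x v), Finset.sum_add_distrib, Finset.sum_sub_distrib, ← Finset.mul_sum,
      Finset.sum_const, nsmul_eq_mul]
    have : ∑ s ∈ A, x s = - x v := by linarith
    have h3 : x b = - x a := by linarith
    rw [this, h3]
    nlinarith [mul_nonneg (Nat.cast_nonneg (α := ℝ) A.card) (sq_nonneg (x v)), sq_nonneg (x v),
      sq_nonneg (x a)]

/-- complete bipartite -/
theorem good5 (G : SimpleGraph (Fin n)) (v w : Fin n) (hvw : v ≠ w) (A : Finset (Fin n))
    (hAv : ∀ a ∈ A, G.Adj v a) (hAw : ∀ a ∈ A, G.Adj w a) (hne : A.Nonempty) :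
    Good G (A.card + 1) 1 := by
  have hv : v ∉ A := fun h => G.irrefl (hAv v h)
  have hw : w ∉ A := fun h => G.irrefl (hAw w h)
  rw [← Finset.card_insert_of_notMem hv]
  refine good_of G 1 (insert v A) (fun t s => if t = w then
    (if s ∈ insert v (insert w A) then 1 else 0)
    else if s = t then 1 else 0) (fun i => if i = v ∨ i = w then A else ∅) ?_ ?_ ?_
  · intro i j hj
    split_ifs at hj with h
    · rcases h with h | h
      · subst h; exact hAv j hj
      · subst h; exact hAw j hj
    · simp at hj
  · intro i j hj
    split_ifs at hj with h
    · have h1 : j ≠ v := fun h => hv (h ▸ hj)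
      have h2 : j ≠ w := fun h => hw (h ▸ hj)
      simp [h1, h2]
    · simp at hj
  · intro x hx
    have hv' : v ∉ insert w A := by simp [hv, hvw]
    have h0 : ∀ t, t ∉ insert v (insert w A) → x t = 0 := by
      intro t ht
      simp only [Finset.mem_insert, not_or] at ht
      have := hx t (by simp [ht])
      simpa [ht.2.1] using this
    have h1 : x v + (x w + ∑ s ∈ A, x s) = 0 := by
      have := hx w (by simp [hw, hvw.symm])
      simp only [if_true, ite_mul, one_mul, zero_mul] at this
      rw [← Finset.sum_filter, Finset.filter_mem_eq_inter, Finset.univ_inter,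
        Finset.sum_insert hv', Finset.sum_insert hw] at this
      exact this
    have e1 : ∑ i, x i ^ 2 = x v ^ 2 + (x w ^ 2 + ∑ s ∈ A, x s ^ 2) := by
      rw [← Finset.sum_insert (f := fun s => x s ^ 2) hw,
        ← Finset.sum_insert (f := fun s => x s ^ 2) hv']
      symm
      refine Finset.sum_subset (Finset.subset_univ _) fun t _ ht => by simp [h0 t ht]
    have e2 : ∑ i, ∑ j ∈ (if i = v ∨ i = w then A else ∅), (x i - x j) ^ 2
        = ∑ j ∈ A, (x v - x j) ^ 2 + ∑ j ∈ A, (x w - x j) ^ 2 := by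
      have : ∀ i, ∑ j ∈ (if i = v ∨ i = w then A else ∅), (x i - x j) ^ 2 =
        (if i = v then ∑ j ∈ A, (x i - x j) ^ 2 else 0) +
          if i = w then ∑ j ∈ A, (x i - x j) ^ 2 else 0 := by
        intro i
        by_cases h : i = v
        · simp [h, hvw]
        · by_cases h' : i = w <;> simp [h, h', hvw.symm]
      simp only [this, Finset.sum_add_distrib, Finset.sum_ite_eq', Finset.mem_univ, if_true]
    rw [e1, e2]
    simp only [sub_sq, Finset.sum_add_distrib, Finset.sum_sub_distrib, ← Finset.mul_sum,
      Finset.sum_const, nsmul_eq_mul]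
    have : ∑ s ∈ A, x s = - x v - x w := by linarith
    have hp : 0 ≤ ∑ s ∈ A, x s ^ 2 := Finset.sum_nonneg fun _ _ => sq_nonneg _
    have hk : (1 : ℝ) ≤ A.card := by exact_mod_cast hne.card_pos
    rw [this]
    nlinarith [mul_nonneg (sub_nonneg.2 hk) (sq_nonneg (x v)),
      mul_nonneg (sub_nonneg.2 hk) (sq_nonneg (x w)), sq_nonneg (x v + x w)]

theorem Good.mono {G : SimpleGraph (Fin n)} {r r' : ℕ} {c c' : ℝ} (h : Good G r' c')
    (hr : r ≤ r') (hc : c ≤ c') : Good G r c := by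
  obtain ⟨W, h1, h2⟩ := h
  refine ⟨W, hr.trans h1, fun x hx => le_trans ?_ (h2 x hx)⟩
  exact mul_le_mul_of_nonneg_right hc (Finset.sum_nonneg fun _ _ => sq_nonneg _)

theorem good_case1 (G : SimpleGraph (Fin n)) (S : Finset (Fin n))
    (hdeg : ∀ s ∈ S, S.card ≤ (univ.filter fun t => G.Adj s t).card + 1)
    (hnot : ¬ IsCliquePlusIsolated G S.card) (hS : S.Nonempty) : Good G S.card 1 := by
  by_cases hbig : ∃ v, S.card ≤ (univ.filter fun t => G.Adj v t).card
  · obtain ⟨v, hv⟩ := hbig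
    exact (good3 G v _ (fun a ha => by simpa using ha)).mono hv le_rfl
  push Not at hbig
  by_cases hedge : ∃ v ∈ S, ∃ a b, G.Adj a b ∧ a ∉ insert v (univ.filter fun t => G.Adj v t) ∧
      b ∉ insert v (univ.filter fun t => G.Adj v t)
  · obtain ⟨v, hv, a, b, hab, ha, hb⟩ := hedge
    exact (good4 G v _ (fun a ha => by simpa using ha) a b hab ha hb).mono (hdeg v hv) le_rfl
  push Not at hedge
  by_cases hpair : ∃ v ∈ S, ∃ w ∈ S, v ≠ w ∧ ¬ G.Adj v w
  · obtain ⟨v, hv, w, hw, hne, hnadj⟩ := hpair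
    have hsub : (univ.filter fun t => G.Adj w t) ⊆ (univ.filter fun t => G.Adj v t) := by
      intro t ht
      simp only [Finset.mem_filter, Finset.mem_univ, true_and] at ht ⊢
      have := hedge v hv w t ht (by simp [hne.symm, hnadj])
      simp only [Finset.mem_insert, Finset.mem_filter, Finset.mem_univ, true_and] at this
      rcases this with h | h
      · subst h; exact absurd ht.symm hnadj
      · exact h
    refine (good5 G v w hne (univ.filter fun t => G.Adj w t) (fun a ha => ?_)
      (fun a ha => by simpa using ha) ?_).mono (hdeg w hw) le_rfl
    · simpa using hsub ha
    · rw [← Finset.card_pos]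
      have h1 := hdeg w hw
      have h2 : 2 ≤ S.card := by
        have := Finset.card_le_card (show ({v, w} : Finset (Fin n)) ⊆ S by
          intro t; simp only [Finset.mem_insert, Finset.mem_singleton]
          rintro (rfl | rfl) <;> assumption)
        rwa [Finset.card_pair hne] at this
      omega
  push Not at hpair
  exfalso
  have hSN : ∀ v ∈ S, S = insert v (univ.filter fun t => G.Adj v t) := by
    intro v hv
    refine Finset.eq_of_subset_of_card_le ?_ ?_
    · intro w hw
      by_cases h : v = w
      · simp [h]
      · simp [hpair v hv w hw h]
    · exact (Finset.card_insert_le _ _).trans (hbig v)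
  apply hnot
  refine ⟨S, rfl, fun u v => ⟨fun h => ⟨h.ne, ?_⟩, fun h => hpair u h.2.1 v h.2.2 h.1⟩⟩
  have key : ∀ u v, G.Adj u v → u ∈ S → v ∈ S := by
    intro u v huv hu
    rw [hSN u hu]; simp [huv]
  by_cases hu : u ∈ S
  · exact ⟨hu, key u v h hu⟩
  · have hv : v ∉ S := fun hv => hu (key v u h.symm hv)
    obtain ⟨s, hs⟩ := hS
    have := hedge s hs u v h (by rw [← hSN s hs]; exact hu)
    rw [← hSN s hs] at this
    exact absurd this hv

theorem bh_main (G : SimpleGraph (Fin n)) (S : Finset (Fin n)) (hS : S.Nonempty) (δ : ℕ)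
    (hdeg : ∀ s ∈ S, δ ≤ (univ.filter fun t => G.Adj s t).card)
    (hnot : ¬ IsCliquePlusIsolated G S.card) :
    Good G S.card ((δ : ℝ) - S.card + 2) := by
  rcases lt_trichotomy (δ + 1) S.card with h | h | h
  · refine ⟨⊤, ?_, fun x _ => ?_⟩
    · simpa using S.card_le_univ
    · have : (δ : ℝ) - S.card + 2 ≤ 0 := by
        have : ((δ + 2 : ℕ) : ℝ) ≤ S.card := by exact_mod_cast h
        push_cast at this; linarith
      have h2 : 0 ≤ ∑ i, x i ^ 2 := Finset.sum_nonneg fun _ _ => sq_nonneg _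
      exact (mul_nonpos_of_nonpos_of_nonneg this h2).trans (qf_nonneg G x)
  · refine (good_case1 G S (fun s hs => ?_) hnot hS).mono le_rfl ?_
    · have := hdeg s hs; omega
    · rw [← h]; push_cast; linarith
  · obtain ⟨e, he⟩ : ∃ e, δ + 1 = S.card + e := ⟨δ + 1 - S.card, by omega⟩
    have he' : (δ : ℝ) - S.card + 2 = e + 1 := by
      have : ((δ + 1 : ℕ) : ℝ) = ((S.card + e : ℕ) : ℝ) := by rw [he]
      push_cast at this; linarith
    rw [he']
    have split : ∀ s, (univ.filter fun t => G.Adj s t).card =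
        (univ.filter fun t => G.Adj s t ∧ t ∉ S).card + (S.filter fun t => G.Adj s t).card := by
      intro s
      rw [← Finset.card_union_of_disjoint]
      · congr 1; ext t
        simp only [Finset.mem_filter, Finset.mem_univ, true_and, Finset.mem_union]; tauto
      · rw [Finset.disjoint_left]; intro t
        simp only [Finset.mem_filter, Finset.mem_univ, true_and]; tauto
    have hsub : ∀ s ∈ S, (S.filter fun t => G.Adj s t) ⊆ S.erase s := by
      intro s hs t
      simp only [Finset.mem_filter, Finset.mem_erase]
      exact fun h => ⟨h.2.ne', h.1⟩
    by_cases hs0 : ∃ s0 ∈ S, ∀ s ∈ S, s ≠ s0 → G.Adj s0 s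
    · obtain ⟨s0, hs0, hadj⟩ := hs0
      refine good2 G e (by omega) S (fun s hs => ?_) s0 hs0 hadj
      have h1 := hdeg s hs
      have hpos := hS.card_pos
      have h2 := Finset.card_le_card (hsub s hs)
      rw [Finset.card_erase_of_mem hs] at h2
      have := split s
      omega
    · push Not at hs0
      have := good1 G (e + 1) S (fun s hs => ?_)
      · exact_mod_cast this
      obtain ⟨w, hw, hws, hadj⟩ := hs0 s hs
      have h1 := hdeg s hs
      have h2 : (S.filter fun t => G.Adj s t) ⊆ (S.erase s).erase w := by
        intro t ht
        have h3 := hsub s hs ht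
        rw [Finset.mem_erase]
        refine ⟨?_, h3⟩
        rintro rfl
        simp only [Finset.mem_filter] at ht
        exact hadj ht.2
      have h3 := Finset.card_le_card h2
      rw [Finset.card_erase_of_mem (Finset.mem_erase.2 ⟨hws, hw⟩),
        Finset.card_erase_of_mem hs] at h3
      have h5 : 2 ≤ S.card := by
        have := Finset.card_le_card (show ({w, s} : Finset (Fin n)) ⊆ S by
          intro t; simp only [Finset.mem_insert, Finset.mem_singleton]
          rintro (rfl | rfl) <;> assumption)
        rwa [Finset.card_pair hws] at this
      have := split s
      omega


theorem exists_perm_of_map_eq {α : Type*} (f g : Fin n → α)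
    (h : (univ : Finset (Fin n)).val.map f = (univ : Finset (Fin n)).val.map g) :
    ∃ σ : Equiv.Perm (Fin n), ∀ i, f i = g (σ i) := by
  have hc : ∀ a, Fintype.card {i // f i = a} = Fintype.card {i // g i = a} := by
    intro a
    have := congrArg (Multiset.count a) h
    rw [Multiset.count_map, Multiset.count_map] at this
    have e : ∀ u : Fin n → α, (univ.filter fun i => u i = a) = univ.filter fun i => a = u i :=
      fun u => Finset.filter_congr fun _ _ => eq_comm
    rw [Fintype.card_subtype, Fintype.card_subtype, e f, e g]
    exact this
  let σ := ((Equiv.sigmaFiberEquiv f).symm.trans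
    (Equiv.sigmaCongrRight fun a => Fintype.equivOfCardEq (hc a))).trans (Equiv.sigmaFiberEquiv g)
  refine ⟨σ, fun i => ?_⟩
  have := ((Fintype.equivOfCardEq (hc (f i))) ⟨i, rfl⟩).2
  exact this.symm

open Matrix in
theorem exists_eigenbasis (L : Matrix (Fin n) (Fin n) ℝ) (hL : L.IsHermitian) (eigs : Fin n → ℝ)
    (hroots : L.charpoly.roots = (univ : Finset (Fin n)).val.map eigs) :
    ∃ b : Fin n → Fin n → ℝ, (∀ i j, b i ⬝ᵥ b j = if i = j then 1 else 0) ∧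
      ∀ i, L *ᵥ b i = eigs i • b i := by
  rw [hL.roots_charpoly_eq_eigenvalues] at hroots
  obtain ⟨σ, hσ⟩ := exists_perm_of_map_eq _ _ hroots.symm
  refine ⟨fun i => hL.eigenvectorBasis (σ i), fun i j => ?_, fun i => ?_⟩
  · have := orthonormal_iff_ite.1 hL.eigenvectorBasis.orthonormal (σ j) (σ i)
    rw [EuclideanSpace.inner_eq_star_dotProduct] at this
    rw [dotProduct_comm] at this
    by_cases hij : i = j
    · subst hij; simpa using this
    · have h2 : σ j ≠ σ i := fun h => hij (σ.injective h).symm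
      rw [if_neg h2] at this
      rw [if_neg hij, ← this, dotProduct_comm]
      simp
  · rw [hL.mulVec_eigenvectorBasis, hσ]
    rfl

open Matrix in
theorem exists_U (L : Matrix (Fin n) (Fin n) ℝ) (eigs : Fin n → ℝ)
    (b : Fin n → Fin n → ℝ) (hb : ∀ i j, b i ⬝ᵥ b j = if i = j then 1 else 0)
    (hLb : ∀ i, L *ᵥ b i = eigs i • b i) (I : Finset (Fin n)) :
    ∃ U : Submodule ℝ (Fin n → ℝ), Module.finrank ℝ U = I.card ∧
      ∀ x ∈ U, ∃ c : I → ℝ, ∑ i, x i ^ 2 = ∑ i, c i ^ 2 ∧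
        x ⬝ᵥ L *ᵥ x = ∑ i : I, eigs i * c i ^ 2 := by
  let B : Matrix (Fin n) I ℝ := Matrix.of fun t i => b i t
  have hBB : Bᵀ * B = 1 := by
    ext i j
    rw [Matrix.mul_apply, Matrix.one_apply]
    have := hb i j
    by_cases hij : i = j
    · subst hij; simpa [B, dotProduct] using this
    · have h2 : i.1 ≠ j.1 := fun h => hij (Subtype.ext h)
      rw [if_neg h2] at this
      rw [if_neg hij, ← this]
      rfl
  have hLB : L * B = B * Matrix.diagonal (fun i : I => eigs i) := by
    ext t i
    have := congrFun (hLb i) t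
    rw [Matrix.mul_diagonal, Matrix.mul_apply]
    simpa [B, Matrix.mulVec, dotProduct, mul_comm] using this
  have inj : Function.Injective B.mulVecLin := by
    intro c c' h
    have := congrArg (fun y => Bᵀ *ᵥ y) h
    simpa [Matrix.mulVec_mulVec, hBB] using this
  refine ⟨LinearMap.range B.mulVecLin, ?_, ?_⟩
  · rw [LinearMap.finrank_range_of_inj inj]; simp
  · rintro _ ⟨c, rfl⟩
    have key : ∀ c', B *ᵥ c ⬝ᵥ B *ᵥ c' = c ⬝ᵥ c' := by
      intro c'
      rw [Matrix.dotProduct_mulVec, ← Matrix.mulVec_transpose, Matrix.mulVec_mulVec, hBB,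
        Matrix.one_mulVec]
    refine ⟨c, ?_, ?_⟩
    · have := key c
      simpa [dotProduct, sq] using this
    · rw [Matrix.mulVecLin_apply, Matrix.mulVec_mulVec, hLB, ← Matrix.mulVec_mulVec, key]
      simp only [dotProduct, Matrix.mulVec_diagonal]
      refine Finset.sum_congr rfl fun i _ => by ring

theorem exists_inter (U W : Submodule ℝ (Fin n → ℝ))
    (h : n < Module.finrank ℝ U + Module.finrank ℝ W) :
    ∃ x ∈ U, x ∈ W ∧ 0 < ∑ i, x i ^ 2 := by
  have h1 := Submodule.finrank_sup_add_finrank_inf_eq U W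
  have h2 := Submodule.finrank_le (U ⊔ W)
  rw [Module.finrank_fintype_fun_eq_card, Fintype.card_fin] at h2
  have h3 : U ⊓ W ≠ ⊥ := by
    intro h
    rw [h, finrank_bot] at h1
    omega
  obtain ⟨x, hx, hne⟩ := Submodule.exists_mem_ne_zero_of_ne_bot h3
  refine ⟨x, hx.1, hx.2, ?_⟩
  obtain ⟨i, hi⟩ := Function.ne_iff.1 hne
  exact Finset.sum_pos' (fun _ _ => sq_nonneg _) ⟨i, Finset.mem_univ _, pow_pos_of_ne hi⟩
where
  pow_pos_of_ne {a : ℝ} (h : a ≠ 0) : 0 < a ^ 2 := by positivity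

open Matrix in
theorem qf_eq (G : SimpleGraph (Fin n)) [DecidableRel G.Adj] (x : Fin n → ℝ) :
    x ⬝ᵥ (G.lapMatrix ℝ) *ᵥ x = qf G x := by
  rw [← Matrix.toLinearMap₂'_apply', SimpleGraph.lapMatrix_toLinearMap₂', qf]
  congr!

theorem qf_add_compl (G : SimpleGraph (Fin n)) (x : Fin n → ℝ) :
    qf G x + qf Gᶜ x = n * ∑ i, x i ^ 2 - (∑ i, x i) ^ 2 := by
  have h1 : qf G x + qf Gᶜ x = (∑ i, ∑ j, (x i - x j) ^ 2) / 2 := by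
    unfold qf
    rw [← add_div, ← Finset.sum_add_distrib]
    congr 1
    refine Finset.sum_congr rfl fun i _ => ?_
    rw [← Finset.sum_add_distrib]
    refine Finset.sum_congr rfl fun j _ => ?_
    rw [SimpleGraph.compl_adj]
    by_cases hij : i = j
    · simp [hij]
    · by_cases h : G.Adj i j <;> simp [h, hij]
  rw [h1]
  simp only [sub_sq, Finset.sum_add_distrib, Finset.sum_sub_distrib, ← Finset.mul_sum,
    Finset.sum_const, nsmul_eq_mul, ← Finset.sum_mul, Finset.card_univ, Fintype.card_fin]
  ring

theorem qf_shift (G : SimpleGraph (Fin n)) (x : Fin n → ℝ) (a : ℝ) :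
    qf G (x + a • 1) = qf G x := by
  simp [qf]

open Matrix in
/-- Rayleigh lower bound. -/
theorem eig_ge (G : SimpleGraph (Fin n)) [DecidableRel G.Adj]
    (eigs : Fin n → ℝ) (heigs : Monotone eigs)
    (hroots : (G.lapMatrix ℝ).charpoly.roots = (univ : Finset (Fin n)).val.map eigs)
    (k : Fin n) (r : ℕ) (hr : n ≤ r + k) (c : ℝ) (h : Good G r c) : c ≤ eigs k := by
  obtain ⟨W, hW, hx⟩ := h
  obtain ⟨b, hb, hLb⟩ := exists_eigenbasis _ (G.isHermitian_lapMatrix ℝ) eigs hroots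
  obtain ⟨U, hU, hUx⟩ := exists_U _ eigs b hb hLb (Finset.Iic k)
  rw [Fin.card_Iic] at hU
  obtain ⟨x, h1, h2, hpos⟩ := exists_inter U W (by omega)
  obtain ⟨c', e1, e2⟩ := hUx x h1
  have h3 := hx x h2
  rw [← qf_eq, e2] at h3
  have h4 : ∑ i : Finset.Iic k, eigs i * c' i ^ 2 ≤ eigs k * ∑ i, x i ^ 2 := by
    rw [e1, Finset.mul_sum]
    refine Finset.sum_le_sum fun i _ => ?_
    exact mul_le_mul_of_nonneg_right (heigs (Finset.mem_Iic.1 i.2)) (sq_nonneg _)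
  exact le_of_mul_le_mul_right (h3.trans h4) hpos

open Matrix in
/-- Rayleigh upper bound. -/
theorem eig_le (G : SimpleGraph (Fin n)) [DecidableRel G.Adj]
    (eigs : Fin n → ℝ) (heigs : Monotone eigs)
    (hroots : (G.lapMatrix ℝ).charpoly.roots = (univ : Finset (Fin n)).val.map eigs)
    (k : Fin n) (c : ℝ) (W : Submodule ℝ (Fin n → ℝ)) (hW : k + 1 ≤ Module.finrank ℝ W)
    (hx : ∀ x ∈ W, qf G x ≤ c * ∑ i, x i ^ 2) : eigs k ≤ c := by
  obtain ⟨b, hb, hLb⟩ := exists_eigenbasis _ (G.isHermitian_lapMatrix ℝ) eigs hroots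
  obtain ⟨U, hU, hUx⟩ := exists_U _ eigs b hb hLb (Finset.Ici k)
  rw [Fin.card_Ici] at hU
  obtain ⟨x, h1, h2, hpos⟩ := exists_inter U W (by omega)
  obtain ⟨c', e1, e2⟩ := hUx x h1
  have h3 := hx x h2
  rw [← qf_eq, e2] at h3
  have h4 : eigs k * ∑ i, x i ^ 2 ≤ ∑ i : Finset.Ici k, eigs i * c' i ^ 2 := by
    rw [e1, Finset.mul_sum]
    refine Finset.sum_le_sum fun i _ => ?_
    exact mul_le_mul_of_nonneg_right (heigs (Finset.mem_Ici.1 i.2)) (sq_nonneg _)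
  exact le_of_mul_le_mul_right (h4.trans h3) hpos

theorem compl_W (G : SimpleGraph (Fin n)) (hn : 0 < n) (r : ℕ) (hrn : r < n) (c : ℝ) (hc : c ≤ n)
    (h : Good Gᶜ r c) : ∃ W : Submodule ℝ (Fin n → ℝ), r + 1 ≤ Module.finrank ℝ W ∧
      ∀ x ∈ W, qf G x ≤ (n - c) * ∑ i, x i ^ 2 := by
  have hn' : (0 : ℝ) < n := by exact_mod_cast hn
  rcases le_or_gt c 0 with hc0 | hc0
  · refine ⟨⊤, by simpa using hrn, fun x _ => ?_⟩
    have h1 := qf_add_compl G x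
    have h2 := qf_nonneg Gᶜ x
    have h3 : 0 ≤ ∑ i, x i ^ 2 := Finset.sum_nonneg fun _ _ => sq_nonneg _
    nlinarith [sq_nonneg (∑ i, x i)]
  obtain ⟨W, hW, hx⟩ := h
  have h1W : (1 : Fin n → ℝ) ∉ W := by
    intro h
    have := hx 1 h
    have h2 : qf Gᶜ (1 : Fin n → ℝ) = 0 := by simp [qf]
    rw [h2] at this
    simp at this
    nlinarith [mul_pos hc0 hn']
  refine ⟨W ⊔ Submodule.span ℝ {1}, ?_, ?_⟩
  · have h1 := Submodule.finrank_sup_add_finrank_inf_eq W (Submodule.span ℝ {(1 : Fin n → ℝ)})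
    have hne : (1 : Fin n → ℝ) ≠ 0 := fun h => h1W (h ▸ W.zero_mem)
    have h3 : W ⊓ Submodule.span ℝ {(1 : Fin n → ℝ)} = ⊥ := by
      rw [Submodule.eq_bot_iff]
      rintro x ⟨hxW, hx1⟩
      obtain ⟨a, rfl⟩ := Submodule.mem_span_singleton.1 hx1
      by_contra hne
      have ha : a ≠ 0 := by rintro rfl; simp at hne
      exact h1W ((W.smul_mem_iff ha).1 hxW)
    rw [h3, finrank_bot, finrank_span_singleton hne] at h1
    omega
  · intro x hxm
    obtain ⟨w, hw, y, hy, rfl⟩ := Submodule.mem_sup.1 hxm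
    obtain ⟨a, rfl⟩ := Submodule.mem_span_singleton.1 hy
    rw [qf_shift]
    have h1 := qf_add_compl G w
    have h2 := hx w hw
    have h3 : ∑ i, (w + a • (1 : Fin n → ℝ)) i ^ 2 = ∑ i, w i ^ 2 + 2 * a * ∑ i, w i + n * a ^ 2 := by
      simp only [Pi.add_apply, Pi.smul_apply, Pi.one_apply, smul_eq_mul, mul_one, add_sq,
        Finset.sum_add_distrib, Finset.sum_const, nsmul_eq_mul, Finset.card_univ, Fintype.card_fin,
        Finset.mul_sum]
      congr 2
      refine Finset.sum_congr rfl fun i _ => by ring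
    rw [h3]
    set Z := ∑ i, w i
    set Q := ∑ i, w i ^ 2
    have h4 : qf G w ≤ n * Q - Z ^ 2 - c * Q := by linarith
    refine h4.trans ?_
    refine le_of_mul_le_mul_left ?_ hn'
    nlinarith [mul_nonneg (sub_nonneg.2 hc) (sq_nonneg (Z + n * a)), mul_nonneg hc0.le (sq_nonneg Z)]

end BH

/-- If `G ≠ K_{n-m+1} + (m-1)K_1` and `Ḡ ≠ K_{m-1} + (n-m+1)K_1`, then
`d_m(G) - n + m + 1 ≤ λ_m(G) ≤ d_{m-1}(G) + m - 2`. -/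
theorem lap_eigenvalue_two_sided_bound (n m : ℕ) (hm : 2 ≤ m) (hmn : m ≤ n)
    (G : SimpleGraph (Fin n)) [DecidableRel G.Adj]
    (eigs : Fin n → ℝ) (heigs : Monotone eigs)
    (hroots : (G.lapMatrix ℝ).charpoly.roots = Finset.univ.val.map eigs)
    (d : Fin n → ℕ) (hd : Monotone d)
    (hdeg : Finset.univ.val.map d = Finset.univ.val.map (fun v => G.degree v))
    (hnot₁ : ¬ IsCliquePlusIsolated G (n - m + 1))
    (hnot₂ : ¬ IsCliquePlusIsolated Gᶜ (m - 1)) :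
    (d ⟨m - 1, by omega⟩ : ℝ) - n + m + 1 ≤ eigs ⟨m - 1, by omega⟩ ∧
      eigs ⟨m - 1, by omega⟩ ≤ (d ⟨m - 2, by omega⟩ : ℝ) + m - 2 := by
  classical
  obtain ⟨σ, hσ⟩ := exists_perm_of_map_eq _ _ hdeg
  have hcard : ∀ v, (univ.filter fun t => G.Adj v t).card = G.degree v := by
    intro v
    rw [← SimpleGraph.card_neighborFinset_eq_degree, SimpleGraph.neighborFinset_eq_filter]
  constructor
  · let S : Finset (Fin n) := (Finset.Ici (⟨m - 1, by omega⟩ : Fin n)).map σ.toEmbedding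
    have hS : S.card = n - m + 1 := by
      rw [Finset.card_map, Fin.card_Ici]; simp only; omega
    have h := bh_main G S (Finset.card_pos.1 (by omega)) (d ⟨m - 1, by omega⟩) (by
      intro s hs
      obtain ⟨i, hi, rfl⟩ := Finset.mem_map.1 hs
      have h1 := hd (Finset.mem_Ici.1 hi)
      rw [hσ i, ← hcard] at h1
      refine h1.trans (le_of_eq ?_)
      rw [Equiv.toEmbedding_apply]
      congr!) (by rw [hS]; exact hnot₁)
    have h2 := eig_ge G eigs heigs hroots ⟨m - 1, by omega⟩ S.card (by
      simp only; omega) _ h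
    refine le_trans (le_of_eq ?_) h2
    rw [hS]; push_cast [Nat.cast_sub hmn]; ring
  · let S : Finset (Fin n) := (Finset.Iic (⟨m - 2, by omega⟩ : Fin n)).map σ.toEmbedding
    have hS : S.card = m - 1 := by
      rw [Finset.card_map, Fin.card_Iic]; simp only; omega
    have hdn : ∀ i, d i < n := by
      intro i; rw [hσ i]; simpa using G.degree_lt_card_verts (σ i)
    have h := bh_main Gᶜ S (Finset.card_pos.1 (by omega)) (n - 1 - d ⟨m - 2, by omega⟩) (by
      intro s hs
      obtain ⟨i, hi, rfl⟩ := Finset.mem_map.1 hs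
      have h1 := hd (Finset.mem_Iic.1 hi)
      have h2 := SimpleGraph.degree_compl (G := G) (v := σ i)
      rw [← SimpleGraph.card_neighborFinset_eq_degree, SimpleGraph.neighborFinset_eq_filter,
        ← hσ i, Fintype.card_fin] at h2
      have h3 : n - 1 - d ⟨m - 2, by omega⟩ ≤ n - 1 - d i := by omega
      rw [← h2] at h3
      refine h3.trans (le_of_eq ?_)
      rw [Equiv.toEmbedding_apply]
      congr!) (by rw [hS]; exact hnot₂)
    have hdk := hdn ⟨m - 2, by omega⟩
    have e1 : (((n - 1 - d ⟨m - 2, by omega⟩ : ℕ) : ℝ)) - (S.card : ℝ) + 2 =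
        n - (d ⟨m - 2, by omega⟩ + m - 2) := by
      rw [hS, Nat.cast_sub (by omega), Nat.cast_sub (by omega), Nat.cast_sub (by omega)]
      push_cast; ring
    rw [e1] at h
    have hm' : (2 : ℝ) ≤ m := by exact_mod_cast hm
    have hd0 : (0 : ℝ) ≤ d ⟨m - 2, by omega⟩ := Nat.cast_nonneg _
    obtain ⟨W, hW, hx⟩ := compl_W G (by omega) S.card (by omega) _ (by linarith) h
    refine eig_le G eigs heigs hroots _ _ W (by rw [hS] at hW; simp only; omega) ?_
    intro x hxm
    refine (hx x hxm).trans (le_of_eq ?_)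
    ring
end

section
/- Let G be a finite simple graph on n vertices and let 2 ≤ m ≤ n. Suppose G is not the disjoint union K_{n−m+1} + (m−1)K_1, the complement Ḡ is not the disjoint union K_{m−1} + (n−m+1)K_1, and the degrees satisfy d_m(G) = d_{m−1}(G) + n − 3. Then λ_m(G) = d_m(G) − n + m + 1 = d_{m−1}(G) + m − 2, where λ_m(G) is the m-th smallest Laplacian eigenvalue of G and d_i(G) is the i-th smallest vertex degree of G. -/
open Matrix Finset in
theorem aux_perm {n : ℕ} {α : Type*} [DecidableEq α] (f g : Fin n → α)
    (h : Finset.univ.val.map f = Finset.univ.val.map g) :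
    ∃ σ : Fin n ≃ Fin n, ∀ i, f i = g (σ i) := by
  have key : ∀ c, Nonempty ({a // f a = c} ≃ {b // g b = c}) := by
    intro c
    rw [← Fintype.card_eq]
    have := congrArg (Multiset.count c) h
    rw [Multiset.count_map, Multiset.count_map] at this
    rw [Fintype.card_subtype, Fintype.card_subtype]
    simpa [Finset.card, eq_comm] using this
  refine ⟨Equiv.ofFiberEquiv (fun c => (key c).some), fun i => ?_⟩
  exact (Equiv.ofFiberEquiv_map (fun c => (key c).some) i).symm

open Matrix in
theorem aux_basis {n : ℕ} (L : Matrix (Fin n) (Fin n) ℝ) (hL : L.IsHermitian)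
    (eigs : Fin n → ℝ) (hroots : L.charpoly.roots = Finset.univ.val.map eigs) :
    ∃ b : Fin n → (Fin n → ℝ), (∀ i, L *ᵥ b i = eigs i • b i) ∧
      (∀ i j, b i ⬝ᵥ b j = if i = j then 1 else 0) ∧
      (∀ x : Fin n → ℝ, x = ∑ i, (b i ⬝ᵥ x) • b i) := by
  rw [hL.roots_charpoly_eq_eigenvalues] at hroots
  obtain ⟨σ, hσ⟩ := aux_perm _ _ hroots.symm
  refine ⟨fun i => (hL.eigenvectorBasis (σ i)).ofLp, fun i => ?_, fun i j => ?_, fun x => ?_⟩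
  · rw [hL.mulVec_eigenvectorBasis, hσ]
    rfl
  · have h := orthonormal_iff_ite.mp hL.eigenvectorBasis.orthonormal (σ j) (σ i)
    simp only [EuclideanSpace.inner_eq_star_dotProduct] at h
    simpa [eq_comm] using h
  · have h := hL.eigenvectorBasis.sum_repr' (WithLp.toLp 2 x)
    rw [← Equiv.sum_comp σ] at h
    have h2 := congrArg WithLp.ofLp h
    simp only [EuclideanSpace.inner_eq_star_dotProduct] at h2
    simp only [WithLp.ofLp_sum, WithLp.ofLp_smul, star_trivial] at h2
    refine h2.symm.trans (Finset.sum_congr rfl fun i _ => ?_)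
    rw [dotProduct_comm]

open Matrix in
theorem aux_orth {n : ℕ} (L : Matrix (Fin n) (Fin n) ℝ) (hL : L.IsHermitian)
    (x y : Fin n → ℝ) (a c : ℝ) (hx : L *ᵥ x = a • x) (hy : L *ᵥ y = c • y) (hne : a ≠ c) :
    x ⬝ᵥ y = 0 := by
  have h1 : x ⬝ᵥ (L *ᵥ y) = (L *ᵥ x) ⬝ᵥ y := by
    rw [dotProduct_mulVec, ← mulVec_transpose]
    have : Lᵀ = L := by simpa [IsHermitian, conjTranspose_eq_transpose_of_trivial] using hL
    rw [this]
  rw [hx, hy, dotProduct_smul, smul_dotProduct, smul_eq_mul, smul_eq_mul] at h1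
  have : (a - c) * (x ⬝ᵥ y) = 0 := by linarith
  rcases mul_eq_zero.mp this with h | h
  · exact absurd (sub_eq_zero.mp h) hne
  · exact h

open Matrix in
theorem aux_exists {n : ℕ} (L : Matrix (Fin n) (Fin n) ℝ) (hL : L.IsHermitian)
    (eigs : Fin n → ℝ) (b : Fin n → (Fin n → ℝ)) (hb : ∀ i, L *ᵥ b i = eigs i • b i)
    (hs : ∀ x : Fin n → ℝ, x = ∑ i, (b i ⬝ᵥ x) • b i)
    (x : Fin n → ℝ) (a : ℝ) (hx : L *ᵥ x = a • x) (h0 : x ≠ 0) : ∃ i, eigs i = a := by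
  by_contra! hne
  apply h0
  rw [hs x]
  apply Finset.sum_eq_zero
  intro i _
  rw [aux_orth L hL (b i) x _ _ (hb i) hx (hne i), zero_smul]

theorem aux_adj_le {n : ℕ} (G : SimpleGraph (Fin n)) [DecidableRel G.Adj] (v : Fin n)
    (T : Finset (Fin n)) (h : ∀ x ∈ T, G.Adj v x) : T.card ≤ G.degree v := by
  rw [← G.card_neighborFinset_eq_degree]
  apply Finset.card_le_card
  intro x hx
  simpa using h x hx

theorem aux_nadj_le {n : ℕ} (G : SimpleGraph (Fin n)) [DecidableRel G.Adj] (v : Fin n)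
    (T : Finset (Fin n)) (h : ∀ x ∈ T, ¬ G.Adj v x) : T.card + G.degree v ≤ n := by
  rw [← G.card_neighborFinset_eq_degree, ← Finset.card_union_of_disjoint]
  · exact (Finset.card_le_univ _).trans (by simp)
  · rw [Finset.disjoint_left]
    intro x hx
    simpa using h x hx

/-- all eigenvalues are at most `n` -/
theorem aux_le_n {n : ℕ} (G : SimpleGraph (Fin n)) [DecidableRel G.Adj] (x : Fin n → ℝ) (a : ℝ)
    (hx : (G.lapMatrix ℝ).mulVec x = a • x) (h0 : x ≠ 0) : a ≤ n := by
  by_contra! hlt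
  have hc : (Gᶜ.lapMatrix ℝ).mulVec x = fun v => n * x v - ∑ u, x u - a * x v := by
    ext v
    have h1 := congrFun hx v
    rw [SimpleGraph.lapMatrix_mulVec_apply] at h1 ⊢
    have h2 : ∑ u, x u = x v + ∑ u ∈ G.neighborFinset v, x u + ∑ u ∈ Gᶜ.neighborFinset v, x u := by
      rw [add_assoc, ← Finset.sum_union]
      · rw [← Finset.sum_insert]
        · apply Finset.sum_congr _ (fun _ _ => rfl)
          ext u
          simp
          by_cases h : u = v
          · simp [h]
          · simp only [h, false_or, Ne.symm h, not_false_eq_true, true_and]; tauto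
        · simp
      · rw [Finset.disjoint_left]
        intro u
        simp
        tauto
    have h3 : (Gᶜ.degree v : ℝ) = n - 1 - G.degree v := by
      have := G.degree_lt_card_verts v
      simp only [Fintype.card_fin] at this
      have h4 := G.degree_compl v
      simp only [Fintype.card_fin] at h4
      have h5 : Gᶜ.degree v + 1 + G.degree v = n := by omega
      have : (Gᶜ.degree v : ℝ) + 1 + G.degree v = n := by exact_mod_cast h5
      linarith
    simp only [Pi.smul_apply, smul_eq_mul] at h1
    rw [h3, h2]
    linarith
  have hpos := (SimpleGraph.posSemidef_lapMatrix ℝ Gᶜ).dotProduct_mulVec_nonneg x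
  rw [hc] at hpos
  simp only [dotProduct, star_trivial, mul_sub, Finset.sum_sub_distrib, ← Finset.sum_mul] at hpos
  have h6 : ∑ i, x i * (n * x i) = n * ∑ i, x i ^ 2 := by
    rw [Finset.mul_sum]; exact Finset.sum_congr rfl (fun _ _ => by ring)
  have h7 : ∑ i, x i * (a * x i) = a * ∑ i, x i ^ 2 := by
    rw [Finset.mul_sum]; exact Finset.sum_congr rfl (fun _ _ => by ring)
  rw [h6, h7] at hpos
  have h8 : 0 < ∑ i, x i ^ 2 := by
    obtain ⟨i, hi⟩ := Function.ne_iff.mp h0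
    refine Finset.sum_pos' (fun _ _ => sq_nonneg _) ⟨i, Finset.mem_univ _, ?_⟩
    have : x i ≠ 0 := hi
    positivity
  nlinarith [mul_pos (sub_pos.mpr hlt) h8, mul_self_nonneg (∑ i, x i)]
open Matrix in
/-- sum of an eigenvector for a nonzero eigenvalue vanishes -/
theorem aux_sum_zero {n : ℕ} (G : SimpleGraph (Fin n)) [DecidableRel G.Adj] (x : Fin n → ℝ) (a : ℝ)
    (hx : (G.lapMatrix ℝ) *ᵥ x = a • x) (h0 : a ≠ 0) : ∑ i, x i = 0 := by
  have h := aux_orth (G.lapMatrix ℝ) (G.isHermitian_lapMatrix ℝ) (fun _ => 1) x 0 a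
    (by rw [G.lapMatrix_mulVec_const_eq_zero, zero_smul]) hx (Ne.symm h0)
  simpa [dotProduct] using h

theorem aux_A {n : ℕ} (G : SimpleGraph (Fin n)) [DecidableRel G.Adj] (hn : 2 ≤ n) (h : Fin n)
    (hh : ∀ v, v ≠ h → G.Adj h v) :
    ∃ x : Fin n → ℝ, x ≠ 0 ∧ (G.lapMatrix ℝ).mulVec x = (n : ℝ) • x := by
  have hn' : (2 : ℝ) ≤ n := by exact_mod_cast hn
  refine ⟨fun v => if v = h then (n : ℝ) - 1 else -1, ?_, ?_⟩
  · intro h0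
    have := congrFun h0 h
    simp at this
    linarith
  · have hs : ∀ S : Finset (Fin n), ∑ u ∈ S, (if u = h then (n : ℝ) - 1 else -1)
        = (if h ∈ S then (n : ℝ) else 0) - S.card := by
      intro S
      have : ∀ u, (if u = h then (n : ℝ) - 1 else -1) = (if u = h then (n : ℝ) else 0) - 1 := by
        intro u; split_ifs <;> ring
      simp [this]
    ext v
    rw [SimpleGraph.lapMatrix_mulVec_apply, hs]
    by_cases hv : v = h
    · subst hv
      have hd : G.degree v = n - 1 := by
        rw [← G.card_neighborFinset_eq_degree]
        have : G.neighborFinset v = Finset.univ.erase v := by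
          ext u; simp; exact ⟨fun h => h.ne', hh u⟩
        rw [this]; simp
      have hd' : (G.degree v : ℝ) = n - 1 := by
        rw [hd]; push_cast [Nat.cast_sub (show 1 ≤ n by omega)]; ring
      simp [hd']
      ring
    · have : G.Adj v h := (hh v hv).symm
      simp [hv, this]
      ring

open Matrix in
theorem aux_B {n : ℕ} (G : SimpleGraph (Fin n)) [DecidableRel G.Adj] (hn : 3 ≤ n) (h w : Fin n)
    (hwh : w ≠ h)
    (hh : ∀ x y, G.Adj x y ↔ (x = h ∧ y ≠ h ∧ y ≠ w) ∨ (y = h ∧ x ≠ h ∧ x ≠ w)) :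
    (∃ x : Fin n → ℝ, x ≠ 0 ∧ (G.lapMatrix ℝ) *ᵥ x = ((n : ℝ) - 1) • x) ∧
    ∀ (x : Fin n → ℝ) (a : ℝ), x ≠ 0 → (G.lapMatrix ℝ) *ᵥ x = a • x → a ≤ (n : ℝ) - 1 := by
  have hn' : (3 : ℝ) ≤ n := by exact_mod_cast hn
  have Nh : G.neighborFinset h = (Finset.univ.erase h).erase w := by
    ext u; simp [hh]; tauto
  have Nw : G.neighborFinset w = ∅ := by
    ext u; simp [hh, hwh]
  have Nl : ∀ v, v ≠ h → v ≠ w → G.neighborFinset v = {h} := by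
    intro v h1 h2; ext u; simp [hh, h1, h2]
  have dh : (G.degree h : ℝ) = n - 2 := by
    rw [← G.card_neighborFinset_eq_degree, Nh, Finset.card_erase_of_mem (by simp [hwh])]
    simp
    rw [show n - 1 - 1 = n - 2 by omega]
    push_cast [Nat.cast_sub (show 2 ≤ n by omega)]; ring
  have sumh : ∀ x : Fin n → ℝ, ∑ u ∈ (Finset.univ.erase h).erase w, x u = ∑ u, x u - x h - x w := by
    intro x
    rw [Finset.sum_erase_eq_sub (by simp [hwh]), Finset.sum_erase_eq_sub (by simp)]
  have dl : ∀ v, v ≠ h → v ≠ w → G.degree v = 1 := by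
    intro v h1 h2
    rw [← G.card_neighborFinset_eq_degree, Nl v h1 h2]; simp
  constructor
  · refine ⟨fun v => if v = h then (n : ℝ) - 2 else if v = w then 0 else -1, ?_, ?_⟩
    · intro h0
      have := congrFun h0 h
      simp at this
      linarith
    · ext v
      rw [SimpleGraph.lapMatrix_mulVec_apply]
      by_cases hv : v = h
      · subst hv
        rw [Nh, dh]
        have : ∑ u ∈ (Finset.univ.erase v).erase w, (if u = v then (n : ℝ) - 2 else if u = w then 0 else -1)
           = ∑ u ∈ (Finset.univ.erase v).erase w, (-1 : ℝ) := by
          apply Finset.sum_congr rfl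
          intro u hu
          simp at hu
          simp [hu]
        rw [this, sumh]
        simp
        ring
      · by_cases hw : v = w
        · subst hw
          rw [Nw]; simp [hv]
        · rw [Nl v hv hw, dl v hv hw]; simp [hv, hw]; ring
  · intro x a hx0 hx
    by_contra! hlt
    have hs := aux_sum_zero G x a hx (by linarith)
    have e : ∀ v, (G.degree v : ℝ) * x v - ∑ u ∈ G.neighborFinset v, x u = a * x v := by
      intro v
      rw [← SimpleGraph.lapMatrix_mulVec_apply, hx]; rfl
    have ew : x w = 0 := by
      have h1 := e w
      have : G.degree w = 0 := by rw [← G.card_neighborFinset_eq_degree, Nw]; simp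
      rw [Nw, this] at h1
      simp at h1
      exact h1.resolve_left (by linarith)
    have eh : x h = 0 := by
      have h1 := e h
      rw [Nh, dh, sumh, hs, ew] at h1
      have : (a - (n - 1)) * x h = 0 := by linarith
      exact (mul_eq_zero.mp this).resolve_left (by linarith)
    apply hx0
    ext v
    by_cases hv : v = h
    · rw [hv, eh]; rfl
    by_cases hw : v = w
    · rw [hw, ew]; rfl
    have h1 := e v
    rw [Nl v hv hw, dl v hv hw] at h1
    simp [eh] at h1
    have : (a - 1) * x v = 0 := by linarith
    exact (mul_eq_zero.mp this).resolve_left (by linarith)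

open Matrix in
theorem aux_C {n : ℕ} (G : SimpleGraph (Fin n)) [DecidableRel G.Adj] (hn : 3 ≤ n) (v u : Fin n)
    (huv : u ≠ v)
    (hh : ∀ x y, G.Adj x y ↔ x ≠ y ∧ (x = v → y = u) ∧ (y = v → x = u)) :
    (∃ x : Fin n → ℝ, x ≠ 0 ∧ (G.lapMatrix ℝ) *ᵥ x = (1 : ℝ) • x) ∧
    ∀ (x : Fin n → ℝ) (a : ℝ), (G.lapMatrix ℝ) *ᵥ x = a • x → a < 1 → ∀ w, x w = x u := by
  have hn' : (3 : ℝ) ≤ n := by exact_mod_cast hn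
  have Nv : G.neighborFinset v = {u} := by
    ext y; simp [hh]; grind
  have Nu : G.neighborFinset u = Finset.univ.erase u := by
    ext y; simp [hh]; grind
  have Nw : ∀ w, w ≠ u → w ≠ v → G.neighborFinset w = (Finset.univ.erase w).erase v := by
    intro w h1 h2
    ext y; simp [hh]; grind
  have dv : G.degree v = 1 := by
    rw [← G.card_neighborFinset_eq_degree, Nv]; simp
  have du : (G.degree u : ℝ) = n - 1 := by
    rw [← G.card_neighborFinset_eq_degree, Nu]
    simp
    push_cast [Nat.cast_sub (show 1 ≤ n by omega)]; ring
  have dw : ∀ w, w ≠ u → w ≠ v → (G.degree w : ℝ) = n - 2 := by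
    intro w h1 h2
    rw [← G.card_neighborFinset_eq_degree, Nw w h1 h2, Finset.card_erase_of_mem (by simp [h2.symm])]
    simp
    rw [show n - 1 - 1 = n - 2 by omega]
    push_cast [Nat.cast_sub (show 2 ≤ n by omega)]; ring
  have su : ∀ x : Fin n → ℝ, ∑ y ∈ Finset.univ.erase u, x y = ∑ y, x y - x u := by
    intro x
    rw [Finset.sum_erase_eq_sub (by simp)]
  have sw : ∀ w, w ≠ v → ∀ x : Fin n → ℝ,
      ∑ y ∈ (Finset.univ.erase w).erase v, x y = ∑ y, x y - x w - x v := by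
    intro w h1 x
    rw [Finset.sum_erase_eq_sub (by simp [h1.symm]), Finset.sum_erase_eq_sub (by simp)]
  constructor
  · have hfs : ∑ y : Fin n, (if y = v then (n : ℝ) - 2 else if y = u then 0 else -1) = 0 := by
      have : ∀ y : Fin n, (if y = v then (n : ℝ) - 2 else if y = u then 0 else -1)
          = (if y = v then (n : ℝ) - 1 else 0) + (if y = u then 1 else 0) - 1 := by
        intro y
        by_cases h1 : y = v
        · have : y ≠ u := by rw [h1]; exact huv.symm
          simp only [h1, huv.symm, if_true, if_false]; ring
        · by_cases h2 : y = u
          · simp [h2, huv]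
          · simp [h1, h2]
      simp only [this, Finset.sum_sub_distrib, Finset.sum_add_distrib]
      simp
    refine ⟨fun y => if y = v then (n : ℝ) - 2 else if y = u then 0 else -1, ?_, ?_⟩
    · intro h0
      have := congrFun h0 v
      simp at this
      linarith
    · ext y
      rw [SimpleGraph.lapMatrix_mulVec_apply]
      by_cases h1 : y = v
      · subst h1
        rw [Nv, dv]; simp [huv]
      · by_cases h2 : y = u
        · subst h2
          rw [Nu, du, su, hfs]; simp [h1]
        · rw [Nw y h2 h1, dw y h2 h1, sw y h1, hfs]; simp [h1, h2]; ring
  · intro x a hx hlt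
    have e : ∀ v, (G.degree v : ℝ) * x v - ∑ u ∈ G.neighborFinset v, x u = a * x v := by
      intro v
      rw [← SimpleGraph.lapMatrix_mulVec_apply, hx]; rfl
    have ev := e v
    have eu := e u
    have ew : ∀ w, w ≠ u → w ≠ v → (n - 2) * x w - (∑ y, x y - x w - x v) = a * x w := by
      intro w h1 h2
      rw [← e w, Nw w h1 h2, dw w h1 h2, sw w h2]
    rw [Nv, dv] at ev
    rw [Nu, du, su] at eu
    simp at ev
    by_cases ha : a = 0
    · subst ha
      intro w
      by_cases h1 : w = u
      · rw [h1]
      by_cases h2 : w = v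
      · rw [h2]; linarith
      have := ew w h1 h2
      have h3 : ((n : ℝ) - 1) * (x w - x u) = 0 := by linarith
      have := (mul_eq_zero.mp h3).resolve_left (by linarith)
      linarith
    · have hs := aux_sum_zero G x a hx ha
      rw [hs] at eu ew
      have xu : x u = 0 := by
        have h3 : ((n : ℝ) - a) * x u = 0 := by linarith
        exact (mul_eq_zero.mp h3).resolve_left (by linarith)
      have xv : x v = 0 := by
        have h3 : (1 - a) * x v = 0 := by linarith
        exact (mul_eq_zero.mp h3).resolve_left (by linarith)
      intro w
      by_cases h1 : w = u
      · rw [h1]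
      by_cases h2 : w = v
      · rw [h2]; linarith
      have := ew w h1 h2
      have h3 : ((n : ℝ) - 1 - a) * x w = 0 := by linarith
      rw [xu]
      exact (mul_eq_zero.mp h3).resolve_left (by linarith)

theorem aux_four : ∀ p q r s : Fin 4, p ≠ q → p ≠ r → p ≠ s → q ≠ r → q ≠ s → r ≠ s →
    ∀ y, y = p ∨ y = q ∨ y = r ∨ y = s := by
  decide

open Matrix in
theorem aux_D (G : SimpleGraph (Fin 4)) [DecidableRel G.Adj] (p q r s : Fin 4)
    (hne : p ≠ q ∧ p ≠ r ∧ p ≠ s ∧ q ≠ r ∧ q ≠ s ∧ r ≠ s)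
    (hpq : G.Adj p q) (hqr : G.Adj q r) (hrs : G.Adj r s)
    (hpr : ¬ G.Adj p r) (hps : ¬ G.Adj p s) (hqs : ¬ G.Adj q s)
    (x : Fin 4 → ℝ) (a : ℝ) (hx : (G.lapMatrix ℝ) *ᵥ x = a • x) :
    x q = (1 - a) * x p ∧ x r = ((2 - a) * (1 - a) - 1) * x p ∧
      x s = ((2 - a) * ((2 - a) * (1 - a) - 1) - (1 - a)) * x p ∧
      a * (a - 2) * (a ^ 2 - 4 * a + 2) * x p = 0 := by
  obtain ⟨h1, h2, h3, h4, h5, h6⟩ := hne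
  have hall : ∀ y, y = p ∨ y = q ∨ y = r ∨ y = s := by
    exact aux_four p q r s h1 h2 h3 h4 h5 h6
  have Np : G.neighborFinset p = {q} := by
    ext y; simp; rcases hall y with rfl | rfl | rfl | rfl <;> grind [SimpleGraph.adj_comm, SimpleGraph.irrefl]
  have Nq : G.neighborFinset q = {p, r} := by
    ext y; simp; rcases hall y with rfl | rfl | rfl | rfl <;> grind [SimpleGraph.adj_comm, SimpleGraph.irrefl]
  have Nr : G.neighborFinset r = {q, s} := by
    ext y; simp; rcases hall y with rfl | rfl | rfl | rfl <;> grind [SimpleGraph.adj_comm, SimpleGraph.irrefl]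
  have Ns : G.neighborFinset s = {r} := by
    ext y; simp; rcases hall y with rfl | rfl | rfl | rfl <;> grind [SimpleGraph.adj_comm, SimpleGraph.irrefl]
  have e : ∀ v, ((G.neighborFinset v).card : ℝ) * x v - ∑ u ∈ G.neighborFinset v, x u = a * x v := by
    intro v
    rw [G.card_neighborFinset_eq_degree, ← SimpleGraph.lapMatrix_mulVec_apply, hx]; rfl
  have ep := e p
  have eq := e q
  have er := e r
  have es := e s
  rw [Np] at ep
  rw [Nq, Finset.card_pair h2, Finset.sum_pair h2] at eq
  rw [Nr, Finset.card_pair h5, Finset.sum_pair h5] at er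
  rw [Ns] at es
  simp at ep eq er es
  have k1 : x q = (1 - a) * x p := by linarith
  have k2 : x r = ((2 - a) * (1 - a) - 1) * x p := by rw [k1] at eq; linarith
  have k3 : x s = ((2 - a) * ((2 - a) * (1 - a) - 1) - (1 - a)) * x p := by
    rw [k1, k2] at er; linarith
  refine ⟨k1, k2, k3, ?_⟩
  rw [k2, k3] at es
  linarith
open Matrix in
/-- final spectral step for the path on four vertices -/
theorem aux_D2 (G : SimpleGraph (Fin 4)) [DecidableRel G.Adj] (p q r s : Fin 4)
    (hne : p ≠ q ∧ p ≠ r ∧ p ≠ s ∧ q ≠ r ∧ q ≠ s ∧ r ≠ s)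
    (hpq : G.Adj p q) (hqr : G.Adj q r) (hrs : G.Adj r s)
    (hpr : ¬ G.Adj p r) (hps : ¬ G.Adj p s) (hqs : ¬ G.Adj q s)
    (eigs : Fin 4 → ℝ) (heigs : Monotone eigs) (b : Fin 4 → (Fin 4 → ℝ))
    (hb : ∀ i, (G.lapMatrix ℝ) *ᵥ b i = eigs i • b i)
    (ho : ∀ i j, b i ⬝ᵥ b j = if i = j then 1 else 0) : eigs 2 = 2 := by
  have hall := aux_four p q r s hne.1 hne.2.1 hne.2.2.1 hne.2.2.2.1 hne.2.2.2.2.1 hne.2.2.2.2.2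
  have key := fun i => aux_D G p q r s hne hpq hqr hrs hpr hps hqs (b i) (eigs i) (hb i)
  have hp : ∀ i, b i p ≠ 0 := by
    intro i h0
    obtain ⟨k1, k2, k3, -⟩ := key i
    rw [h0, mul_zero] at k1 k2 k3
    have : b i = 0 := by
      ext y; rcases hall y with rfl | rfl | rfl | rfl <;> simpa
    have h := ho i i
    simp [this] at h
  have hinj : ∀ i j, i ≠ j → eigs i ≠ eigs j := by
    intro i j hij he
    obtain ⟨k1, k2, k3, -⟩ := key i
    obtain ⟨l1, l2, l3, -⟩ := key j
    rw [← he] at l1 l2 l3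
    have : (b j p) • b i = (b i p) • b j := by
      ext y
      rcases hall y with rfl | rfl | rfl | rfl <;> simp only [Pi.smul_apply, smul_eq_mul]
      · ring
      · rw [k1, l1]; ring
      · rw [k2, l2]; ring
      · rw [k3, l3]; ring
    have h := congrArg (fun z => z ⬝ᵥ b j) this
    simp only [smul_dotProduct, ho] at h
    simp [hij] at h
    exact hp i h.symm
  have hroot : ∀ i, eigs i = 0 ∨ eigs i = 2 - √2 ∨ eigs i = 2 ∨ eigs i = 2 + √2 := by
    intro i
    have h := (mul_eq_zero.mp (key i).2.2.2).resolve_right (hp i)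
    have h2 : √2 * √2 = 2 := Real.mul_self_sqrt (by norm_num)
    have : eigs i * ((eigs i - 2) * ((eigs i - (2 - √2)) * (eigs i - (2 + √2)))) = 0 := by
      rw [← h]; linear_combination (eigs i * (eigs i - 2)) * (- h2)
    rcases mul_eq_zero.mp this with h | h
    · left; exact h
    rcases mul_eq_zero.mp h with h | h
    · right; right; left; linarith
    rcases mul_eq_zero.mp h with h | h
    · right; left; linarith
    · right; right; right; linarith
  have s1 : (1 : ℝ) < √2 := by rw [Real.lt_sqrt] <;> norm_num
  have s2 : √2 < (2 : ℝ) := by rw [Real.sqrt_lt] <;> norm_num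
  have l01 : eigs 0 < eigs 1 := lt_of_le_of_ne (heigs (by decide)) (hinj 0 1 (by decide))
  have l12 : eigs 1 < eigs 2 := lt_of_le_of_ne (heigs (by decide)) (hinj 1 2 (by decide))
  have l23 : eigs 2 < eigs 3 := lt_of_le_of_ne (heigs (by decide)) (hinj 2 3 (by decide))
  rcases hroot 2 with h | h | h | h
  · rcases hroot 1 with h' | h' | h' | h' <;> rcases hroot 0 with h'' | h'' | h'' | h'' <;> linarith
  · rcases hroot 1 with h' | h' | h' | h' <;> rcases hroot 0 with h'' | h'' | h'' | h'' <;> linarith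
  · exact h
  · rcases hroot 3 with h' | h' | h' | h' <;> linarith

set_option maxHeartbeats 1000000 in
open Matrix in
theorem aux_main (n m : ℕ) (hmn : m ≤ n) (hm : 2 ≤ m)
    (G : SimpleGraph (Fin n)) [DecidableRel G.Adj]
    (eigs : Fin n → ℝ) (heigs : Monotone eigs) (b : Fin n → (Fin n → ℝ))
    (hb : ∀ i, (G.lapMatrix ℝ) *ᵥ b i = eigs i • b i)
    (ho : ∀ i j, b i ⬝ᵥ b j = if i = j then 1 else 0)
    (hs : ∀ x : Fin n → ℝ, x = ∑ i, (b i ⬝ᵥ x) • b i)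
    (σ : Fin n ≃ Fin n) (a D : ℕ)
    (hlow : ∀ i : Fin n, (i : ℕ) + 1 < m → G.degree (σ i) ≤ a)
    (hhigh : ∀ i : Fin n, m ≤ (i : ℕ) + 1 → D ≤ G.degree (σ i))
    (hlowa : G.degree (σ ⟨m - 2, by omega⟩) = a)
    (hhighD : G.degree (σ ⟨m - 1, by omega⟩) = D)
    (hnot₁ : ¬ IsCliquePlusIsolated G (n - m + 1))
    (hnot₂ : ¬ IsCliquePlusIsolated Gᶜ (m - 1))
    (haD : a ≤ D) (hdd : D + 3 = a + n) :
    eigs ⟨m - 1, by omega⟩ = (a : ℝ) + m - 2 := by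
  have hL := G.isHermitian_lapMatrix ℝ
  have hbne : ∀ i, b i ≠ 0 := by
    intro i h
    have := ho i i
    simp [h] at this
  have hnn : ∀ i, 0 ≤ eigs i := by
    intro i
    have := (SimpleGraph.posSemidef_lapMatrix ℝ G).dotProduct_mulVec_nonneg (b i)
    rw [hb, dotProduct_smul, star_trivial, ho] at this
    simpa using this
  have hDn : D < n := by
    rw [← hhighD]
    simpa using G.degree_lt_card_verts (σ ⟨m - 1, by omega⟩)
  -- the high and low vertex sets
  let H : Finset (Fin n) := (Finset.univ.filter (fun i : Fin n => m ≤ (i : ℕ) + 1)).map σ.toEmbedding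
  let W : Finset (Fin n) := (Finset.univ.filter (fun i : Fin n => (i : ℕ) + 1 < m)).map σ.toEmbedding
  have hWcard : W.card = m - 1 := by
    rw [Finset.card_map]
    have : (Finset.univ.filter (fun i : Fin n => (i : ℕ) + 1 < m)) = Finset.Iio ⟨m - 1, by omega⟩ := by
      ext i; simp [Fin.lt_def]; omega
    rw [this, Fin.card_Iio]
  have hHW : ∀ v, v ∈ H ↔ v ∉ W := by
    intro v
    simp only [H, W, Finset.mem_map, Finset.mem_filter, Finset.mem_univ, true_and,
      Equiv.coe_toEmbedding, not_exists, not_and]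
    constructor
    · rintro ⟨i, hi, rfl⟩ j hj he
      have := σ.injective he
      subst this; omega
    · intro h
      refine ⟨σ.symm v, ?_, by simp⟩
      by_contra! hc
      exact h _ hc (by simp)
  have hHcard : H.card = n - m + 1 := by
    have : H = Wᶜ := by ext v; simp [hHW]
    rw [this, Finset.card_compl, hWcard, Fintype.card_fin]; omega
  have hWdeg : ∀ v ∈ W, G.degree v ≤ a := by
    intro v hv
    simp only [W, Finset.mem_map, Finset.mem_filter, Finset.mem_univ, true_and,
      Equiv.coe_toEmbedding] at hv
    obtain ⟨i, hi, rfl⟩ := hv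
    exact hlow i hi
  have hHdeg : ∀ v ∈ H, D ≤ G.degree v := by
    intro v hv
    simp only [H, Finset.mem_map, Finset.mem_filter, Finset.mem_univ, true_and,
      Equiv.coe_toEmbedding] at hv
    obtain ⟨i, hi, rfl⟩ := hv
    exact hhigh i hi
  have hlW : σ ⟨m - 2, by omega⟩ ∈ W := by
    simp [W]; omega
  have hhH : σ ⟨m - 1, by omega⟩ ∈ H := by
    simp [H]; omega
  generalize σ ⟨m - 2, by omega⟩ = l at *
  generalize σ ⟨m - 1, by omega⟩ = h at *
  have hacases : a = 0 ∨ a = 1 ∨ a = 2 := by omega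
  rcases hacases with rfl | rfl | rfl
  · -- a = 0
    have hiso : ∀ v ∈ W, ∀ u, ¬ G.Adj v u := by
      intro v hv u huv
      have := aux_adj_le G v {u} (by simpa using huv)
      have := hWdeg v hv
      simp at *; omega
    have hm3 : m ≤ 3 := by
      have := aux_nadj_le G h (insert h W) (by
        intro x hx
        rcases Finset.mem_insert.mp hx with rfl | hx
        · exact G.irrefl
        · exact fun hh => hiso x hx h hh.symm)
      rw [Finset.card_insert_of_notMem ((hHW h).mp hhH), hWcard] at this
      omega
    rcases (show m = 2 ∨ m = 3 by omega) with rfl | rfl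
    · -- m = 2
      by_contra hne
      have hne1 : eigs ⟨1, by omega⟩ ≠ 0 := by simpa using hne
      have hz : ∀ i : Fin n, i ≠ ⟨0, by omega⟩ → eigs i ≠ 0 := by
        intro i hi
        have h1 : eigs ⟨1, by omega⟩ ≤ eigs i := heigs (by
          rw [Fin.le_def]; simp
          have : (i : ℕ) ≠ 0 := fun h => hi (Fin.ext h)
          omega)
        have := lt_of_le_of_ne (hnn _) hne1.symm
        linarith
      have hmul : ∀ x : Fin n → ℝ, (G.lapMatrix ℝ) *ᵥ x = 0 →
          x = (b ⟨0, by omega⟩ ⬝ᵥ x) • b ⟨0, by omega⟩ := by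
        intro x hx
        conv_lhs => rw [hs x]
        apply Finset.sum_eq_single
        · intro i _ hi
          rw [aux_orth _ hL (b i) x _ 0 (hb i) (by rw [hx, zero_smul]) (hz i hi), zero_smul]
        · simp
      have hhl : h ≠ l := by rintro rfl; exact (hHW _).mp hhH hlW
      have e1 := hmul (fun _ => 1) (G.lapMatrix_mulVec_const_eq_zero)
      have e2 := hmul (Pi.single l 1) (by
        rw [G.lapMatrix_mulVec_eq_zero_iff_forall_adj]
        intro i j hij
        have hi : i ≠ l := by rintro rfl; exact hiso _ hlW _ hij
        have hj : j ≠ l := by rintro rfl; exact hiso _ hlW _ hij.symm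
        simp [hi, hj])
      generalize b ⟨0, by omega⟩ ⬝ᵥ (fun _ => 1) = c1 at *
      generalize b ⟨0, by omega⟩ ⬝ᵥ (Pi.single l 1) = c2 at *
      have f1 := congrFun e1 h
      have f2 := congrFun e2 h
      have f3 := congrFun e2 l
      simp [hhl] at f1 f2 f3
      rcases f2 with f2 | f2 <;> simp [f2] at f1 f3
    · -- m = 3
      exfalso
      apply hnot₁
      refine ⟨H, hHcard, fun u v => ⟨fun huv => ⟨huv.ne, ?_, ?_⟩, ?_⟩⟩
      · rw [hHW]; exact fun hu => hiso u hu v huv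
      · rw [hHW]; exact fun hu => hiso v hu u huv.symm
      · rintro ⟨huv, hu, hv⟩
        by_contra hc
        have := aux_nadj_le G u (insert u (insert v W)) (by
          intro x hx
          rcases Finset.mem_insert.mp hx with rfl | hx
          · exact G.irrefl
          rcases Finset.mem_insert.mp hx with rfl | hx
          · exact hc
          · exact fun hh => hiso x hx u hh.symm)
        rw [Finset.card_insert_of_notMem (by simp [huv, (hHW u).mp hu]),
          Finset.card_insert_of_notMem ((hHW v).mp hv), hWcard] at this
        have := hHdeg u hu
        omega
  · -- a = 1
    have hW1 : ∀ v ∈ W, ∀ x y, G.Adj v x → G.Adj v y → x = y := by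
      intro v hv x y hx hy
      by_contra hxy
      have := aux_adj_le G v {x, y} (by simp [hx, hy])
      rw [Finset.card_pair hxy] at this
      have := hWdeg v hv
      omega
    have hH1 : ∀ v ∈ H, ∀ x y, x ≠ v → y ≠ v → ¬ G.Adj v x → ¬ G.Adj v y → x = y := by
      intro v hv x y hxv hyv hx hy
      by_contra hxy
      have := aux_nadj_le G v {v, x, y} (by simp [hx, hy])
      rw [Finset.card_insert_of_notMem (by simp [hxv.symm, hyv.symm]), Finset.card_pair hxy] at this
      have := hHdeg v hv
      omega
    by_cases hmn' : m = n
    · subst hmn'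
      have hH' : ∀ v, v ≠ h → v ∈ W := by
        intro v hv
        by_contra hc
        have h1 : H.card = 1 := by omega
        rw [Finset.card_eq_one] at h1
        obtain ⟨z, hz⟩ := h1
        have := (hHW v).mpr hc
        rw [hz] at this hhH
        simp at this hhH
        exact hv (this.trans hhH.symm)
      obtain ⟨w, hwh, hw⟩ : ∃ w, w ≠ h ∧ ¬ G.Adj h w := by
        by_contra! hc
        have := aux_adj_le G h (Finset.univ.erase h) (by
          intro x hx; exact hc x (by simpa using hx))
        simp at this
        omega
      obtain ⟨⟨x, hx0, hx⟩, hub⟩ := aux_B G (by omega) h w hwh (by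
        intro x y
        have c1 := hH1 h hhH
        have key : ∀ x y, x ≠ h → y ≠ h → ¬ G.Adj x y := by
          intro x y hx hy hxy
          rcases Classical.em (x = w) with rfl | hxw
          · have : G.Adj h y := by
              by_contra hc
              exact hxy.ne (c1 _ _ hx hy hw hc)
            exact hx (hW1 y (hH' y hy) _ _ hxy.symm this.symm)
          · have : G.Adj h x := by
              by_contra hc
              exact hxw (c1 _ _ hx hwh hc hw)
            exact hy (hW1 x (hH' x hx) _ _ hxy this.symm)
        have k2 : ∀ y, G.Adj h y ↔ y ≠ h ∧ y ≠ w := by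
          intro y
          constructor
          · intro hy
            exact ⟨hy.ne', fun he => hw (he ▸ hy)⟩
          · rintro ⟨h1, h2⟩
            by_contra hc
            exact h2 (c1 _ _ h1 hwh hc hw)
        by_cases hxh : x = h
        · subst hxh; rw [k2]; simp
        · by_cases hyh : y = h
          · subst hyh; rw [G.adj_comm, k2]; simp
          · have := key x y hxh hyh
            simp [this, hxh, hyh])
      obtain ⟨i, hi⟩ := aux_exists _ hL eigs b hb hs x _ hx hx0
      have h1 := hub _ _ (hbne ⟨m - 1, by omega⟩) (hb _)
      have h2 : eigs i ≤ eigs ⟨m - 1, by omega⟩ := heigs (by rw [Fin.le_def]; simp; omega)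
      push_cast
      linarith
    by_cases hm2 : m = 2
    · subst hm2
      have hH' : ∀ v, v ≠ l → v ∈ H := by
        intro v hv
        rw [hHW]
        intro hc
        have h1 : W.card = 1 := by omega
        rw [Finset.card_eq_one] at h1
        obtain ⟨z, hz⟩ := h1
        rw [hz] at hc hlW
        simp at hc hlW
        exact hv (hc.trans hlW.symm)
      obtain ⟨u, hu⟩ : ∃ u, G.Adj l u := by
        have : 0 < G.degree l := by omega
        exact (G.degree_pos_iff_exists_adj l).mp this
      have kl : ∀ y, G.Adj l y ↔ y = u := fun y =>
        ⟨fun hy => hW1 l hlW _ _ hy hu, fun hy => hy ▸ hu⟩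
      obtain ⟨⟨x, hx0, hx⟩, hub⟩ := aux_C G (by omega) l u hu.ne' (by
        intro x y
        have key : ∀ x y, x ≠ l → y ≠ l → x ≠ u → x ≠ y → G.Adj x y := by
          intro x y hx hy hxu hxy
          by_contra hc
          exact hy (hH1 x (hH' x hx) y l hxy.symm hx.symm hc (fun h => hxu ((kl x).mp h.symm)))
        by_cases hxl : x = l
        · subst hxl; rw [kl]
          constructor
          · rintro rfl; exact ⟨hu.ne, fun _ => rfl, fun h => h.symm⟩
          · rintro ⟨_, h, _⟩; exact h rfl
        by_cases hyl : y = l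
        · subst hyl; rw [G.adj_comm, kl]
          constructor
          · rintro rfl; exact ⟨hu.ne', fun h => h.symm, fun _ => rfl⟩
          · rintro ⟨_, _, h⟩; exact h rfl
        simp only [hxl, hyl, false_imp_iff, and_true]
        constructor
        · intro h; exact h.ne
        · intro hxy
          by_cases hxu : x = u
          · exact (key y x hyl hxl (by rw [← hxu]; exact hxy.symm) hxy.symm).symm
          · exact key x y hxl hyl hxu hxy)
      have h01 : (⟨0, by omega⟩ : Fin n) ≠ ⟨1, by omega⟩ := by simp
      have hge : 1 ≤ eigs ⟨1, by omega⟩ := by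
        by_contra! hlt
        have hlt0 : eigs ⟨0, by omega⟩ < 1 :=
          lt_of_le_of_lt (heigs (by rw [Fin.le_def]; simp)) hlt
        have c0 := hub _ _ (hb ⟨0, by omega⟩) hlt0
        have c1 := hub _ _ (hb ⟨1, by omega⟩) hlt
        have hdot := ho ⟨0, by omega⟩ ⟨1, by omega⟩
        rw [if_neg h01] at hdot
        have hn0 : (n : ℝ) ≠ 0 := by
          have : n ≠ 0 := by omega
          exact_mod_cast this
        simp only [dotProduct, c0, c1, Finset.sum_const, Finset.card_univ, Fintype.card_fin,
          nsmul_eq_mul] at hdot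
        rcases mul_eq_zero.mp hdot with h' | h'
        · exact hn0 h'
        rcases mul_eq_zero.mp h' with h' | h'
        · apply hbne ⟨0, by omega⟩; ext w; rw [c0, h']; rfl
        · apply hbne ⟨1, by omega⟩; ext w; rw [c1, h']; rfl
      obtain ⟨i, hi⟩ := aux_exists _ hL eigs b hb hs x _ hx hx0
      obtain ⟨j, hj⟩ := aux_exists _ hL eigs b hb hs (fun _ => 1) 0
        (by rw [G.lapMatrix_mulVec_const_eq_zero, zero_smul])
        (fun hc => by simpa using congrFun hc l)
      have hi0 : (i : ℕ) ≠ 0 := by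
        intro h0
        have : eigs i ≤ eigs j := heigs (by rw [Fin.le_def]; omega)
        linarith
      have : eigs ⟨1, by omega⟩ ≤ eigs i := heigs (by rw [Fin.le_def]; simp; omega)
      have : eigs ⟨1, by omega⟩ = 1 := by linarith
      simpa using this
    -- two lows, two highs
    obtain ⟨l', hl'W, hll'⟩ : ∃ l' ∈ W, l' ≠ l :=
      Finset.exists_mem_ne (by omega) l
    obtain ⟨h', hh'H, hhh'⟩ : ∃ h' ∈ H, h' ≠ h :=
      Finset.exists_mem_ne (by omega) h
    have hdisj : ∀ x ∈ H, ∀ y ∈ W, x ≠ y := by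
      rintro x hx y hy rfl; exact (hHW x).mp hx hy
    have hor : ∀ x ∈ H, ∀ y ∈ W, ∀ z ∈ W, y ≠ z → G.Adj x y ∨ G.Adj x z := by
      intro x hx y hy z hz hyz
      by_contra! hc
      exact hyz (hH1 x hx y z (hdisj x hx y hy).symm (hdisj x hx z hz).symm hc.1 hc.2)
    have hWle : W.card ≤ 2 := by
      by_contra! hc
      obtain ⟨x, hx, y, hy, z, hz, hxy, hxz, hyz⟩ := Finset.two_lt_card.mp hc
      have a1 := hor h hhH x hx y hy hxy
      have a2 := hor h hhH x hx z hz hxz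
      have a3 := hor h hhH y hy z hz hyz
      have b1 := hor h' hh'H x hx y hy hxy
      have b2 := hor h' hh'H x hx z hz hxz
      have b3 := hor h' hh'H y hy z hz hyz
      have c : ∀ w ∈ W, ¬ (G.Adj h w ∧ G.Adj h' w) := fun w hw hc =>
        hhh' (hW1 w hw _ _ hc.2.symm hc.1.symm)
      have c1 := c x hx
      have c2 := c y hy
      have c3 := c z hz
      clear * - a1 a2 a3 b1 b2 b3 c1 c2 c3
      tauto
    have hHle : H.card ≤ 2 := by
      by_contra! hc
      obtain ⟨x, hx, y, hy, z, hz, hxy, hxz, hyz⟩ := Finset.two_lt_card.mp hc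
      have a1 := hor x hx l hlW l' hl'W hll'.symm
      have a2 := hor y hy l hlW l' hl'W hll'.symm
      have a3 := hor z hz l hlW l' hl'W hll'.symm
      have c : ∀ w ∈ W, ∀ p q, p ≠ q → ¬ (G.Adj p w ∧ G.Adj q w) := fun w hw p q hpq hc =>
        hpq (hW1 w hw _ _ hc.1.symm hc.2.symm)
      have c1 := c l hlW x y hxy
      have c2 := c l hlW x z hxz
      have c3 := c l hlW y z hyz
      have d1 := c l' hl'W x y hxy
      have d2 := c l' hl'W x z hxz
      have d3 := c l' hl'W y z hyz
      clear * - a1 a2 a3 c1 c2 c3 d1 d2 d3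
      tauto
    obtain rfl : m = 3 := by omega
    obtain rfl : n = 4 := by omega
    -- the graph is a path on four vertices
    have path : ∀ l1 ∈ W, ∀ l2 ∈ W, l1 ≠ l2 → G.Adj h l1 → eigs 2 = 2 := by
      intro l1 hl1 l2 hl2 h12 hadj
      have n1 : ¬ G.Adj h' l1 := fun hc => hhh' (hW1 l1 hl1 _ _ hc.symm hadj.symm)
      have y2 : G.Adj h' l2 := (hor h' hh'H l1 hl1 l2 hl2 h12).resolve_left n1
      have n2 : ¬ G.Adj h l2 := fun hc => hhh' (hW1 l2 hl2 _ _ y2.symm hc.symm)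
      have y3 : G.Adj h h' := by
        by_contra hc
        exact hdisj h' hh'H l2 hl2
          (hH1 h hhH h' l2 hhh' (hdisj h hhH l2 hl2).symm hc n2)
      have n3 : ¬ G.Adj l1 l2 := fun hc =>
        hdisj h hhH l2 hl2 (hW1 l1 hl1 _ _ hadj.symm hc)
      exact aux_D2 G l1 h h' l2 ⟨(hdisj h hhH l1 hl1).symm, (hdisj h' hh'H l1 hl1).symm, h12,
        hhh'.symm, hdisj h hhH l2 hl2, hdisj h' hh'H l2 hl2⟩ hadj.symm y3 y2
        (fun hc => n1 hc.symm) n3 n2 eigs heigs b hb ho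
    have : eigs 2 = 2 := by
      rcases hor h hhH l hlW l' hl'W hll'.symm with hc | hc
      · exact path l hlW l' hl'W hll'.symm hc
      · exact path l' hl'W l hlW hll' hc
    refine Eq.trans this ?_
    norm_num
  · -- a = 2
    have huniv : ∀ v ∈ H, ∀ u, u ≠ v → G.Adj v u := by
      intro v hv u huv
      by_contra hc
      have := aux_nadj_le G v {v, u} (by simp [hc])
      rw [Finset.card_pair huv.symm] at this
      have := hHdeg v hv
      omega
    have hWH : ∀ v ∈ W, ∀ u ∈ H, G.Adj v u := by
      intro v hv u hu
      exact (huniv u hu v (by rintro rfl; exact (hHW v).mp hu hv)).symm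
    have hH2 : H.card ≤ 2 := (aux_adj_le G l H (hWH l hlW)).trans (hWdeg l hlW)
    rcases (show m = n ∨ n = m + 1 by omega) with rfl | rfl
    · obtain ⟨x, hx0, hx⟩ := aux_A G (by omega) h (fun v hv => huniv h hhH v hv)
      obtain ⟨i, hi⟩ := aux_exists _ hL eigs b hb hs x _ hx hx0
      have h1 := aux_le_n G _ _ (hb ⟨m - 1, by omega⟩) (hbne _)
      have h2 : eigs i ≤ eigs ⟨m - 1, by omega⟩ := heigs (by rw [Fin.le_def]; simp; omega)
      push_cast
      linarith
    · exfalso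
      apply hnot₂
      refine ⟨W, hWcard, fun u v => ?_⟩
      rw [SimpleGraph.compl_adj]
      constructor
      · rintro ⟨huv, hadj⟩
        refine ⟨huv, ?_, ?_⟩
        · by_contra hc
          exact hadj (huniv u ((hHW u).mpr hc) v huv.symm)
        · by_contra hc
          exact hadj (huniv v ((hHW v).mpr hc) u huv).symm
      · rintro ⟨huv, hu, hv⟩
        refine ⟨huv, fun hadj => ?_⟩
        have := aux_adj_le G u (insert v H) (by
          intro x hx
          rcases Finset.mem_insert.mp hx with rfl | hx
          · exact hadj
          · exact hWH u hu x hx)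
        rw [Finset.card_insert_of_notMem (fun hc => (hHW v).mp hc hv), hHcard] at this
        have := hWdeg u hu
        omega

/-- If `G ≠ K_{n-m+1} + (m-1)K_1`, `Ḡ ≠ K_{m-1} + (n-m+1)K_1` and
`d_m(G) = d_{m-1}(G) + n - 3`, then `λ_m(G) = d_m(G) - n + m + 1 = d_{m-1}(G) + m - 2`. -/
theorem lap_eigenvalue_equality_case (n m : ℕ) (hm : 2 ≤ m) (hmn : m ≤ n)
    (G : SimpleGraph (Fin n)) [DecidableRel G.Adj]
    (eigs : Fin n → ℝ) (heigs : Monotone eigs)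
    (hroots : (G.lapMatrix ℝ).charpoly.roots = Finset.univ.val.map eigs)
    (d : Fin n → ℕ) (hd : Monotone d)
    (hdeg : Finset.univ.val.map d = Finset.univ.val.map (fun v => G.degree v))
    (hnot₁ : ¬ IsCliquePlusIsolated G (n - m + 1))
    (hnot₂ : ¬ IsCliquePlusIsolated Gᶜ (m - 1))
    (hdd : (d ⟨m - 1, by omega⟩ : ℝ) = (d ⟨m - 2, by omega⟩ : ℝ) + n - 3) :
    eigs ⟨m - 1, by omega⟩ = (d ⟨m - 1, by omega⟩ : ℝ) - n + m + 1 ∧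
      eigs ⟨m - 1, by omega⟩ = (d ⟨m - 2, by omega⟩ : ℝ) + m - 2 := by
  obtain ⟨b, hb, ho, hs⟩ := aux_basis _ (G.isHermitian_lapMatrix ℝ) eigs hroots
  obtain ⟨σ, hσ⟩ := aux_perm _ _ hdeg
  have hdd' : d ⟨m - 1, by omega⟩ + 3 = d ⟨m - 2, by omega⟩ + n := by
    have : (d ⟨m - 1, by omega⟩ : ℝ) + 3 = d ⟨m - 2, by omega⟩ + n := by linarith
    exact_mod_cast this
  have key := aux_main n m hmn hm G eigs heigs b hb ho hs σ (d ⟨m - 2, by omega⟩)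
    (d ⟨m - 1, by omega⟩)
    (fun i hi => by rw [← hσ]; exact hd (by rw [Fin.le_def]; simp; omega))
    (fun i hi => by rw [← hσ]; exact hd (by rw [Fin.le_def]; simp; omega))
    (hσ _).symm (hσ _).symm hnot₁ hnot₂
    (hd (by rw [Fin.le_def]; simp; omega)) hdd'
  constructor <;> linarith
end

section
/- Let A be a symmetric n×n real matrix with nonnegative entries and zero diagonal (a weighted graph G), with degrees d_i = Σ_j a_{ij} ordered so that d_1 ≤ d_2 ≤ … ≤ d_n, Laplacian L = D − A, and maximal edge weight a = max_{i,j} a_{ij}. For 2 ≤ m ≤ n, the m-th smallest eigenvalue of L satisfies d_m − Δ(G_{l_m}) ≤ λ_m(G) ≤ d_{m−1} + (m−1)·a − δ(G_{S_{m−1}}), where Δ(G_{l_m}) = max_{m ≤ i ≤ n} Σ_{m ≤ j ≤ n} a_{ij} and δ(G_{S_{m−1}}) = min_{1 ≤ i ≤ m−1} Σ_{1 ≤ j ≤ m−1} a_{ij}. -/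
open Finset in
/-- Dimension count: a quadratic form bounded by `B` on the kernel of `κ` linear constraints. -/
lemma wl_dim_count {n : ℕ} {κ : Type} [Fintype κ] (M U : Matrix (Fin n) (Fin n) ℝ) (μ : Fin n → ℝ)
    (hU : U * U.transpose = 1) (hM : M = U * Matrix.diagonal μ * U.transpose)
    (C : (Fin n → ℝ) →ₗ[ℝ] (κ → ℝ)) (B : ℝ)
    (hq : ∀ x, C x = 0 → x ⬝ᵥ M.mulVec x ≤ B * (x ⬝ᵥ x)) :
    n ≤ Fintype.card κ + (univ.filter (fun i => μ i ≤ B)).card := by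
  classical
  by_contra hlt
  push Not at hlt
  let E : (Fin n → ℝ) →ₗ[ℝ] ({i // μ i ≤ B} → ℝ) :=
    (LinearMap.funLeft ℝ ℝ (fun i : {i // μ i ≤ B} => i.1)).comp (Matrix.mulVecLin U.transpose)
  have hdim : Module.finrank ℝ ((κ → ℝ) × ({i // μ i ≤ B} → ℝ)) < Module.finrank ℝ (Fin n → ℝ) := by
    simp only [Module.finrank_prod, Module.finrank_fintype_fun_eq_card, Fintype.card_fin,
      Fintype.card_subtype]
    exact hlt
  have hk := LinearMap.ker_ne_bot_of_finrank_lt (f := C.prod E) hdim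
  obtain ⟨x, hx, hx0⟩ := (Submodule.ne_bot_iff _).1 hk
  rw [LinearMap.mem_ker] at hx
  have hC : C x = 0 := congrArg Prod.fst hx
  have hE : E x = 0 := congrArg Prod.snd hx
  set c := U.transpose.mulVec x with hc
  have hxc : x = U.mulVec c := by
    rw [hc, Matrix.mulVec_mulVec, hU, Matrix.one_mulVec]
  have hU' : U.transpose * U = 1 := mul_eq_one_comm.1 hU
  have hcc : x ⬝ᵥ x = c ⬝ᵥ c := by
    rw [hc, Matrix.dotProduct_mulVec, Matrix.vecMul_transpose, Matrix.mulVec_mulVec, hU,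
      Matrix.one_mulVec]
  have hMx : x ⬝ᵥ M.mulVec x = ∑ i, μ i * c i ^ 2 := by
    rw [hM, ← Matrix.mulVec_mulVec, ← Matrix.mulVec_mulVec, ← hc, Matrix.dotProduct_mulVec,
      ← Matrix.mulVec_transpose, ← hc, dotProduct]
    refine sum_congr rfl fun i _ => ?_
    rw [Matrix.mulVec_diagonal]; ring
  have h0 : ∀ i, μ i ≤ B → c i = 0 := by
    intro i hi
    have := congrFun hE ⟨i, hi⟩
    exact this
  have hne : ∃ i, c i ≠ 0 := by
    by_contra hh
    push Not at hh
    apply hx0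
    rw [hxc, show c = 0 from funext hh, Matrix.mulVec_zero]
  have h1 := hq x hC
  rw [hMx, hcc, dotProduct, mul_sum] at h1
  refine absurd h1 (not_le.2 ?_)
  obtain ⟨i, hi⟩ := hne
  refine sum_lt_sum (fun j _ => ?_) ⟨i, mem_univ _, ?_⟩
  · by_cases hj : μ j ≤ B
    · simp [h0 j hj]
    · nlinarith [sq_nonneg (c j), not_le.1 hj]
  · have hj : ¬ μ i ≤ B := fun h => hi (h0 i h)
    have : 0 < c i ^ 2 := by positivity
    nlinarith [not_le.1 hj]

/-- Spectral decomposition with the counting of eigenvalues. -/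
lemma wl_spectral {n : ℕ} (M : Matrix (Fin n) (Fin n) ℝ) (hM : M.IsSymm) (eigs : Fin n → ℝ)
    (hroots : M.charpoly.roots = Finset.univ.val.map eigs) :
    ∃ (U : Matrix (Fin n) (Fin n) ℝ) (μ : Fin n → ℝ), U * U.transpose = 1 ∧
      M = U * Matrix.diagonal μ * U.transpose ∧
      ∀ (p : ℝ → Prop) [DecidablePred p], (Finset.univ.filter (fun i => p (μ i))).card =
        (Finset.univ.filter (fun i => p (eigs i))).card := by
  have hH : M.IsHermitian := by
    rw [Matrix.IsHermitian, Matrix.conjTranspose_eq_transpose_of_trivial]; exact hM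
  refine ⟨hH.eigenvectorUnitary, hH.eigenvalues, ?_, ?_, ?_⟩
  · have := (Matrix.mem_unitaryGroup_iff).1 hH.eigenvectorUnitary.2
    rwa [Matrix.star_eq_conjTranspose, Matrix.conjTranspose_eq_transpose_of_trivial] at this
  · have := hH.spectral_theorem
    rw [Unitary.conjStarAlgAut_apply] at this
    rw [Matrix.star_eq_conjTranspose, Matrix.conjTranspose_eq_transpose_of_trivial] at this
    exact this
  · intro p _
    have h := hH.roots_charpoly_eq_eigenvalues
    rw [hroots] at h
    have h2 := congrArg (Multiset.countP p) h
    rw [Multiset.countP_map, Multiset.countP_map] at h2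
    exact h2.symm

/-- Quadratic form of the Laplacian. -/
lemma wl_quad {n : ℕ} (A : Matrix (Fin n) (Fin n) ℝ) (x : Fin n → ℝ) :
    x ⬝ᵥ (Matrix.diagonal (fun i => ∑ j, A i j) - A).mulVec x =
      ∑ i, ∑ j, A i j * (x i ^ 2 - x i * x j) := by
  rw [Matrix.sub_mulVec, dotProduct]
  refine Finset.sum_congr rfl fun i _ => ?_
  rw [Pi.sub_apply, Matrix.mulVec_diagonal, Matrix.mulVec, dotProduct, Finset.sum_mul,
    ← Finset.sum_sub_distrib, Finset.mul_sum]
  exact Finset.sum_congr rfl fun j _ => by ring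

lemma wl_quad_sq {n : ℕ} (A : Matrix (Fin n) (Fin n) ℝ) (hs : A.IsSymm) (x : Fin n → ℝ) :
    ∑ i, ∑ j, A i j * (x i ^ 2 - x i * x j) = ∑ i, ∑ j, A i j * (x i - x j) ^ 2 / 2 := by
  have h : ∑ i, ∑ j, A i j * (x i ^ 2 - x i * x j) = ∑ i, ∑ j, A i j * (x j ^ 2 - x i * x j) := by
    rw [Finset.sum_comm]
    refine Finset.sum_congr rfl fun i _ => Finset.sum_congr rfl fun j _ => ?_
    rw [hs.apply i j]; ring
  have h2 : ∑ i, ∑ j, A i j * (x i - x j) ^ 2 / 2 =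
      (∑ i, ∑ j, A i j * (x i ^ 2 - x i * x j) + ∑ i, ∑ j, A i j * (x j ^ 2 - x i * x j)) / 2 := by
    simp only [← Finset.sum_add_distrib, Finset.sum_div]
    refine Finset.sum_congr rfl fun i _ => Finset.sum_congr rfl fun j _ => ?_
    ring
  rw [h2, ← h]; ring

lemma wl_lower {n : ℕ} (A : Matrix (Fin n) (Fin n) ℝ) (hs : A.IsSymm) (hn : ∀ i j, 0 ≤ A i j)
    (S : Finset (Fin n)) (x : Fin n → ℝ) (hx : ∀ i, i ∉ S → x i = 0) (d Δ : ℝ)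
    (hd : ∀ i ∈ S, d ≤ ∑ j, A i j) (hΔ : ∀ i ∈ S, ∑ j ∈ S, A i j ≤ Δ) :
    (d - Δ) * (x ⬝ᵥ x) ≤ ∑ i, ∑ j, A i j * (x i ^ 2 - x i * x j) := by
  have e1 : ∑ i, ∑ j, A i j * (x i ^ 2 - x i * x j) =
      ∑ i ∈ S, (∑ j, A i j) * x i ^ 2 - ∑ i ∈ S, ∑ j ∈ S, A i j * (x i * x j) := by
    rw [← Finset.sum_sub_distrib, ← Finset.sum_subset (Finset.subset_univ S)]
    · refine Finset.sum_congr rfl fun i _ => ?_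
      rw [Finset.sum_mul, Finset.sum_subset (Finset.subset_univ S) (f := fun j => A i j * (x i * x j)),
        ← Finset.sum_sub_distrib]
      · exact Finset.sum_congr rfl fun j _ => by ring
      · intro j _ hj; simp [hx j hj]
    · intro i _ hi; simp [hx i hi]
  have e2 : x ⬝ᵥ x = ∑ i ∈ S, x i ^ 2 := by
    rw [dotProduct, ← Finset.sum_subset (Finset.subset_univ S)]
    · exact Finset.sum_congr rfl fun j _ => by ring
    · intro i _ hi; simp [hx i hi]
  have e3 : ∑ i ∈ S, ∑ j ∈ S, A i j * (x i * x j) ≤ ∑ i ∈ S, (∑ j ∈ S, A i j) * x i ^ 2 := by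
    have a1 : ∑ i ∈ S, ∑ j ∈ S, A i j * (x i * x j) ≤
        ∑ i ∈ S, ∑ j ∈ S, (A i j * x i ^ 2 / 2 + A i j * x j ^ 2 / 2) :=
      Finset.sum_le_sum fun i _ => Finset.sum_le_sum fun j _ => by
        nlinarith [mul_nonneg (hn i j) (sq_nonneg (x i - x j))]
    have a2 : ∑ i ∈ S, ∑ j ∈ S, A i j * x j ^ 2 / 2 = ∑ i ∈ S, ∑ j ∈ S, A i j * x i ^ 2 / 2 := by
      rw [Finset.sum_comm]
      refine Finset.sum_congr rfl fun i _ => Finset.sum_congr rfl fun j _ => ?_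
      rw [hs.apply i j]
    have a3 : ∑ i ∈ S, (∑ j ∈ S, A i j) * x i ^ 2 = 2 * ∑ i ∈ S, ∑ j ∈ S, A i j * x i ^ 2 / 2 := by
      rw [Finset.mul_sum]
      refine Finset.sum_congr rfl fun i _ => ?_
      rw [Finset.sum_mul, Finset.mul_sum]
      exact Finset.sum_congr rfl fun j _ => by ring
    simp only [Finset.sum_add_distrib] at a1
    rw [a2] at a1
    linarith
  rw [e1, e2, Finset.mul_sum]
  have e4 : ∑ i ∈ S, (d - Δ) * x i ^ 2 ≤
      ∑ i ∈ S, ((∑ j, A i j) * x i ^ 2 - (∑ j ∈ S, A i j) * x i ^ 2) :=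
    Finset.sum_le_sum fun i hi => by
      nlinarith [mul_nonneg (sub_nonneg.2 (hd i hi)) (sq_nonneg (x i)),
        mul_nonneg (sub_nonneg.2 (hΔ i hi)) (sq_nonneg (x i))]
  rw [Finset.sum_sub_distrib] at e4
  linarith

lemma wl_upper {n : ℕ} (A : Matrix (Fin n) (Fin n) ℝ) (hs : A.IsSymm) (hn : ∀ i j, 0 ≤ A i j)
    (a : ℝ) (ha0 : 0 ≤ a) (ha : ∀ i j, A i j ≤ a)
    (S : Finset (Fin n)) (x : Fin n → ℝ) (c : ℝ) (hx : ∀ i, i ∉ S → x i = c) (d δ : ℝ)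
    (hd : ∀ i ∈ S, ∑ j, A i j ≤ d) (hδ : ∀ i ∈ S, δ ≤ ∑ j ∈ S, A i j)
    (hB : 0 ≤ d + S.card * a - δ) :
    ∑ i, ∑ j, A i j * (x i ^ 2 - x i * x j) ≤ (d + S.card * a - δ) * (x ⬝ᵥ x) := by
  set A' : Matrix (Fin n) (Fin n) ℝ := Matrix.of fun i j => a - A i j with hA'
  have hs' : A'.IsSymm := by
    ext i j; simp [hA', hs.apply i j]
  have hn' : ∀ i j, 0 ≤ A' i j := fun i j => by simp [hA', ha i j]
  set y : Fin n → ℝ := fun i => x i - c with hy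
  have hlow := wl_lower A' hs' hn' S y (fun i hi => by simp [hy, hx i hi]) (n * a - d)
    (S.card * a - δ) (fun i hi => by
      simp only [hA', Matrix.of_apply, Finset.sum_sub_distrib, Finset.sum_const, Finset.card_univ,
        Fintype.card_fin, nsmul_eq_mul]
      linarith [hd i hi]) (fun i hi => by
      simp only [hA', Matrix.of_apply, Finset.sum_sub_distrib, Finset.sum_const, nsmul_eq_mul]
      linarith [hδ i hi])
  rw [wl_quad_sq A' hs'] at hlow
  have hyx : ∑ i, ∑ j, A' i j * (y i - y j) ^ 2 / 2 = ∑ i, ∑ j, A' i j * (x i - x j) ^ 2 / 2 := by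
    simp [hy]
  rw [hyx] at hlow
  have hpos : 0 ≤ ∑ i, ∑ j, A' i j * (x i - x j) ^ 2 / 2 :=
    Finset.sum_nonneg fun i _ => Finset.sum_nonneg fun j _ => by
      have := hn' i j
      positivity
  have key : ∀ z : Fin n → ℝ, ∑ i, ∑ j, (z i - z j) ^ 2 / 2 = n * (z ⬝ᵥ z) - (∑ i, z i) ^ 2 := by
    intro z
    have : ∀ i j, (z i - z j) ^ 2 / 2 = z i * z i / 2 + z j * z j / 2 - z i * z j := by
      intros; ring
    simp only [this, Finset.sum_sub_distrib, Finset.sum_add_distrib, Finset.sum_const,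
      Finset.card_univ, Fintype.card_fin, nsmul_eq_mul, ← Finset.mul_sum, ← Finset.sum_div,
      ← Finset.sum_mul, dotProduct]
    ring
  have hdec : ∑ i, ∑ j, A i j * (x i - x j) ^ 2 / 2 =
      a * (∑ i, ∑ j, (x i - x j) ^ 2 / 2) - ∑ i, ∑ j, A' i j * (x i - x j) ^ 2 / 2 := by
    simp only [Finset.mul_sum, ← Finset.sum_sub_distrib]
    refine Finset.sum_congr rfl fun i _ => Finset.sum_congr rfl fun j _ => ?_
    simp only [hA', Matrix.of_apply]; ring
  have hVy : ∑ i, ∑ j, (x i - x j) ^ 2 / 2 = ∑ i, ∑ j, (y i - y j) ^ 2 / 2 := by simp [hy]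
  have k1 := key x
  have k2 := key y
  rw [← hVy] at k2
  rw [wl_quad_sq A hs, hdec]
  set V := ∑ i, ∑ j, (x i - x j) ^ 2 / 2
  set Q := ∑ i, ∑ j, A' i j * (x i - x j) ^ 2 / 2
  rcases Nat.eq_zero_or_pos n with h0 | h0
  · subst h0
    simp [V, Q, dotProduct]
  have hn0 : (0:ℝ) < n := by exact_mod_cast h0
  have hV1 : V ≤ n * (x ⬝ᵥ x) := by nlinarith [sq_nonneg (∑ i, x i)]
  have hV2 : V ≤ n * (y ⬝ᵥ y) := by nlinarith [sq_nonneg (∑ i, y i)]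
  have hxx : 0 ≤ x ⬝ᵥ x := by
    rw [dotProduct]; exact Finset.sum_nonneg fun i _ => mul_self_nonneg _
  set B := d + S.card * a - δ with hBdef
  have hβ : (n * a - d - (S.card * a - δ)) = n * a - B := by rw [hBdef]; ring
  rw [hβ] at hlow
  by_cases hb : B ≤ n * a
  · have h1 : (n * a - B) * V ≤ (n * a - B) * (n * (y ⬝ᵥ y)) :=
      mul_le_mul_of_nonneg_left hV2 (by linarith)
    have h2 : B * V ≤ B * (n * (x ⬝ᵥ x)) := mul_le_mul_of_nonneg_left hV1 hB
    have h3 := mul_le_mul_of_nonneg_left hlow hn0.le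
    refine le_of_mul_le_mul_left ?_ hn0
    linarith
  · have h1 : a * V ≤ a * (n * (x ⬝ᵥ x)) := mul_le_mul_of_nonneg_left hV1 ha0
    have h2 : (n * a) * (x ⬝ᵥ x) ≤ B * (x ⬝ᵥ x) :=
      mul_le_mul_of_nonneg_right (not_le.1 hb).le hxx
    linarith


open Finset in
/-- Weighted two-sided bound:
`d_m - Δ(G_{l_m}) ≤ λ_m(G) ≤ d_{m-1} + (m-1)·a - δ(G_{S_{m-1}})`. -/
theorem weighted_lap_eigenvalue_two_sided_bound (n m : ℕ) (hm : 2 ≤ m) (hmn : m ≤ n)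
    (A : Matrix (Fin n) (Fin n) ℝ) (hsymm : A.IsSymm)
    (hnonneg : ∀ i j, 0 ≤ A i j) (hdiag : ∀ i, A i i = 0)
    (hmono : Monotone (fun i : Fin n => ∑ j, A i j))
    (a : ℝ) (ha : IsGreatest {x : ℝ | ∃ i j, A i j = x} a)
    (eigs : Fin n → ℝ) (heigs : Monotone eigs)
    (hroots : (Matrix.diagonal (fun i => ∑ j, A i j) - A).charpoly.roots
      = Finset.univ.val.map eigs) :
    (∑ j, A ⟨m - 1, by omega⟩ j) -
      (Finset.univ.filter (fun i : Fin n => m - 1 ≤ i.val)).sup'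
        ⟨⟨m - 1, by omega⟩, by simp; omega⟩
        (fun i => ∑ j ∈ Finset.univ.filter (fun j : Fin n => m - 1 ≤ j.val), A i j)
      ≤ eigs ⟨m - 1, by omega⟩ ∧
    eigs ⟨m - 1, by omega⟩ ≤ (∑ j, A ⟨m - 2, by omega⟩ j) + (m - 1 : ℕ) * a -
      (Finset.univ.filter (fun i : Fin n => i.val ≤ m - 2)).inf'
        ⟨⟨m - 2, by omega⟩, by simp⟩
        (fun i => ∑ j ∈ Finset.univ.filter (fun j : Fin n => j.val ≤ m - 2), A i j) := by
  have hLs : (Matrix.diagonal (fun i => ∑ j, A i j) - A).IsSymm :=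
    (Matrix.isSymm_diagonal _).sub hsymm
  obtain ⟨U, μ, hU, hM, hcard⟩ := wl_spectral _ hLs eigs hroots
  have ha1 : ∀ i j, A i j ≤ a := fun i j => ha.2 ⟨i, j, rfl⟩
  have ha0 : 0 ≤ a := by
    obtain ⟨i, j, hij⟩ := ha.1
    rw [← hij]; exact hnonneg i j
  constructor
  · set Δ := (Finset.univ.filter (fun i : Fin n => m - 1 ≤ i.val)).sup'
        ⟨⟨m - 1, by omega⟩, by simp; omega⟩
        (fun i => ∑ j ∈ Finset.univ.filter (fun j : Fin n => m - 1 ≤ j.val), A i j) with hΔ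
    by_contra hlt
    push Not at hlt
    set B := (∑ j, A ⟨m - 1, by omega⟩ j) - Δ with hB
    have hM' : -(Matrix.diagonal (fun i => ∑ j, A i j) - A) =
        U * Matrix.diagonal (fun i => - μ i) * U.transpose := by
      rw [hM, ← Matrix.diagonal_neg, Matrix.mul_neg, Matrix.neg_mul]
    have h := wl_dim_count (κ := Fin (m - 1)) _ U _ hU hM'
      (LinearMap.funLeft ℝ ℝ (fun i : Fin (m - 1) => (⟨i.1, by omega⟩ : Fin n))) (-B) (by
        intro x hx
        have := wl_lower A hsymm hnonneg (Finset.univ.filter (fun i : Fin n => m - 1 ≤ i.val)) x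
          (fun i hi => by
            have hi' : i.1 < m - 1 := by
              rw [Finset.mem_filter] at hi
              by_contra hh
              exact hi ⟨Finset.mem_univ _, not_lt.1 hh⟩
            have := congrFun hx ⟨i.1, hi'⟩
            simpa [LinearMap.funLeft] using this) (∑ j, A ⟨m - 1, by omega⟩ j) Δ
          (fun i hi => by
            apply hmono
            rw [Fin.le_def]
            simpa using hi)
          (fun i hi => by
            rw [hΔ]
            exact Finset.le_sup' (fun i => ∑ j ∈ Finset.univ.filter
              (fun j : Fin n => m - 1 ≤ j.val), A i j) hi)
        rw [Matrix.neg_mulVec, dotProduct_neg, wl_quad]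
        linarith)
    rw [hcard (fun t => -t ≤ -B), Fintype.card_fin] at h
    have h2 : (Finset.univ.filter (fun i => - eigs i ≤ -B)).card ≤
        (Finset.Ioi (⟨m - 1, by omega⟩ : Fin n)).card := by
      apply Finset.card_le_card
      intro i hi
      rw [Finset.mem_Ioi]
      by_contra hh
      have h3 := heigs (not_lt.1 hh)
      have h4 : - eigs i ≤ -B := by simpa using hi
      linarith
    rw [Fin.card_Ioi] at h2
    simp only at h2
    omega
  · set δ := (Finset.univ.filter (fun i : Fin n => i.val ≤ m - 2)).inf'
        ⟨⟨m - 2, by omega⟩, by simp⟩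
        (fun i => ∑ j ∈ Finset.univ.filter (fun j : Fin n => j.val ≤ m - 2), A i j) with hδ
    by_contra hlt
    push Not at hlt
    set B := (∑ j, A ⟨m - 2, by omega⟩ j) + (m - 1 : ℕ) * a - δ with hB
    have hδle : ∀ i ∈ Finset.univ.filter (fun i : Fin n => i.val ≤ m - 2),
        δ ≤ ∑ j ∈ Finset.univ.filter (fun j : Fin n => j.val ≤ m - 2), A i j := fun i hi => by
      rw [hδ]
      exact Finset.inf'_le (fun i => ∑ j ∈ Finset.univ.filter
        (fun j : Fin n => j.val ≤ m - 2), A i j) hi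
    have hSc : (Finset.univ.filter (fun i : Fin n => i.val ≤ m - 2)).card = m - 1 := by
      have : Finset.univ.filter (fun i : Fin n => i.val ≤ m - 2) =
          Finset.Iic (⟨m - 2, by omega⟩ : Fin n) := by
        ext i; simp [Fin.le_def]
      rw [this, Fin.card_Iic]
      simp only
      omega
    have hB0 : 0 ≤ B := by
      have h1 := hδle ⟨m - 2, by omega⟩ (by simp)
      have h2 : ∑ j ∈ Finset.univ.filter (fun j : Fin n => j.val ≤ m - 2), A ⟨m - 2, by omega⟩ j
          ≤ ∑ j, A ⟨m - 2, by omega⟩ j :=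
        Finset.sum_le_sum_of_subset_of_nonneg (Finset.subset_univ _) fun j _ _ => hnonneg _ _
      have h3 : 0 ≤ ((m - 1 : ℕ) : ℝ) * a := by positivity
      rw [hB]; linarith
    have h := wl_dim_count (κ := Fin (n - m)) _ U _ hU hM
      (LinearMap.funLeft ℝ ℝ (fun i : Fin (n - m) => (⟨m - 1 + i.1, by omega⟩ : Fin n)) -
        LinearMap.funLeft ℝ ℝ (fun _ : Fin (n - m) => (⟨n - 1, by omega⟩ : Fin n))) B (by
        intro x hx
        have := wl_upper A hsymm hnonneg a ha0 ha1
          (Finset.univ.filter (fun i : Fin n => i.val ≤ m - 2)) x (x ⟨n - 1, by omega⟩)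
          (fun i hi => by
            have hi' : m - 2 < i.1 := by simpa using hi
            by_cases hl : i.1 = n - 1
            · congr 1; exact Fin.ext hl
            have := congrFun hx ⟨i.1 - (m - 1), by omega⟩
            have hii : (⟨m - 1 + (i.1 - (m - 1)), by omega⟩ : Fin n) = i := by
              ext; simp only; omega
            simp only [LinearMap.sub_apply, Pi.sub_apply, LinearMap.funLeft_apply, hii,
              Pi.zero_apply] at this
            linarith) (∑ j, A ⟨m - 2, by omega⟩ j) δ
          (fun i hi => by
            apply hmono
            rw [Fin.le_def]
            simpa using hi) hδle (by rw [hSc]; exact hB0)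
        rw [hSc] at this
        rw [wl_quad]
        exact this)
    rw [hcard (fun t => t ≤ B), Fintype.card_fin] at h
    have h2 : (Finset.univ.filter (fun i => eigs i ≤ B)).card ≤
        (Finset.Iio (⟨m - 1, by omega⟩ : Fin n)).card := by
      apply Finset.card_le_card
      intro i hi
      rw [Finset.mem_Iio]
      by_contra hh
      have h3 := heigs (not_lt.1 hh)
      have h4 : eigs i ≤ B := by simpa using hi
      linarith
    rw [Fin.card_Iio] at h2
    simp only at h2
    omega
end
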